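/- arXiv:1007.4084 — 2 statements merged into one kernel-verified Lean document; each statement's English description precedes it below -/
import Mathlib

section
/- Let p be an odd prime and let k be a positive integer. Then there exists a non-abelian UCS p-group of exponent p² and order p^{6k}, and there exists a non-abelian UCS p-group of exponent p² and order p^{14k}. -/
/-- A finite `p`-group is a UCS group if it has exactly three characteristic
subgroups. -/
def IsUCS (p : ℕ) (G : Type*) [Group G] : Prop :=
  IsPGroup p G ∧ Nat.card {H : Subgroup G // H.Characteristic} = 3

/-- The central extension of `(I → ℤ/p²)` obtained by twisting the addition with the bilinear
cocycle `(x, y) ↦ (p * x (i + α) * y (i + β))ᵢ`. -/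
@[ext]
structure TwistedGroup (p : ℕ) {I : Type} (α β : I) where
  /-- The coordinate vector of a group element. -/
  coords : I → ZMod (p ^ 2)

namespace TwistedGroup

lemma natCast_mul_self (p : ℕ) : (p : ZMod (p ^ 2)) * p = 0 := by
  rw [← pow_two, ← Nat.cast_pow, ZMod.natCast_self]

instance {p : ℕ} {I : Type} {α β : I} : One (TwistedGroup p α β) := ⟨⟨0⟩⟩

lemma one_coords {p : ℕ} {I : Type} {α β : I} (i : I) :
    (1 : TwistedGroup p α β).coords i = 0 := rfl

/-- A group element is determined by its coordinate vector. -/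
def coordsEquiv {p : ℕ} {I : Type} {α β : I} : TwistedGroup p α β ≃ (I → ZMod (p ^ 2)) where
  toFun := coords
  invFun := mk
  left_inv _ := rfl
  right_inv _ := rfl

lemma natCard_eq (p : ℕ) {I : Type} [Fintype I] (α β : I) :
    Nat.card (TwistedGroup p α β) = p ^ (2 * Fintype.card I) := by
  rw [Nat.card_congr coordsEquiv, Nat.card_fun, Nat.card_zmod, Nat.card_eq_fintype_card, pow_mul]

section Group

variable {p : ℕ} {I : Type} [AddCommGroup I] {α β : I}

instance : Mul (TwistedGroup p α β) :=
  ⟨fun x y => ⟨fun i => x.coords i + y.coords i + p * (x.coords (i + α) * y.coords (i + β))⟩⟩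

instance : Inv (TwistedGroup p α β) :=
  ⟨fun x => ⟨fun i => -x.coords i + p * (x.coords (i + α) * x.coords (i + β))⟩⟩

lemma mul_coords (x y : TwistedGroup p α β) (i : I) :
    (x * y).coords i = x.coords i + y.coords i + p * (x.coords (i + α) * y.coords (i + β)) := rfl

lemma inv_coords (x : TwistedGroup p α β) (i : I) :
    x⁻¹.coords i = -x.coords i + p * (x.coords (i + α) * x.coords (i + β)) := rfl

instance : Group (TwistedGroup p α β) :=
  Group.ofLeftAxioms
    (fun x y z => by
      ext i
      simp only [mul_coords]
      linear_combination (x.coords (i + α + α) * y.coords (i + α + β) * z.coords (i + β) -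
        x.coords (i + α) * (y.coords (i + β + α) * z.coords (i + β + β))) * natCast_mul_self p)
    (fun x => by
      ext i
      simp [mul_coords, one_coords])
    (fun x => by
      ext i
      simp only [mul_coords, one_coords, inv_coords]
      linear_combination (x.coords (i + α + α) * x.coords (i + α + β) * x.coords (i + β)) *
        natCast_mul_self p)

lemma pow_coords (x : TwistedGroup p α β) (n : ℕ) (i : I) :
    (x ^ n).coords i =
      n * x.coords i + p * (n.choose 2 * (x.coords (i + α) * x.coords (i + β))) := by
  induction n generalizing i with
  | zero => simp [one_coords]
  | succ n ih =>
    rw [pow_succ x n, mul_coords, ih, ih, Nat.choose_succ_succ' n 1, Nat.choose_one_right]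
    push_cast
    linear_combination (n.choose 2 * (x.coords (i + α + α) * x.coords (i + α + β)) *
      x.coords (i + β)) * natCast_mul_self p

lemma pow_prime_coords (hodd : Odd p) (x : TwistedGroup p α β) (i : I) :
    (x ^ p).coords i = p * x.coords i := by
  obtain ⟨m, rfl⟩ := hodd
  have h : (2 * m + 1).choose 2 = (2 * m + 1) * m := by
    rw [Nat.choose_two_right, Nat.add_sub_cancel, mul_left_comm, Nat.mul_div_cancel_left _ two_pos]
  rw [pow_coords, h, Nat.cast_mul (2 * m + 1) m]
  linear_combination (m * (x.coords (i + α) * x.coords (i + β))) * natCast_mul_self (2 * m + 1)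

lemma pow_prime_sq (hodd : Odd p) (x : TwistedGroup p α β) : x ^ p ^ 2 = 1 := by
  rw [show x ^ p ^ 2 = (x ^ p) ^ p by rw [pow_two, pow_mul]]
  ext i
  rw [pow_prime_coords hodd, pow_prime_coords hodd, one_coords, ← mul_assoc,
    natCast_mul_self, zero_mul]

/-- Translation of the coordinates, as an automorphism. -/
def translate (t : I) : TwistedGroup p α β ≃* TwistedGroup p α β where
  toFun x := ⟨fun i => x.coords (i + t)⟩
  invFun x := ⟨fun i => x.coords (i - t)⟩
  left_inv x := by ext i; simp
  right_inv x := by ext i; simp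
  map_mul' x y := by
    ext i
    simp only [mul_coords, add_right_comm i t]

/-- A sign vector compatible with the cocycle acts as an automorphism. -/
def signChange (s : I → ℤˣ) (hs : ∀ i, s i = s (i + α) * s (i + β)) :
    TwistedGroup p α β ≃* TwistedGroup p α β where
  toFun x := ⟨fun i => s i • x.coords i⟩
  invFun x := ⟨fun i => s i • x.coords i⟩
  left_inv x := by ext i; simp [smul_smul]
  right_inv x := by ext i; simp [smul_smul]
  map_mul' x y := by
    ext i
    simp only [mul_coords, smul_add]
    rw [smul_mul_smul_comm, ← hs i, mul_smul_comm]

/-- The subgroup of elements annihilated by `p`. -/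
def pTorsion (p : ℕ) (α β : I) : Subgroup (TwistedGroup p α β) where
  carrier := {x | ∀ i, (p : ZMod (p ^ 2)) * x.coords i = 0}
  mul_mem' {x y} hx hy i := by
    rw [mul_coords]
    linear_combination hx i + hy i +
      (x.coords (i + α) * y.coords (i + β)) * natCast_mul_self p
  one_mem' i := by simp [one_coords]
  inv_mem' {x} hx i := by
    rw [inv_coords]
    linear_combination -hx i + (x.coords (i + α) * x.coords (i + β)) * natCast_mul_self p

lemma mem_pTorsion {x : TwistedGroup p α β} :
    x ∈ pTorsion p α β ↔ ∀ i, (p : ZMod (p ^ 2)) * x.coords i = 0 := Iff.rfl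

lemma mem_pTorsion_iff_pow (hodd : Odd p) {x : TwistedGroup p α β} :
    x ∈ pTorsion p α β ↔ x ^ p = 1 := by
  simp [mem_pTorsion, TwistedGroup.ext_iff, funext_iff, pow_prime_coords hodd, one_coords]

lemma pTorsion_characteristic (hodd : Odd p) : (pTorsion p α β).Characteristic := by
  refine Subgroup.characteristic_iff_le_comap.2 fun φ x hx => ?_
  rw [Subgroup.mem_comap, mem_pTorsion_iff_pow hodd] at *
  rw [MulEquiv.coe_toMonoidHom, ← map_pow, hx, map_one]

/-- A subgroup that contains the `p`-torsion or is contained in it, regarded as an additive group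
of coordinate vectors. -/
def toAddSubgroup (H : Subgroup (TwistedGroup p α β))
    (hH : pTorsion p α β ≤ H ∨ H ≤ pTorsion p α β) : AddSubgroup (I → ZMod (p ^ 2)) :=
  have key : ∀ x ∈ H, ∀ y ∈ H, (⟨fun i => -(p * (x.coords (i + α) * y.coords (i + β)))⟩ :
      TwistedGroup p α β) ∈ H := by
    intro x hx y hy
    rcases hH with h | h
    · refine h fun i => ?_
      linear_combination (-x.coords (i + α) * y.coords (i + β)) * natCast_mul_self p
    · convert H.one_mem using 1
      ext i
      rw [one_coords]
      linear_combination -h hx (i + α) * y.coords (i + β)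
  { carrier := {x | mk x ∈ H}
    zero_mem' := H.one_mem
    add_mem' := by
      intro x y hx hy
      have h := H.mul_mem (H.mul_mem hx hy) (key _ hx _ hy)
      rw [Set.mem_ofPred_eq]
      convert h using 1
      ext i
      simp only [mul_coords, Pi.add_apply]
      linear_combination ((x (i + α) + y (i + α) + p * (x (i + α + α) * y (i + α + β))) *
        (x (i + β + α) * y (i + β + β))) * natCast_mul_self p
    neg_mem' := by
      intro x hx
      have h := H.mul_mem (H.inv_mem hx) (key _ hx _ hx)
      rw [Set.mem_ofPred_eq]
      convert h using 1
      ext i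
      simp only [mul_coords, inv_coords, Pi.neg_apply]
      linear_combination ((-x (i + α) + p * (x (i + α + α) * x (i + α + β))) *
        (x (i + β + α) * x (i + β + β))) * natCast_mul_self p }

lemma mem_toAddSubgroup {H : Subgroup (TwistedGroup p α β)}
    {hH : pTorsion p α β ≤ H ∨ H ≤ pTorsion p α β} {x : I → ZMod (p ^ 2)} :
    x ∈ toAddSubgroup H hH ↔ (⟨x⟩ : TwistedGroup p α β) ∈ H := Iff.rfl

end Group

lemma isUnit_of_natCast_mul_ne_zero {p : ℕ} (hp : p.Prime) {c : ZMod (p ^ 2)}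
    (hc : (p : ZMod (p ^ 2)) * c ≠ 0) : IsUnit c := by
  have : NeZero (p ^ 2) := ⟨pow_ne_zero 2 hp.ne_zero⟩
  obtain ⟨n, rfl⟩ := ZMod.natCast_zmod_surjective c
  rw [ZMod.isUnit_iff_coprime]
  refine Nat.Coprime.pow_right 2 (Nat.Coprime.symm ((Nat.Prime.coprime_iff_not_dvd hp).2 ?_))
  rintro ⟨d, rfl⟩
  apply hc
  rw [Nat.cast_mul, ← mul_assoc, natCast_mul_self, zero_mul]

lemma exists_eq_natCast_mul {p : ℕ} (hp : p.Prime) {c : ZMod (p ^ 2)}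
    (hc : (p : ZMod (p ^ 2)) * c = 0) : ∃ d, c = p * d := by
  have : NeZero (p ^ 2) := ⟨pow_ne_zero 2 hp.ne_zero⟩
  obtain ⟨n, rfl⟩ := ZMod.natCast_zmod_surjective c
  rw [← Nat.cast_mul, ZMod.natCast_eq_zero_iff, pow_two] at hc
  obtain ⟨d, rfl⟩ := Nat.dvd_of_mul_dvd_mul_left hp.pos hc
  exact ⟨d, by push_cast; rfl⟩

lemma exists_mul_eq_of_natCast_mul_eq_zero {p : ℕ} (hp : p.Prime) {c c' : ZMod (p ^ 2)}
    (hc0 : c ≠ 0) (hc : (p : ZMod (p ^ 2)) * c = 0) (hc' : (p : ZMod (p ^ 2)) * c' = 0) :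
    ∃ d, d * c = c' := by
  obtain ⟨u, rfl⟩ := exists_eq_natCast_mul hp hc
  obtain ⟨v, rfl⟩ := exists_eq_natCast_mul hp hc'
  obtain ⟨w, hw⟩ := (isUnit_of_natCast_mul_ne_zero hp hc0).exists_left_inv
  exact ⟨v * w, by linear_combination (p * v : ZMod (p ^ 2)) * hw⟩

lemma natCast_ne_zero {p : ℕ} (hp : p.Prime) : (p : ZMod (p ^ 2)) ≠ 0 := by
  rw [Ne, ZMod.natCast_eq_zero_iff]
  intro h
  have := Nat.le_of_dvd hp.pos h
  nlinarith [hp.two_le]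

section BasisVector

variable {p : ℕ} {I : Type} [AddCommGroup I] [DecidableEq I] {α β : I}

/-- The element whose only nonzero coordinate is `1`, at `i`. -/
def basisVector (p : ℕ) (α β i : I) : TwistedGroup p α β := ⟨Pi.single i 1⟩

lemma basisVector_notMem_pTorsion (hp : p.Prime) (i : I) :
    basisVector p α β i ∉ pTorsion p α β := fun h =>
  natCast_ne_zero hp (by simpa [basisVector] using h i)

lemma exponent_eq (hp : p.Prime) (hodd : Odd p) :
    Monoid.exponent (TwistedGroup p α β) = p ^ 2 := by
  have : Fact p.Prime := ⟨hp⟩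
  refine Nat.dvd_antisymm (Monoid.exponent_dvd_of_forall_pow_eq_one (pow_prime_sq hodd)) ?_
  rw [← orderOf_eq_prime_pow (x := basisVector p α β 0) (n := 1) ?_ (pow_prime_sq hodd _)]
  · exact Monoid.order_dvd_exponent _
  · rw [pow_one, ← mem_pTorsion_iff_pow hodd]
    exact basisVector_notMem_pTorsion hp 0

lemma not_commutative (hp : p.Prime) (hne : α ≠ β) :
    ¬ ∀ x y : TwistedGroup p α β, x * y = y * x := by
  intro h
  have h0 := congrFun (congrArg coords (h (basisVector p α β α) (basisVector p α β β))) 0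
  simp only [mul_coords, basisVector, zero_add, Pi.single_eq_same, Pi.single_eq_of_ne hne,
    Pi.single_eq_of_ne hne.symm] at h0
  exact natCast_ne_zero hp (by linear_combination h0)

end BasisVector

section Separating

variable {p : ℕ} {I : Type} [AddCommGroup I] [Fintype I] [DecidableEq I] {α β : I}

/-- The sign vectors compatible with the cocycle separate the coordinates. -/
def Separating (α β : I) : Prop :=
  ∀ i j : I, i ≠ j → ∃ s : I → ℤˣ, (∀ l, s l = s (l + α) * s (l + β)) ∧ s i = 1 ∧ s j = -1

lemma isUnit_two (hodd : Odd p) : IsUnit (2 : ZMod (p ^ 2)) := by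
  have := (ZMod.isUnit_iff_coprime 2 (p ^ 2)).2
    (Nat.Coprime.pow_right 2 (Nat.coprime_two_left.2 hodd))
  simpa using this

lemma single_mem_of_mem (hodd : Odd p) (hsep : Separating α β)
    (M : AddSubgroup (I → ZMod (p ^ 2)))
    (hsign : ∀ s : I → ℤˣ, (∀ l, s l = s (l + α) * s (l + β)) →
      ∀ v ∈ M, (fun l => s l • v l) ∈ M)
    (htrans : ∀ t : I, ∀ v ∈ M, (fun l => v (l + t)) ∈ M)
    {v : I → ZMod (p ^ 2)} (hv : v ∈ M) (i j : I) (c : ZMod (p ^ 2)) :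
    Pi.single j (c * v i) ∈ M := by
  have : NeZero (p ^ 2) := ⟨pow_ne_zero 2 hodd.pos.ne'⟩
  have project : ∀ T : Finset I, i ∉ T →
      ∃ w ∈ M, w i = 2 ^ T.card * v i ∧ ∀ l ∈ T, w l = 0 := by
    intro T
    induction T using Finset.induction_on with
    | empty => exact fun _ => ⟨v, hv, by simp, by simp⟩
    | insert a T ha ih =>
      intro hi
      rw [Finset.mem_insert, not_or] at hi
      obtain ⟨w, hw, hwi, hwT⟩ := ih hi.2
      obtain ⟨s, hs, hsi, hsa⟩ := hsep i a hi.1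
      refine ⟨w + fun l => s l • w l, M.add_mem hw (hsign s hs w hw), ?_, ?_⟩
      · rw [Pi.add_apply, hsi, one_smul, hwi, Finset.card_insert_of_notMem ha]
        ring
      · intro l hl
        rcases Finset.mem_insert.1 hl with rfl | hl
        · simp [hsa]
        · simp [hwT l hl]
  obtain ⟨w, hw, hwi, hw0⟩ := project (Finset.univ.erase i) (by simp)
  obtain ⟨d, hd⟩ := ((isUnit_two hodd).pow (Finset.univ.erase i).card).exists_left_inv
  have h := htrans (i - j) _ (M.nsmul_mem hw (c * d).val)
  convert h using 1
  ext l
  rw [Pi.smul_apply, nsmul_eq_mul, ZMod.natCast_zmod_val]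
  rcases eq_or_ne l j with rfl | hl
  · rw [Pi.single_eq_same, add_sub_cancel, hwi]
    linear_combination -(c * v i) * hd
  · rw [Pi.single_eq_of_ne hl, hw0, mul_zero]
    refine Finset.mem_erase.2 ⟨fun h => hl ?_, Finset.mem_univ _⟩
    rw [← add_left_inj (i - j), h, add_sub_cancel]

lemma single_mem_of_characteristic (hodd : Odd p) (hsep : Separating α β)
    {H : Subgroup (TwistedGroup p α β)} (hH : H.Characteristic)
    (hcomp : pTorsion p α β ≤ H ∨ H ≤ pTorsion p α β)
    {x : TwistedGroup p α β} (hx : x ∈ H) (i j : I) (c : ZMod (p ^ 2)) :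
    Pi.single j (c * x.coords i) ∈ toAddSubgroup H hcomp := by
  have hinv := Subgroup.characteristic_iff_le_comap.1 hH
  exact single_mem_of_mem hodd hsep _ (fun s hs v hv => hinv (signChange s hs) hv)
    (fun t v hv => hinv (translate t) hv) hx i j c

lemma pTorsion_le_of_le (hp : p.Prime) (hodd : Odd p) (hsep : Separating α β)
    {H : Subgroup (TwistedGroup p α β)} (hH : H.Characteristic) (hle : H ≤ pTorsion p α β)
    (hbot : H ≠ ⊥) : pTorsion p α β ≤ H := by
  obtain ⟨⟨x, hx⟩, hx1⟩ := H.ne_bot_iff_exists_ne_one.1 hbot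
  obtain ⟨i, hi⟩ : ∃ i, x.coords i ≠ 0 := by
    by_contra! h
    exact hx1 (Subtype.ext (TwistedGroup.ext (funext h)))
  intro y hy
  rw [← mem_toAddSubgroup (hH := Or.inr hle) (x := y.coords),
    ← Finset.univ_sum_single y.coords]
  refine AddSubgroup.sum_mem _ fun j _ => ?_
  obtain ⟨d, hd⟩ := exists_mul_eq_of_natCast_mul_eq_zero hp hi (hle hx i) (hy j)
  rw [← hd]
  exact single_mem_of_characteristic hodd hsep hH _ hx i j d

lemma characteristic_eq (hp : p.Prime) (hodd : Odd p) (hsep : Separating α β)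
    {H : Subgroup (TwistedGroup p α β)} (hH : H.Characteristic) :
    H = ⊥ ∨ H = pTorsion p α β ∨ H = ⊤ := by
  by_cases hbot : H = ⊥
  · exact Or.inl hbot
  by_cases hle : H ≤ pTorsion p α β
  · exact Or.inr (Or.inl (le_antisymm hle (pTorsion_le_of_le hp hodd hsep hH hle hbot)))
  obtain ⟨x, hx, hxt⟩ := SetLike.not_le_iff_exists.1 hle
  have hge : pTorsion p α β ≤ H := by
    have := pTorsion_characteristic (α := α) (β := β) hodd
    refine (pTorsion_le_of_le hp hodd hsep (H := H ⊓ pTorsion p α β) inferInstance inf_le_right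
      fun h => hxt ?_).trans inf_le_left
    rw [mem_pTorsion_iff_pow hodd, ← Subgroup.mem_bot, ← h]
    refine ⟨H.pow_mem hx p, (mem_pTorsion_iff_pow hodd).2 ?_⟩
    rw [← pow_mul, ← pow_two, pow_prime_sq hodd]
  obtain ⟨i, hi⟩ := not_forall.1 hxt
  obtain ⟨d, hd⟩ := (isUnit_of_natCast_mul_ne_zero hp hi).exists_left_inv
  refine Or.inr (Or.inr (eq_top_iff.2 fun y _ => ?_))
  rw [← mem_toAddSubgroup (hH := Or.inl hge) (x := y.coords),
    ← Finset.univ_sum_single y.coords]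
  refine AddSubgroup.sum_mem _ fun j _ => ?_
  have h := single_mem_of_characteristic hodd hsep hH (Or.inl hge) hx i j (y.coords j * d)
  rwa [mul_assoc, hd, mul_one] at h

lemma isUCS (hp : p.Prime) (hodd : Odd p) (hsep : Separating α β) :
    IsUCS p (TwistedGroup p α β) := by
  refine ⟨fun x => ⟨2, pow_prime_sq hodd x⟩, ?_⟩
  have hset : {H : Subgroup (TwistedGroup p α β) | H.Characteristic} =
      {⊥, pTorsion p α β, ⊤} := by
    ext H
    refine ⟨fun hH => characteristic_eq hp hodd hsep hH, ?_⟩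
    rintro (rfl | rfl | rfl)
    · exact Subgroup.botCharacteristic
    · exact pTorsion_characteristic hodd
    · exact Subgroup.topCharacteristic
  have hb := basisVector_notMem_pTorsion (α := α) (β := β) hp 0
  have h_top : pTorsion p α β ≠ ⊤ := fun h => hb (h ▸ Subgroup.mem_top _)
  have h_bot : ⊥ ≠ pTorsion p α β := by
    intro h
    have hmem : basisVector p α β 0 ^ p ∈ pTorsion p α β := by
      rw [mem_pTorsion_iff_pow hodd, ← pow_mul, ← pow_two, pow_prime_sq hodd]
    rw [← h, Subgroup.mem_bot, ← mem_pTorsion_iff_pow hodd] at hmem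
    exact hb hmem
  have h_bot_top : (⊥ : Subgroup (TwistedGroup p α β)) ≠ ⊤ := fun h =>
    h_bot (le_antisymm bot_le (h ▸ le_top))
  change Nat.card {H : Subgroup (TwistedGroup p α β) | H.Characteristic} = 3
  rw [Nat.card_coe_set_eq, hset]
  exact Set.ncard_eq_three.2 ⟨_, _, _, h_bot, h_bot_top, h_top, rfl⟩

lemma exists_isUCS (hp : p.Prime) (hodd : Odd p) (hsep : Separating α β) (hne : α ≠ β) :
    ∃ (G : Type) (_ : Group G) (_ : Finite G),
      IsUCS p G ∧ (¬ ∀ a b : G, a * b = b * a) ∧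
      Monoid.exponent G = p ^ 2 ∧ Nat.card G = p ^ (2 * Fintype.card I) :=
  have : NeZero (p ^ 2) := ⟨pow_ne_zero 2 hp.ne_zero⟩
  ⟨TwistedGroup p α β, inferInstance, Finite.of_equiv _ coordsEquiv.symm,
    isUCS hp hodd hsep, not_commutative hp hne, exponent_eq hp hodd, natCard_eq p α β⟩

end Separating

lemma separating_prod {J I : Type} [AddCommGroup J] [AddCommGroup I] [DecidableEq J] {α β : I}
    (h : Separating α β) [Nontrivial I] :
    Separating ((0, α) : J × I) (0, β) := by
  rintro ⟨u, i⟩ ⟨v, j⟩ hij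
  obtain ⟨s, hs, hsi, hsj⟩ : ∃ s : I → ℤˣ, (∀ l, s l = s (l + α) * s (l + β)) ∧
      (u = v → s i = 1) ∧ s j = -1 := by
    by_cases huv : u = v
    · subst huv
      obtain ⟨s, hs, hsi, hsj⟩ := h i j fun hij' => hij (by rw [hij'])
      exact ⟨s, hs, fun _ => hsi, hsj⟩
    · obtain ⟨i', hi'⟩ := exists_ne j
      obtain ⟨s, hs, -, hsj⟩ := h i' j hi'
      exact ⟨s, hs, fun h => absurd h huv, hsj⟩
  refine ⟨fun l => if l.1 = v then s l.2 else 1, fun l => ?_, ?_, by simpa using hsj⟩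
  · by_cases hl : l.1 = v
    · simpa [hl] using hs l.2
    · simp [hl]
  · by_cases huv : u = v
    · simpa [huv] using hsi huv
    · simp [huv]

lemma separating_of_sequence {I : Type} [AddCommGroup I] {α β : I} (m : I → ℤˣ)
    (hm : ∀ l, m l = m (l + α) * m (l + β))
    (hsep : ∀ j, j ≠ 0 → ∃ t, m t = 1 ∧ m (j + t) = -1) : Separating α β := by
  intro i j hij
  obtain ⟨t, ht, hjt⟩ := hsep (j - i) (sub_ne_zero.2 hij.symm)
  refine ⟨fun l => m (l + (t - i)), fun l => ?_, ?_, ?_⟩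
  · simp only [add_right_comm l α, add_right_comm l β]
    exact hm _
  · simpa using ht
  · rw [← hjt]
    exact congrArg m (by abel)

lemma separating_three : Separating (1 : ZMod 3) 2 :=
  separating_of_sequence (I := ZMod 3) (![1, -1, -1] : Fin 3 → ℤˣ)
    (by change ∀ l : Fin 3, _; decide)
    (by change ∀ j : Fin 3, j ≠ 0 → ∃ t : Fin 3, _; decide)

lemma separating_seven : Separating (4 : ZMod 7) 5 :=
  separating_of_sequence (I := ZMod 7) (![1, 1, -1, 1, -1, -1, -1] : Fin 7 → ℤˣ)
    (by change ∀ l : Fin 7, _; decide)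
    (by change ∀ j : Fin 7, j ≠ 0 → ∃ t : Fin 7, _; decide)

end TwistedGroup

theorem stmt18 (p k : ℕ) (hp : p.Prime) (hodd : Odd p) (hk : 1 ≤ k) :
    (∃ (G : Type) (_ : Group G) (_ : Finite G),
        IsUCS p G ∧ (¬ ∀ a b : G, a * b = b * a) ∧
        Monoid.exponent G = p ^ 2 ∧ Nat.card G = p ^ (6 * k)) ∧
    (∃ (G : Type) (_ : Group G) (_ : Finite G),
        IsUCS p G ∧ (¬ ∀ a b : G, a * b = b * a) ∧
        Monoid.exponent G = p ^ 2 ∧ Nat.card G = p ^ (14 * k)) := by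
  have : NeZero k := ⟨by omega⟩
  constructor
  · have h := TwistedGroup.exists_isUCS hp hodd
      (TwistedGroup.separating_prod (J := ZMod k) TwistedGroup.separating_three)
      fun h => absurd (congrArg Prod.snd h) (show (1 : ZMod 3) ≠ 2 by decide)
    rwa [Fintype.card_prod, ZMod.card, ZMod.card, show 2 * (k * 3) = 6 * k by ring] at h
  · have : Fact (1 < 7) := ⟨by norm_num⟩
    have h := TwistedGroup.exists_isUCS hp hodd
      (TwistedGroup.separating_prod (J := ZMod k) TwistedGroup.separating_seven)
      fun h => absurd (congrArg Prod.snd h) (show (4 : ZMod 7) ≠ 5 by decide)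
    rwa [Fintype.card_prod, ZMod.card, ZMod.card, show 2 * (k * 7) = 14 * k by ring] at h
end

section
/- Let p be an odd prime. There exists a non-abelian UCS p-group of exponent p² and order p^{10} if and only if p⁵ ≡ 1 (mod 11). -/
section

open Module

section SkewAlgebra

variable {F V : Type*} [Field F] [AddCommGroup V] [Module F V]

/-- The automorphism group of a nonassociative algebra given by its multiplication. -/
def algAut (μ : V →ₗ[F] V →ₗ[F] V) : Subgroup (V ≃ₗ[F] V) where
  carrier := {h | ∀ x y, h (μ x y) = μ (h x) (h y)}
  mul_mem' {a b} ha hb x y := by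
    simp only [Set.mem_ofPred_eq, LinearEquiv.mul_apply] at *
    rw [hb, ha]
  one_mem' x y := rfl
  inv_mem' {a} ha x y := by
    apply a.injective
    rw [ha]
    simp

theorem mem_algAut {μ : V →ₗ[F] V →ₗ[F] V} {h : V ≃ₗ[F] V} :
    h ∈ algAut μ ↔ ∀ x y, h (μ x y) = μ (h x) (h y) := Iff.rfl

/-- The automorphism group acts irreducibly. -/
def AutIrreducible (μ : V →ₗ[F] V →ₗ[F] V) : Prop :=
  ∀ W : Submodule F V, (∀ h ∈ algAut μ, ∀ x ∈ W, h x ∈ W) → W = ⊥ ∨ W = ⊤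

theorem eq_zero_of_basis (e : Basis (Fin 5) F V) {A : V [⋀^Fin 5]→ₗ[F] F} (h : A e = 0) :
    A = 0 := by
  apply e.ext_alternating
  intro v hv
  have hb := AlternatingMap.map_perm A e
    (Equiv.ofBijective v (Finite.injective_iff_bijective.mp hv))
  rw [h, smul_zero] at hb
  exact hb

/-- A skew family of alternating forms, equivariant under the automorphism group,
vanishes in odd dimension five. -/
theorem equivariant_skew_eq_zero {μ : V →ₗ[F] V →ₗ[F] V} (hirr : AutIrreducible μ)
    (h2 : (2 : F) ≠ 0) (e : Basis (Fin 5) F V)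
    (B : Dual F V →ₗ[F] Dual F V →ₗ[F] (V [⋀^Fin 5]→ₗ[F] F))
    (hskew : ∀ f g, B g f = - B f g)
    (hB : ∀ h ∈ algAut μ, ∀ f g : Dual F V,
      B (f ∘ₗ h.toLinearMap) (g ∘ₗ h.toLinearMap) = (B f g).compLinearMap h.toLinearMap) :
    B = 0 := by
  classical
  have : FiniteDimensional F V := e.finiteDimensional_of_finite
  let M : Matrix (Fin 5) (Fin 5) F := fun i j => B (e.dualBasis i) (e.dualBasis j) e
  have hM : M.transpose = -M := by
    ext i j
    change B (e.dualBasis j) (e.dualBasis i) e = - B (e.dualBasis i) (e.dualBasis j) e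
    rw [hskew (e.dualBasis i) (e.dualBasis j), AlternatingMap.neg_apply]
  have hdet : M.det = 0 := by
    have h1 : M.det = - M.det := by
      conv_lhs => rw [← Matrix.det_transpose, hM, Matrix.det_neg]
      norm_num
    have : 2 * M.det = 0 := by linear_combination h1
    simpa [h2] using this
  obtain ⟨c, hc, hcM⟩ := Matrix.exists_vecMul_eq_zero_iff.mpr hdet
  have hker : LinearMap.ker B ≠ ⊥ := by
    intro hbot
    apply hc
    let f : Dual F V := ∑ i, c i • e.dualBasis i
    have hf : f ∈ LinearMap.ker B := by
      rw [LinearMap.mem_ker]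
      apply e.dualBasis.ext
      intro j
      have hz : B f (e.dualBasis j) e = 0 := by
        have := congrFun hcM j
        simp only [Matrix.vecMul, dotProduct, M, Pi.zero_apply] at this
        have hev : ∀ d : Dual F V, B f d e = ∑ i, c i * B (e.dualBasis i) d e := by
          intro d
          let ev : (V [⋀^Fin 5]→ₗ[F] F) →ₗ[F] F :=
            { toFun := fun A => A e, map_add' := fun _ _ => rfl, map_smul' := fun _ _ => rfl }
          change ev (B f d) = ∑ i, c i * ev (B (e.dualBasis i) d)
          simp only [f, map_sum, map_smul, LinearMap.sum_apply, LinearMap.smul_apply, smul_eq_mul]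
        rw [hev]
        exact this
      exact eq_zero_of_basis e hz
    rw [hbot, Submodule.mem_bot] at hf
    exact funext fun i => (Fintype.linearIndependent_iff.mp e.dualBasis.linearIndependent) c hf i
  have hinv : ∀ h ∈ algAut μ, ∀ f ∈ LinearMap.ker B, f ∘ₗ h.toLinearMap ∈ LinearMap.ker B := by
    intro h hh f hf
    rw [LinearMap.mem_ker] at hf ⊢
    ext1 g
    have : g = (g ∘ₗ h.symm.toLinearMap) ∘ₗ h.toLinearMap := by
      ext x; simp
    rw [this, hB h hh, hf]
    simp
  rcases hirr (LinearMap.ker B).dualCoannihilator (by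
    intro h hh x hx
    rw [Submodule.mem_dualCoannihilator] at hx ⊢
    intro f hf
    exact hx _ (hinv h hh f hf)) with h0 | h1
  · have := congrArg Submodule.dualAnnihilator h0
    rw [Subspace.dualCoannihilator_dualAnnihilator_eq, Submodule.dualAnnihilator_bot] at this
    exact LinearMap.ker_eq_top.mp this
  · exfalso
    apply hker
    rw [eq_bot_iff]
    intro f hf
    rw [Submodule.mem_bot]
    ext x
    have hx : x ∈ (LinearMap.ker B).dualCoannihilator := h1 ▸ Submodule.mem_top
    exact (Submodule.mem_dualCoannihilator _).mp hx f hf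

/-- The wedge product of a trilinear and a bilinear form, as a function of five vectors. -/
def wedgeFun (T : V →ₗ[F] V →ₗ[F] V →ₗ[F] F) (S : V →ₗ[F] V →ₗ[F] F) (v : Fin 5 → V) : F :=
  T (v 0) (v 1) (v 2) * S (v 3) (v 4) - T (v 0) (v 1) (v 3) * S (v 2) (v 4)
  + T (v 0) (v 1) (v 4) * S (v 2) (v 3) + T (v 0) (v 2) (v 3) * S (v 1) (v 4)
  - T (v 0) (v 2) (v 4) * S (v 1) (v 3) + T (v 0) (v 3) (v 4) * S (v 1) (v 2)
  - T (v 1) (v 2) (v 3) * S (v 0) (v 4) + T (v 1) (v 2) (v 4) * S (v 0) (v 3)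
  - T (v 1) (v 3) (v 4) * S (v 0) (v 2) + T (v 2) (v 3) (v 4) * S (v 0) (v 1)

set_option linter.unusedSimpArgs false in
/-- The wedge product of an alternating trilinear and an alternating bilinear form. -/
def wedge (T : V →ₗ[F] V →ₗ[F] V →ₗ[F] F) (S : V →ₗ[F] V →ₗ[F] F)
    (hT1 : ∀ x y, T x x y = 0) (hT2 : ∀ x y, T x y y = 0) (hS : ∀ x, S x x = 0) :
    V [⋀^Fin 5]→ₗ[F] F where
  toFun := wedgeFun T S
  map_update_add' := by
    intro inst v i x y
    obtain rfl : inst = instDecidableEqFin 5 := Subsingleton.elim _ _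
    obtain rfl | rfl | rfl | rfl | rfl : i = 0 ∨ i = 1 ∨ i = 2 ∨ i = 3 ∨ i = 4 := by
      revert i; decide
    all_goals simp [wedgeFun]; ring
  map_update_smul' := by
    intro inst v i c x
    obtain rfl : inst = instDecidableEqFin 5 := Subsingleton.elim _ _
    obtain rfl | rfl | rfl | rfl | rfl : i = 0 ∨ i = 1 ∨ i = 2 ∨ i = 3 ∨ i = 4 := by
      revert i; decide
    all_goals simp [wedgeFun]; ring
  map_eq_zero_of_eq' v i j hv hij := by
    have hT1' : ∀ x y z, T x y z = - T y x z := by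
      intro x y z
      have := hT1 (x + y) z
      simp only [map_add, LinearMap.add_apply, hT1] at this
      linear_combination this
    have hT2' : ∀ x y z, T x y z = - T x z y := by
      intro x y z
      have := hT2 x (y + z)
      simp only [map_add, LinearMap.add_apply, hT2] at this
      linear_combination this
    have hT3 : ∀ x y, T x y x = 0 := by
      intro x y; rw [hT2', hT1, neg_zero]
    have hS' : ∀ x y, S x y = - S y x := by
      intro x y
      have := hS (x + y)
      simp only [map_add, LinearMap.add_apply, hS] at this
      linear_combination this
    wlog hlt : i < j generalizing i j
    · exact this j i hv.symm hij.symm (lt_of_le_of_ne (not_lt.mp hlt) hij.symm)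
    fin_cases i <;> fin_cases j <;> simp at hlt hv <;>
      simp only [wedgeFun, hv, hT1, hT2, hT3, hS,
        hT1' (v 1) (v 0), hT2' _ (v 1) (v 0), hS' (v 1) (v 0), hT1' (v 2) (v 0), hT2' _ (v 2) (v
        0), hS' (v 2) (v 0), hT1' (v 2) (v 1), hT2' _ (v 2) (v 1), hS' (v 2) (v 1), hT1' (v 3)
        (v 0), hT2' _ (v 3) (v 0), hS' (v 3) (v 0), hT1' (v 3) (v 1), hT2' _ (v 3) (v 1), hS' (v
        3) (v 1), hT1' (v 3) (v 2), hT2' _ (v 3) (v 2), hS' (v 3) (v 2), hT1' (v 4) (v 0), hT2'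
        _ (v 4) (v 0), hS' (v 4) (v 0), hT1' (v 4) (v 1), hT2' _ (v 4) (v 1), hS' (v 4) (v 1),
        hT1' (v 4) (v 2), hT2' _ (v 4) (v 2), hS' (v 4) (v 2), hT1' (v 4) (v 3), hT2' _ (v 4) (v
        3), hS' (v 4) (v 3)] <;>
      ring

end SkewAlgebra

end

section

open Module

section Jacobi

variable {F V : Type*} [Field F] [AddCommGroup V] [Module F V]

theorem skew_of_alternating {N : Type*} [AddCommGroup N] [Module F N]
    {μ : V →ₗ[F] V →ₗ[F] N} (hμ : ∀ x, μ x x = 0) (x y : V) :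
    μ y x = - μ x y := by
  have := hμ (x + y)
  simp only [map_add, LinearMap.add_apply, hμ, zero_add, add_zero] at this
  exact eq_neg_of_add_eq_zero_left this

theorem trace_mul_eq_zero {μ : V →ₗ[F] V →ₗ[F] V} (hirr : AutIrreducible μ)
    (hdim : finrank F V = 5) (x : V) : LinearMap.trace F V (μ x) = 0 := by
  have : FiniteDimensional F V := FiniteDimensional.of_finrank_pos (by omega)
  rcases hirr (LinearMap.ker (LinearMap.trace F V ∘ₗ μ)) (by
    intro h hh y hy
    rw [LinearMap.mem_ker, LinearMap.comp_apply] at hy ⊢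
    have : μ (h y) = h.conj (μ y) := by
      ext z
      rw [LinearEquiv.conj_apply_apply, mem_algAut.mp hh]
      simp
    rw [this, LinearMap.trace_conj', hy]) with h0 | h1
  · have := LinearMap.finrank_le_finrank_of_injective (LinearMap.ker_eq_bot.mp h0)
    rw [hdim, finrank_self] at this
    omega
  · have : x ∈ LinearMap.ker (LinearMap.trace F V ∘ₗ μ) := h1 ▸ Submodule.mem_top
    exact this

theorem span_values_eq_top {μ : V →ₗ[F] V →ₗ[F] V} (hirr : AutIrreducible μ) (h0 : μ ≠ 0) :
    Submodule.span F {z | ∃ x y, μ x y = z} = ⊤ := by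
  refine (hirr _ ?_).resolve_left ?_
  · intro h hh x hx
    induction hx using Submodule.span_induction with
    | mem z hz =>
      obtain ⟨x, y, rfl⟩ := hz
      exact Submodule.subset_span ⟨h x, h y, (mem_algAut.mp hh x y).symm⟩
    | zero => simp
    | add a b _ _ ha hb => rw [map_add]; exact add_mem ha hb
    | smul c a _ ha => rw [map_smul]; exact Submodule.smul_mem _ _ ha
  · intro hbot
    apply h0
    ext x y
    have : μ x y ∈ Submodule.span F {z | ∃ x y, μ x y = z} := Submodule.subset_span ⟨x, y, rfl⟩
    rw [hbot] at this
    exact this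

theorem dual_eq_zero_of_values {μ : V →ₗ[F] V →ₗ[F] V} (hirr : AutIrreducible μ) (h0 : μ ≠ 0)
    {f : Dual F V} (hf : ∀ x y, f (μ x y) = 0) : f = 0 := by
  rw [← LinearMap.ker_eq_top, eq_top_iff, ← span_values_eq_top hirr h0, Submodule.span_le]
  rintro _ ⟨x, y, rfl⟩
  exact hf x y

/-- The Jacobiator of a bilinear multiplication. -/
def jacobiator (μ : V →ₗ[F] V →ₗ[F] V) : V →ₗ[F] V →ₗ[F] V →ₗ[F] V :=
  LinearMap.mk₂ F (fun x y => μ (μ x y) + (μ.flip x) ∘ₗ (μ y) + (μ.flip y) ∘ₗ (μ.flip x))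
    (by intros; ext; simp; abel) (by intros; ext; simp)
    (by intros; ext; simp; abel) (by intros; ext; simp)

theorem jacobiator_apply (μ : V →ₗ[F] V →ₗ[F] V) (x y z : V) :
    jacobiator μ x y z = μ (μ x y) z + μ (μ y z) x + μ (μ z x) y := rfl

/-- The wedge of the Jacobiator and the multiplication. -/
def jacobiatorWedge {μ : V →ₗ[F] V →ₗ[F] V} (hμ : ∀ x, μ x x = 0) :
    Dual F V →ₗ[F] Dual F V →ₗ[F] (V [⋀^Fin 5]→ₗ[F] F) :=
  LinearMap.mk₂ F (fun f g => wedge ((jacobiator μ).compr₂ (LinearMap.llcomp F V V F f))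
      (μ.compr₂ g)
      (by
        intro x y
        have := skew_of_alternating hμ y x
        simp [jacobiator_apply, this, hμ])
      (by
        intro x y
        have := skew_of_alternating hμ y x
        simp [jacobiator_apply, this, hμ])
      (by intro x; simp [hμ]))
    (by intros; ext; simp [wedge, wedgeFun]; ring)
    (by intros; ext; simp [wedge, wedgeFun]; ring)
    (by intros; ext; simp [wedge, wedgeFun]; ring)
    (by intros; ext; simp [wedge, wedgeFun]; ring)

theorem jacobiatorWedge_apply {μ : V →ₗ[F] V →ₗ[F] V} (hμ : ∀ x, μ x x = 0) (f g : Dual F V)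
    (v : Fin 5 → V) : jacobiatorWedge hμ f g v =
      wedgeFun ((jacobiator μ).compr₂ (LinearMap.llcomp F V V F f)) (μ.compr₂ g) v := rfl

theorem jacobiatorWedge_self {μ : V →ₗ[F] V →ₗ[F] V} (hμ : ∀ x, μ x x = 0)
    (htr : ∀ x, LinearMap.trace F V (μ x) = 0) (e : Basis (Fin 5) F V) (f : Dual F V) :
    jacobiatorWedge hμ f f = 0 := by
  apply eq_zero_of_basis e
  rw [jacobiatorWedge_apply]
  have hC : ∀ a b, μ (e a) (e b) = ∑ k, e.repr (μ (e a) (e b)) k • e k :=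
    fun a b => (e.sum_repr _).symm
  have ht : ∀ a, ∑ k, e.repr (μ (e a) (e k)) k = 0 := by
    intro a
    rw [← htr (e a), LinearMap.trace_eq_matrix_trace F e, Matrix.trace]
    simp [LinearMap.toMatrix_apply]
  obtain ⟨C, hCd⟩ : ∃ C : Fin 5 → Fin 5 → Fin 5 → F,
    ∀ a b k, C a b k = e.repr (μ (e a) (e b)) k := ⟨_, fun _ _ _ => rfl⟩
  obtain ⟨A, hA⟩ : ∃ A : Fin 5 → Fin 5 → F, ∀ a b, A a b = f (μ (e a) (e b)) :=
    ⟨_, fun _ _ => rfl⟩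
  have hCs : ∀ a b k, C b a k = - C a b k := by
    intro a b k
    rw [hCd, hCd, skew_of_alternating hμ (e a) (e b)]
    simp
  have hC0 : ∀ a k, C a a k = 0 := by
    intro a k
    rw [hCd, hμ]
    simp
  have hAs : ∀ a b, A b a = - A a b := by
    intro a b
    rw [hA, hA, skew_of_alternating hμ (e a) (e b)]
    simp
  have hA0 : ∀ a, A a a = 0 := by
    intro a
    rw [hA, hμ]
    simp
  simp only [← hCd] at hC ht
  have hJ : ∀ a b c, f (μ (μ (e a) (e b)) (e c)) = ∑ k, C a b k * A k c := by
    intro a b c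
    rw [hC]
    simp [hA]
  have t0 := ht 0
  have t1 := ht 1
  have t2 := ht 2
  have t3 := ht 3
  have t4 := ht 4
  simp only [wedgeFun, LinearMap.compr₂_apply, LinearMap.llcomp_apply, jacobiator_apply, map_add,
    hJ, ← hA]
  simp only [Fin.sum_univ_five] at *
  simp only [hC0, hA0, hCs 0 1, hCs 0 2, hCs 0 3, hCs 0 4, hCs 1 2, hCs 1 3, hCs 1 4, hCs 2 3,
    hCs 2 4, hCs 3 4, hAs 0 1, hAs 0 2, hAs 0 3, hAs 0 4, hAs 1 2, hAs 1 3, hAs 1 4, hAs 2 3,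
    hAs 2 4, hAs 3 4] at *
  linear_combination
    (A 1 2 * A 3 4 - A 1 3 * A 2 4 + A 1 4 * A 2 3) * t0
    - (A 0 2 * A 3 4 - A 0 3 * A 2 4 + A 0 4 * A 2 3) * t1
    + (A 0 1 * A 3 4 - A 0 3 * A 1 4 + A 0 4 * A 1 3) * t2
    - (A 0 1 * A 2 4 - A 0 2 * A 1 4 + A 0 4 * A 1 2) * t3
    + (A 0 1 * A 2 3 - A 0 2 * A 1 3 + A 0 3 * A 1 2) * t4

theorem jacobiatorWedge_eq_zero {μ : V →ₗ[F] V →ₗ[F] V} (hirr : AutIrreducible μ)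
    (h2 : (2 : F) ≠ 0) (hμ : ∀ x, μ x x = 0) (e : Basis (Fin 5) F V) :
    jacobiatorWedge hμ = 0 := by
  have hdim : finrank F V = 5 := by simpa using finrank_eq_card_basis e
  have hself := jacobiatorWedge_self hμ (trace_mul_eq_zero hirr hdim) e
  refine equivariant_skew_eq_zero hirr h2 e _ (skew_of_alternating hself) ?_
  intro h hh f g
  ext v
  simp [jacobiatorWedge_apply, wedgeFun, jacobiator_apply, mem_algAut.mp hh]

end Jacobi

end

section

open Module Polynomial

section Charpoly

variable {F : Type*} [Field F]

theorem Matrix.charpoly_sq_comp {n : Type*} [Fintype n] [DecidableEq n] (M : Matrix n n F) :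
    (M * M).charpoly.comp (X ^ 2) =
      (-1) ^ Fintype.card n * (M.charpoly * M.charpoly.comp (-X)) := by
  have h1 : (M * M).charpoly.comp (X ^ 2) =
      (Matrix.scalar n (X ^ 2 : F[X]) - (M * M).map C).det := by
    rw [Matrix.charpoly, ← Polynomial.coe_compRingHom_apply, RingHom.map_det]
    congr 1
    ext i j : 1
    by_cases h : i = j
    · subst h; simp [-Matrix.map_mul]
    · simp [h, -Matrix.map_mul]
  have h2 : M.charpoly.comp (-X) = (-(Matrix.scalar n (X : F[X]) + M.map C)).det := by
    rw [Matrix.charpoly, ← Polynomial.coe_compRingHom_apply, RingHom.map_det]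
    congr 1
    ext i j : 1
    by_cases h : i = j
    · subst h; simp; ring
    · simp [h]
  have hs : (-1 : F[X]) ^ Fintype.card n * (-1) ^ Fintype.card n = 1 := by
    rw [← mul_pow]
    norm_num
  rw [h1, h2, Matrix.det_neg, mul_left_comm, ← mul_assoc ((-1) ^ _), hs, one_mul, Matrix.charpoly,
    Matrix.charmatrix, ← Matrix.det_mul]
  congr 1
  have hc : Matrix.scalar n (X : F[X]) * M.map C = M.map C * Matrix.scalar n (X : F[X]) :=
    (Matrix.scalar_commute _ (fun _ => Commute.all _ _) _).eq
  have hm : (M * M).map C = M.map C * M.map C := Matrix.map_mul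
  have := map_pow (Matrix.scalar n) (X : F[X]) 2
  simp only [RingHom.mapMatrix_apply, hm]
  rw [this, sub_mul, mul_add, mul_add, hc, pow_two]
  abel

theorem charpoly_eq_of_trace_eq_zero {V : Type*} [AddCommGroup V] [Module F V]
    [FiniteDimensional F V] (h2 : (2 : F) ≠ 0) (hdim : finrank F V = 5) (D : End F V)
    (h1 : LinearMap.trace F V D = 0) (ht : LinearMap.trace F V (D * D) = 0)
    (hd : LinearMap.det D = 0) :
    ∃ a b : F, D.charpoly = X ^ 5 - C a * X ^ 2 - C b * X := by
  let e : Basis (Fin 5) F V := (finBasisOfFinrankEq F V hdim)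
  let M := LinearMap.toMatrix e e D
  have hM : D.charpoly = M.charpoly := (LinearMap.charpoly_toMatrix D e).symm
  have hexp : ∀ N : Matrix (Fin 5) (Fin 5) F, ∃ a1 a2 a3, N.charpoly =
      X ^ 5 - C N.trace * X ^ 4 + C a3 * X ^ 3 + C a2 * X ^ 2 + C a1 * X - C N.det := by
    intro N
    refine ⟨N.charpoly.coeff 1, N.charpoly.coeff 2, N.charpoly.coeff 3, ?_⟩
    have hdeg : N.charpoly.natDegree = 5 := by simp [Matrix.charpoly_natDegree_eq_dim]
    have hlead : N.charpoly.coeff 5 = 1 := by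
      have := N.charpoly_monic.coeff_natDegree
      rwa [hdeg] at this
    conv_lhs => rw [N.charpoly.as_sum_range_C_mul_X_pow, hdeg]
    simp only [Finset.sum_range_succ, Finset.sum_range_zero, hlead]
    have h4 := Matrix.trace_eq_neg_charpoly_coeff N
    have h0 := Matrix.det_eq_sign_charpoly_coeff N
    simp only [Fintype.card_fin] at h4 h0
    rw [h4, h0]
    simp
    ring
  have htr : M.trace = 0 := by rw [← LinearMap.trace_eq_matrix_trace F e D, h1]
  have htr2 : (M * M).trace = 0 := by
    rw [← LinearMap.toMatrix_mul, ← LinearMap.trace_eq_matrix_trace F e, ht]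
  have hdet : M.det = 0 := by rw [LinearMap.det_toMatrix, hd]
  obtain ⟨a1, a2, a3, ha⟩ := hexp M
  obtain ⟨b1, b2, b3, hb⟩ := hexp (M * M)
  have hsq := Matrix.charpoly_sq_comp M
  rw [ha, hb, htr2, htr, Matrix.det_mul, hdet] at hsq
  have h8 : C (2 * a3) * X ^ 8 = (C (b3 - a3 ^ 2 - 2 * a1 ) * X ^ 6 +
      C (b2 + a2 ^ 2 - 2 * a3 * a1) * X ^ 4 + C (b1 - a1 ^ 2) * X ^ 2 : F[X]) := by
    simp only [Fintype.card_fin, mul_zero, map_zero, zero_mul, sub_zero, add_comp, mul_comp,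
      pow_comp, X_comp, C_comp] at hsq
    simp only [map_mul, map_sub, map_add, map_pow, C_ofNat]
    linear_combination -hsq
  have h8' := congrArg (fun q => coeff q 8) h8
  simp only [coeff_add, coeff_C_mul, coeff_X_pow] at h8'
  norm_num [h2] at h8'
  refine ⟨-a2, -a1, ?_⟩
  rw [hM, ha, htr, hdet, h8']
  simp
end Charpoly

end

section

open Module

section Killing

variable {F V : Type*} [Field F] [AddCommGroup V] [Module F V]

/-- The trace form of a bilinear multiplication. -/
noncomputable def traceBilin (μ : V →ₗ[F] V →ₗ[F] V) : V →ₗ[F] V →ₗ[F] F :=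
  ((LinearMap.mul F (End F V)).compr₂ (LinearMap.trace F V)).compl₁₂ μ μ

theorem traceBilin_apply (μ : V →ₗ[F] V →ₗ[F] V) (x y : V) :
    traceBilin μ x y = LinearMap.trace F V (μ x * μ y) := rfl

theorem mul_eq_commutator {μ : V →ₗ[F] V →ₗ[F] V} (hμ : ∀ x, μ x x = 0)
    (hJ : jacobiator μ = 0) (x y : V) : μ (μ x y) = μ x * μ y - μ y * μ x := by
  ext z
  have h := jacobiator_apply μ x y z
  rw [hJ] at h
  simp only [LinearMap.zero_apply] at h
  rw [skew_of_alternating hμ x (μ y z), skew_of_alternating hμ y (μ z x),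
    skew_of_alternating hμ x z, map_neg, neg_neg] at h
  rw [LinearMap.sub_apply, Module.End.mul_apply, Module.End.mul_apply, ← sub_eq_zero, h]
  abel

theorem mul_conj {μ : V →ₗ[F] V →ₗ[F] V} {h : V ≃ₗ[F] V} (hh : h ∈ algAut μ) (x : V) :
    μ (h x) = h.conj (μ x) := by
  ext z
  rw [LinearEquiv.conj_apply_apply, mem_algAut.mp hh]
  simp

theorem traceBilin_equivariant {μ : V →ₗ[F] V →ₗ[F] V} {h : V ≃ₗ[F] V} (hh : h ∈ algAut μ)
    (x y : V) : traceBilin μ (h x) (h y) = traceBilin μ x y := by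
  rw [traceBilin_apply, traceBilin_apply, mul_conj hh, mul_conj hh, Module.End.mul_eq_comp,
    ← LinearEquiv.conj_comp, LinearMap.trace_conj']
  rfl

/-- The wedge of the trilinear trace form with the wedge of two linear forms. -/
noncomputable def traceWedge {μ : V →ₗ[F] V →ₗ[F] V} (hμ : ∀ x, μ x x = 0)
    (hJ : jacobiator μ = 0) :
    Dual F V →ₗ[F] Dual F V →ₗ[F] (V [⋀^Fin 5]→ₗ[F] F) :=
  LinearMap.mk₂ F (fun f g => wedge (μ.compr₂ (traceBilin μ))
      (LinearMap.mk₂ F (fun x y => f x * g y - g x * f y)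
        (by intros; simp; ring) (by intros; simp; ring)
        (by intros; simp; ring) (by intros; simp; ring))
      (by intro x y; simp [hμ])
      (by
        intro x y
        rw [LinearMap.compr₂_apply, traceBilin_apply, mul_eq_commutator hμ hJ, sub_mul, map_sub,
          LinearMap.trace_mul_cycle, mul_assoc, sub_self])
      (by intro x; simp [mul_comm]))
    (by intros; ext; simp [wedge, wedgeFun]; ring)
    (by intros; ext; simp [wedge, wedgeFun]; ring)
    (by intros; ext; simp [wedge, wedgeFun]; ring)
    (by intros; ext; simp [wedge, wedgeFun]; ring)

theorem traceBilin_eq_zero {μ : V →ₗ[F] V →ₗ[F] V} (hirr : AutIrreducible μ) (h0 : μ ≠ 0)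
    (h2 : (2 : F) ≠ 0) (hμ : ∀ x, μ x x = 0) (e : Basis (Fin 5) F V) (hJ : jacobiator μ = 0) :
    traceBilin μ = 0 := by
  have hB : traceWedge hμ hJ = 0 := by
    refine equivariant_skew_eq_zero hirr h2 e _ ?_ ?_
    · intro f g
      ext v
      simp [traceWedge, wedge, wedgeFun]
      ring
    · intro h hh f g
      ext v
      simp [traceWedge, wedge, wedgeFun, ← mem_algAut.mp hh, traceBilin_equivariant hh]
  obtain ⟨T, hT⟩ : ∃ T : V → V → V → F, ∀ x y z, T x y z = traceBilin μ (μ x y) z :=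
    ⟨_, fun _ _ _ => rfl⟩
  have hT0 : ∀ x z, T x x z = 0 := by intro x z; simp [hT, hμ]
  have hT1 : ∀ x y z, T y x z = - T x y z := by
    intro x y z; simp [hT, skew_of_alternating hμ x y]
  have hT2 : ∀ x y z, T x z y = - T x y z := by
    intro x y z
    simp only [hT, traceBilin_apply, mul_eq_commutator hμ hJ, sub_mul, map_sub]
    have h1 := LinearMap.trace_mul_cycle F (μ x) (μ z) (μ y)
    have h2 := LinearMap.trace_mul_cycle F (μ x) (μ y) (μ z)
    linear_combination h1 + h2
  have hT3 : ∀ x y, T x y y = 0 := by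
    intro x y
    simp only [hT, traceBilin_apply, mul_eq_commutator hμ hJ, sub_mul, map_sub]
    rw [LinearMap.trace_mul_cycle, mul_assoc, sub_self]
  have hT4 : ∀ x y, T x y x = 0 := by
    intro x y; rw [hT2, hT0, neg_zero]
  have hcd : ∀ i j, e.coord i (e j) = if j = i then 1 else 0 := by
    intro i j
    simp [Basis.coord_apply, Finsupp.single_apply]
  have key : ∀ i j, traceWedge hμ hJ (e.coord i) (e.coord j) e = 0 := by
    intro i j; rw [hB]; rfl
  simp only [traceWedge, LinearMap.mk₂_apply, wedge, wedgeFun, hcd, LinearMap.compr₂_apply, ← hT,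
    AlternatingMap.coe_mk, MultilinearMap.coe_mk] at key
  have k01 := key 0 1
  have k02 := key 0 2
  have k03 := key 0 3
  have k04 := key 0 4
  have k12 := key 1 2
  have k13 := key 1 3
  have k14 := key 1 4
  have k23 := key 2 3
  have k24 := key 2 4
  have k34 := key 3 4
  simp at k01 k02 k03 k04 k12 k13 k14 k23 k24 k34
  have hTe : ∀ i j k, T (e i) (e j) (e k) = 0 := by
    intro i j k
    fin_cases i <;> fin_cases j <;> fin_cases k <;>
      simp [hT0, hT3, hT4, k01, k02, k03, k04, k12, k13, k14, k23, k24, k34, hT1 (e 0) (e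
        1), hT1 (e 0) (e 2), hT1 (e 0) (e 3), hT1 (e 0) (e 4), hT1 (e 1) (e 2), hT1 (e 1) (e
        3), hT1 (e 1) (e 4), hT1 (e 2) (e 3), hT1 (e 2) (e 4), hT1 (e 3) (e 4), hT2 _ (e 0)
        (e 2), hT2 _ (e 0) (e 3), hT2 _ (e 0) (e 4), hT2 _ (e 1) (e 2), hT2 _ (e 1) (e 3),
        hT2 _ (e 1) (e 4), hT2 _ (e 2) (e 3), hT2 _ (e 2) (e 4), hT2 _ (e 3) (e 4)]
  have hfin : μ.compr₂ (traceBilin μ) = 0 := by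
    refine e.ext fun i => e.ext fun j => e.ext fun k => ?_
    have := hTe i j k
    rw [hT] at this
    exact this
  ext x z
  have : (traceBilin μ).flip z = 0 := by
    apply dual_eq_zero_of_values hirr h0
    intro u v
    exact congrArg (fun φ => φ u v z) hfin
  exact congrArg (fun φ => φ x) this

end Killing

end

section

open Module Polynomial

section LieCase

variable {F V : Type*} [Field F] [AddCommGroup V] [Module F V]

theorem leibniz_of_jacobiator {μ : V →ₗ[F] V →ₗ[F] V} (hμ : ∀ x, μ x x = 0)
    (hJ : jacobiator μ = 0) (x u v : V) : μ x (μ u v) = μ (μ x u) v + μ u (μ x v) := by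
  rw [mul_eq_commutator hμ hJ x u]
  simp

variable [FiniteDimensional F V]

theorem cayley_hamilton_apply {D : End F V} {a b : F}
    (hD : D.charpoly = X ^ 5 - C a * X ^ 2 - C b * X) (v : V) :
    D (D (D (D (D v)))) = a • D (D v) + b • D v := by
  have h := congrArg (fun f => f v) D.aeval_self_charpoly
  simp only [hD, map_sub, map_mul, map_pow, aeval_X, aeval_C, LinearMap.sub_apply,
    Module.End.mul_apply, Module.algebraMap_end_apply, LinearMap.zero_apply] at h
  simp only [pow_succ, pow_zero, one_mul, Module.End.mul_apply] at h
  rw [← sub_eq_zero, ← h]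
  abel

theorem finrank_maxGen_of_charpoly_one {D : End F V} {a b : F} (hb : b ≠ 0)
    (hD : D.charpoly = X ^ 5 - C a * X ^ 2 - C b * X) :
    finrank F (D.maxGenEigenspace 0) = 1 := by
  rw [LinearMap.finrank_maxGenEigenspace_zero_eq]
  apply le_antisymm
  · apply natTrailingDegree_le_of_ne_zero
    rw [hD]
    simpa [coeff_X_pow, coeff_X] using hb
  · apply le_natTrailingDegree D.charpoly_monic.ne_zero
    intro m hm
    obtain rfl : m = 0 := by omega
    rw [hD]
    simp [coeff_X_pow]

theorem finrank_maxGen_of_charpoly_two {D : End F V} {a : F} (ha : a ≠ 0)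
    (hD : D.charpoly = X ^ 5 - C a * X ^ 2 - C 0 * X) :
    finrank F (D.maxGenEigenspace 0) = 2 := by
  rw [LinearMap.finrank_maxGenEigenspace_zero_eq]
  apply le_antisymm
  · apply natTrailingDegree_le_of_ne_zero
    rw [hD]
    simpa [coeff_X_pow, coeff_X] using ha
  · apply le_natTrailingDegree D.charpoly_monic.ne_zero
    intro m hm
    rw [hD]
    interval_cases m <;> simp [coeff_X_pow]

theorem coeff_one_eq_zero_of_lie {μ : V →ₗ[F] V →ₗ[F] V} (h2 : (2 : F) ≠ 0)
    (h15 : (15 : F) ≠ 0) (hdim : finrank F V = 5) (hμ : ∀ x, μ x x = 0)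
    (hJ : jacobiator μ = 0) (hperf : ∀ f : Dual F V, (∀ u v, f (μ u v) = 0) → f = 0)
    {x : V} {a b : F} (hD : (μ x).charpoly = X ^ 5 - C a * X ^ 2 - C b * X) : b = 0 := by
  by_contra hb
  obtain ⟨D, hDx⟩ : ∃ D : End F V, D = μ x := ⟨_, rfl⟩
  have hder : ∀ u v, D (μ u v) = μ (D u) v + μ u (D v) := by
    rw [hDx]; exact leibniz_of_jacobiator hμ hJ x
  have hDxx : D x = 0 := by rw [hDx, hμ]
  rw [← hDx] at hD
  have hCH := cayley_hamilton_apply hD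
  have h1 := finrank_maxGen_of_charpoly_one hb hD
  have hker : ∀ y, D y = 0 → y ∈ D.maxGenEigenspace 0 := by
    intro y hy
    rw [Module.End.mem_maxGenEigenspace]
    exact ⟨1, by simpa using hy⟩
  have hx0 : x ≠ 0 := by
    rintro rfl
    have hD0 : D = 0 := by rw [hDx, map_zero]
    have : D.maxGenEigenspace 0 = ⊤ := by
      rw [eq_top_iff]
      intro y _
      exact hker y (by rw [hD0, LinearMap.zero_apply])
    rw [this, finrank_top] at h1
    omega
  have hspan : ∀ y, D y = 0 → ∃ c : F, y = c • x := by
    intro y hy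
    obtain ⟨c, hc⟩ := (finrank_eq_one_iff_of_nonzero' (⟨x, hker x hDxx⟩ : D.maxGenEigenspace 0)
      (by simpa [Subtype.ext_iff] using hx0)).mp h1 ⟨y, hker y hy⟩
    exact ⟨c, (congrArg Subtype.val hc).symm⟩
  obtain ⟨f₀, hf₀⟩ := Module.Projective.exists_dual_eq_one F hx0
  obtain ⟨π, hπ⟩ : ∃ π : End F V, ∀ v, π v = v - b⁻¹ • (D (D (D (D v))) - a • D v) :=
    ⟨LinearMap.id - b⁻¹ • (D * D * D * D - a • D), fun v => by simp⟩
  obtain ⟨f, hf⟩ : ∃ f : Dual F V, ∀ v, f v = f₀ (π v) := ⟨f₀ ∘ₗ π, fun _ => rfl⟩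
  have hπf : ∀ v, π v = f v • x := by
    intro v
    obtain ⟨c, hc⟩ := hspan (π v) (by
      rw [hπ, map_sub, map_smul, map_sub, map_smul, hCH, add_sub_cancel_left,
        inv_smul_smul₀ hb, sub_self])
    rw [hf, hc, map_smul, hf₀, smul_eq_mul, mul_one]
  have hfD : ∀ v, f (D v) = 0 := by
    intro v
    rw [hf, hπ, hCH, add_sub_cancel_left, inv_smul_smul₀ hb, sub_self, map_zero]
  have hfx : f x = 1 := by
    rw [hf, hπ, hDxx]
    simp [hf₀]
  have hdec : ∀ v, D (D (D (D v))) = a • D v + b • v - (b * f v) • x := by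
    intro v
    have h := hπ v
    rw [hπf, eq_sub_iff_add_eq, ← eq_sub_iff_add_eq', inv_smul_eq_iff₀ hb] at h
    rw [sub_eq_iff_eq_add] at h
    rw [h, smul_sub, smul_smul]
    abel
  have hW : ∀ v, f v = 0 → D (D (D (D v))) = a • D v + b • v := by
    intro v hv
    rw [hdec, hv, mul_zero, zero_smul, sub_zero]
  have hskew : ∀ u v, f (μ (D u) v) = - f (μ u (D v)) := by
    intro u v
    rw [← add_eq_zero_iff_eq_neg, ← map_add, ← hder, hfD]
  have hfl : ∀ v, f (μ x v) = 0 := by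
    intro v
    rw [← hDx, hfD]
  have hfr : ∀ v, f (μ v x) = 0 := by
    intro v
    rw [skew_of_alternating hμ x v, map_neg, hfl, neg_zero]
  have hfsub : ∀ u, f (u - f u • x) = 0 := by
    intro u
    simp [hfx]
  have hfW : ∀ u v, f (μ (u - f u • x) (v - f v • x)) = f (μ u v) := by
    intro u v
    simp [hfl, hfr]
  have hf0 : f ≠ 0 := by
    rintro rfl
    simp at hfx
  have ha : a = 0 := by
    by_contra ha
    have h1 : ∀ u v, f u = 0 → f v = 0 → f (μ u (D v)) = 0 := by
      intro u v hu hv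
      have h : f (μ (D (D (D (D u)))) v) = f (μ u (D (D (D (D v))))) := by
        rw [hskew, hskew, hskew, hskew]
        simp
      rw [hW u hu, hW v hv] at h
      simp only [map_add, map_smul, LinearMap.add_apply, LinearMap.smul_apply, smul_eq_mul,
        hskew] at h
      have : (2 * a) * f (μ u (D v)) = 0 := by linear_combination -h
      exact (mul_eq_zero.mp this).resolve_left (mul_ne_zero h2 ha)
    apply hf0
    apply hperf
    intro u v
    rw [← hfW]
    generalize hu' : u - f u • x = u'
    generalize hv' : v - f v • x = v'
    have hu : f u' = 0 := by rw [← hu', hfsub]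
    have hv : f v' = 0 := by rw [← hv', hfsub]
    have h3 := h1 u' (D (D (D v')) - a • v') hu (by simp [hfD, hv])
    rw [map_sub, hW v' hv, map_smul, add_sub_cancel_left, map_smul, map_smul, smul_eq_mul] at h3
    exact (mul_eq_zero.mp h3).resolve_left hb
  subst ha
  simp only [zero_smul, zero_add] at hW hCH
  have h4 : ∀ u v, D (D (D (D (μ u v)))) = μ (D (D (D (D u)))) v
      + (4 : F) • μ (D (D (D u))) (D v) + (6 : F) • μ (D (D u)) (D (D v))
      + (4 : F) • μ (D u) (D (D (D v))) + μ u (D (D (D (D v)))) := by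
    intro u v
    simp only [hder, map_add]
    module
  have hR : ∀ u v, f u = 0 → f v = 0 → b • D (μ u v) + (4 : F) • D (μ (D (D (D u))) (D v))
      + (6 : F) • D (μ (D (D u)) (D (D v))) + (4 : F) • D (μ (D u) (D (D (D v)))) = 0 := by
    intro u v hu hv
    have h := hCH (μ u v)
    rw [h4, hW u hu, hW v hv] at h
    simp only [map_add, map_smul, LinearMap.smul_apply] at h
    linear_combination (norm := module) h
  have hg : ∀ u v, f u = 0 → f v = 0 → D (μ u v) = 0 := by
    intro u v hu hv
    have r0 := hR u v hu hv
    have r1 := hR (D (D (D u))) (D v) (hfD _) (hfD _)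
    have r2 := hR (D (D u)) (D (D v)) (hfD _) (hfD _)
    have r3 := hR (D u) (D (D (D v))) (hfD _) (hfD _)
    simp only [hW u hu, hW v hv, map_smul, LinearMap.smul_apply] at r1 r2 r3
    have hb1 : ∀ w : V, b • w = 0 → w = 0 := fun w hw => (smul_eq_zero.mp hw).resolve_left hb
    have r1' := hb1 (D (μ (D (D (D u))) (D v)) + (4 : F) • D (μ (D (D u)) (D (D v)))
      + (6 : F) • D (μ (D u) (D (D (D v)))) + (4 : F) • b • D (μ u v))
      (by linear_combination (norm := module) r1)
    have r2' := hb1 (D (μ (D (D u)) (D (D v))) + (4 : F) • D (μ (D u) (D (D (D v))))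
      + (6 : F) • b • D (μ u v) + (4 : F) • D (μ (D (D (D u))) (D v)))
      (by linear_combination (norm := module) r2)
    have r3' := hb1 (D (μ (D u) (D (D (D v)))) + (4 : F) • b • D (μ u v)
      + (6 : F) • D (μ (D (D (D u))) (D v)) + (4 : F) • D (μ (D (D u)) (D (D v))))
      (by linear_combination (norm := module) r3)
    have : (15 * b) • D (μ u v) = 0 := by
      linear_combination (norm := module) (-5 : F) • r0 + (4 : F) • r1' -
        (2 : F) • r2' + (4 : F) • r3'
    exact (smul_eq_zero.mp this).resolve_left (mul_ne_zero h15 hb)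
  have hmul : ∀ u v, f u = 0 → f v = 0 → μ u v = f (μ u v) • x := by
    intro u v hu hv
    obtain ⟨c, hc⟩ := hspan _ (hg u v hu hv)
    rw [hc, map_smul, hfx, smul_eq_mul, mul_one]
  apply hf0
  apply hperf
  intro u v
  by_contra hne
  rw [← hfW] at hne
  generalize hu' : u - f u • x = u' at hne
  generalize hv' : v - f v • x = v' at hne
  have hu : f u' = 0 := by rw [← hu', hfsub]
  have hv : f v' = 0 := by rw [← hv', hfsub]
  have hz : ∀ z, f z = 0 → D z ∈ Submodule.span F {x, D u', D v'} := by
    intro z hz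
    have h := jacobiator_apply μ u' v' z
    rw [hJ, hmul u' v' hu hv, hmul v' z hv hz, hmul z u' hz hu] at h
    simp only [LinearMap.zero_apply, map_smul, LinearMap.smul_apply, ← hDx] at h
    have h' : D z = (f (μ u' v'))⁻¹ • (-(f (μ v' z) • D u') - f (μ z u') • D v') := by
      rw [eq_inv_smul_iff₀ hne]
      linear_combination (norm := module) -h
    rw [h']
    refine Submodule.smul_mem _ _ (sub_mem (neg_mem (Submodule.smul_mem _ _ ?_))
      (Submodule.smul_mem _ _ ?_)) <;> exact Submodule.subset_span (by simp)
  have htop : Submodule.span F {x, D u', D v'} = ⊤ := by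
    rw [eq_top_iff]
    intro y _
    have h := hdec y
    rw [zero_smul, zero_add, eq_sub_iff_add_eq] at h
    have h' : y = b⁻¹ • (D (D (D (D y))) + (b * f y) • x) := by
      rw [h, inv_smul_smul₀ hb]
    rw [h']
    exact Submodule.smul_mem _ _ (add_mem (hz _ (hfD _))
      (Submodule.smul_mem _ _ (Submodule.subset_span (by simp))))
  classical
  have hcard := finrank_span_le_card (R := F) ({x, D u', D v'} : Set V)
  rw [htop, finrank_top, hdim] at hcard
  have : ({x, D u', D v'} : Set V).toFinset.card ≤ 3 := by
    have := Finset.card_le_three (a := x) (b := D u') (c := D v')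
    simpa using this
  omega

end LieCase

end

section

open Module Polynomial

section LieCase

variable {F V : Type*} [Field F] [AddCommGroup V] [Module F V] [FiniteDimensional F V]

theorem coeff_two_eq_zero_of_lie {μ : V →ₗ[F] V →ₗ[F] V} (h2 : (2 : F) ≠ 0)
    (hdim : finrank F V = 5) (hμ : ∀ x, μ x x = 0)
    (hJ : jacobiator μ = 0) (hperf : ∀ f : Dual F V, (∀ u v, f (μ u v) = 0) → f = 0)
    {x : V} {a : F} (hD : (μ x).charpoly = X ^ 5 - C a * X ^ 2 - C 0 * X) : a = 0 := by
  by_contra ha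
  obtain ⟨D, hDx⟩ : ∃ D : End F V, D = μ x := ⟨_, rfl⟩
  have hder : ∀ u v, D (μ u v) = μ (D u) v + μ u (D v) := by
    rw [hDx]; exact leibniz_of_jacobiator hμ hJ x
  have hDxx : D x = 0 := by rw [hDx, hμ]
  rw [← hDx] at hD
  have hCH : ∀ v, D (D (D (D (D v)))) = a • D (D v) := by
    intro v
    rw [cayley_hamilton_apply hD, zero_smul, add_zero]
  have hrk := finrank_maxGen_of_charpoly_two ha hD
  have hx0 : x ≠ 0 := by
    rintro rfl
    have hD0 : D = 0 := by rw [hDx, map_zero]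
    have : D.maxGenEigenspace 0 = ⊤ := by
      rw [eq_top_iff]
      intro y _
      rw [Module.End.mem_maxGenEigenspace]
      exact ⟨1, by simp [hD0]⟩
    rw [this, finrank_top] at hrk
    omega
  have hker : D.maxGenEigenspace 0 = LinearMap.ker (D * D) := by
    ext y
    rw [Module.End.mem_maxGenEigenspace, LinearMap.mem_ker]
    constructor
    · rintro ⟨k, hk⟩
      rw [zero_smul, sub_zero] at hk
      have hstep : ∀ m, (D ^ (3 * m)) (D (D y)) = a ^ m • D (D y) := by
        intro m
        induction m with
        | zero => simp
        | succ m ih =>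
          rw [show 3 * (m + 1) = 3 + 3 * m by ring, pow_add, Module.End.mul_apply, ih, map_smul]
          simp only [pow_succ, pow_zero, one_mul, Module.End.mul_apply, hCH, smul_smul]
      have h1 := hstep k
      have h3 : (D ^ (3 * k)) (D (D y)) = (D ^ (2 * k + 2)) ((D ^ k) y) := by
        change (D ^ (3 * k) * D * D) y = (D ^ (2 * k + 2) * D ^ k) y
        rw [← pow_succ, ← pow_succ, ← pow_add]
        congr 2
        ring
      rw [h3, hk, map_zero] at h1
      exact (smul_eq_zero.mp h1.symm).resolve_left (pow_ne_zero k ha)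
    · intro h
      exact ⟨2, by simpa [pow_two] using h⟩
  rw [hker] at hrk
  have hlt : Submodule.span F {x} ⊔ LinearMap.range (D * D) < ⊤ := by
    apply lt_top_iff_ne_top.mpr
    intro htop
    have h1 := Submodule.finrank_add_le_finrank_add_finrank (Submodule.span F {x})
      (LinearMap.range (D * D))
    have h3 := LinearMap.finrank_range_add_finrank_ker (D * D)
    rw [htop, finrank_top, finrank_span_singleton hx0] at h1
    omega
  obtain ⟨f, hf0, hf⟩ := Submodule.exists_dual_map_eq_bot_of_lt_top hlt inferInstance
  have hfz : ∀ v ∈ Submodule.span F {x} ⊔ LinearMap.range (D * D), f v = 0 := by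
    intro v hv
    have : f v ∈ Submodule.map f (Submodule.span F {x} ⊔ LinearMap.range (D * D)) :=
      Submodule.mem_map_of_mem hv
    rwa [hf, Submodule.mem_bot] at this
  have hfx : f x = 0 := hfz x (Submodule.mem_sup_left (Submodule.mem_span_singleton_self x))
  have hfDD : ∀ v, f (D (D v)) = 0 := fun v =>
    hfz _ (Submodule.mem_sup_right ⟨v, rfl⟩)
  -- the kernel of `D ^ 2` is spanned by `x` and one more vector `y`
  obtain ⟨y, hy, hspan⟩ : ∃ y, D (D y) = 0 ∧ ∀ z, D (D z) = 0 → ∃ s t : F, z = s • x + t • y := by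
    have hxk : x ∈ LinearMap.ker (D * D) := by simp [hDxx]
    obtain ⟨y, hy⟩ : ∃ y : LinearMap.ker (D * D), y ∉ Submodule.span F {(⟨x, hxk⟩ :
        LinearMap.ker (D * D))} := by
      by_contra! hall
      have htop : Submodule.span F {(⟨x, hxk⟩ : LinearMap.ker (D * D))} = ⊤ :=
        eq_top_iff.mpr fun z _ => hall z
      have h1 := finrank_span_singleton (K := F) (v := (⟨x, hxk⟩ : LinearMap.ker (D * D)))
        (by simpa [Subtype.ext_iff] using hx0)
      rw [htop, finrank_top] at h1
      omega
    have hli : LinearIndependent F ![(⟨x, hxk⟩ : LinearMap.ker (D * D)), y] := by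
      rw [LinearIndependent.pair_iff' (by simpa [Subtype.ext_iff] using hx0)]
      intro c hc
      exact hy (Submodule.mem_span_singleton.mpr ⟨c, hc⟩)
    have htop := hli.span_eq_top_of_card_eq_finrank' (by simpa using hrk.symm)
    refine ⟨y, y.2, fun z hz => ?_⟩
    have hz' : (⟨z, hz⟩ : LinearMap.ker (D * D)) ∈
      Submodule.span F (Set.range ![(⟨x, hxk⟩ : LinearMap.ker (D * D)), y]) :=
        htop ▸ Submodule.mem_top
    simp only [Matrix.range_cons, Matrix.range_empty, Set.union_empty, Set.singleton_union] at hz'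
    obtain ⟨s, t, hst⟩ := Submodule.mem_span_pair.mp hz'
    exact ⟨s, t, (congrArg Subtype.val hst).symm⟩
  have hDy : ∃ s : F, D y = s • x := by
    obtain ⟨s, t, hst⟩ := hspan (D y) (by rw [hy, map_zero])
    have h1 := congrArg D hst
    rw [hy, map_add, map_smul, map_smul, hDxx, smul_zero, zero_add] at h1
    rcases smul_eq_zero.mp h1.symm with h | h
    · exact ⟨s, by rw [hst, h, zero_smul, add_zero]⟩
    · exact ⟨0, by rw [h, zero_smul]⟩
  obtain ⟨s, hs⟩ := hDy
  have hdec : ∀ v, ∃ z w, D (D z) = 0 ∧ v = z + D (D w) := by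
    intro v
    refine ⟨v - a⁻¹ • D (D (D v)), a⁻¹ • D v, ?_, ?_⟩
    · simp [hCH, smul_smul, ha]
    · simp
  have hfD : ∀ v, f (D v) = 0 := by
    intro v
    obtain ⟨z, w, hz, rfl⟩ := hdec v
    obtain ⟨α, β, rfl⟩ := hspan z hz
    simp [hDxx, hs, hfx, hfDD]
  have hskew : ∀ u v, f (μ (D u) v) = - f (μ u (D v)) := by
    intro u v
    rw [← add_eq_zero_iff_eq_neg, ← map_add, ← hder, hfD]
  have hfl : ∀ v, f (μ x v) = 0 := by
    intro v
    rw [← hDx, hfD]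
  have hfr : ∀ v, f (μ v x) = 0 := by
    intro v
    rw [skew_of_alternating hμ x v, map_neg, hfl, neg_zero]
  have hyD : ∀ w, f (μ y (D (D w))) = 0 := by
    intro w
    rw [← neg_eq_zero, ← hskew, ← neg_eq_zero, ← hskew, hy, map_zero, LinearMap.zero_apply,
      map_zero]
  have hDD : ∀ u w, f (μ (D (D u)) (D (D w))) = 0 := by
    intro u w
    have h : f (μ (D (D (D (D (D u))))) (D (D w))) = - f (μ (D (D u)) (D (D (D (D (D w)))))) := by
      rw [hskew, hskew, hskew]
      simp
    rw [hCH, hCH] at h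
    simp only [map_smul, LinearMap.smul_apply, smul_eq_mul] at h
    have : (2 * a) * f (μ (D (D u)) (D (D w))) = 0 := by linear_combination h
    exact (mul_eq_zero.mp this).resolve_left (mul_ne_zero h2 ha)
  apply hf0
  apply hperf
  intro u v
  obtain ⟨z, w, hz, rfl⟩ := hdec u
  obtain ⟨α, β, rfl⟩ := hspan z hz
  obtain ⟨z', w', hz', rfl⟩ := hdec v
  obtain ⟨α', β', rfl⟩ := hspan z' hz'
  have hDy' : ∀ w, f (μ (D (D w)) y) = 0 := by
    intro w
    rw [skew_of_alternating hμ y, map_neg, hyD, neg_zero]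
  simp [hfl, hfr, hμ, hyD, hDD, hDy']

theorem jacobiator_ne_zero {μ : V →ₗ[F] V →ₗ[F] V} (hirr : AutIrreducible μ) (h0 : μ ≠ 0)
    (h2 : (2 : F) ≠ 0) (h15 : (15 : F) ≠ 0) (hμ : ∀ x, μ x x = 0) (hdim : finrank F V = 5) :
    jacobiator μ ≠ 0 := by
  intro hJ
  have htr := traceBilin_eq_zero hirr h0 h2 hμ (finBasisOfFinrankEq F V hdim) hJ
  have hperf : ∀ f : Dual F V, (∀ u v, f (μ u v) = 0) → f = 0 :=
    fun f hf => dual_eq_zero_of_values hirr h0 hf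
  have hpow : ∀ x, (μ x) ^ 5 = 0 := by
    intro x
    have hdet : LinearMap.det (μ x) = 0 := by
      by_cases hx : x = 0
      · rw [hx, map_zero, LinearMap.det_zero, hdim]
        norm_num
      · rw [LinearMap.det_eq_zero_iff_ker_ne_bot]
        intro hbot
        have : x ∈ LinearMap.ker (μ x) := hμ x
        rw [hbot] at this
        exact hx this
    obtain ⟨a, b, hab⟩ := charpoly_eq_of_trace_eq_zero h2 hdim (μ x)
      (trace_mul_eq_zero hirr hdim x) (by rw [← traceBilin_apply, htr]; rfl) hdet
    obtain rfl := coeff_one_eq_zero_of_lie h2 h15 hdim hμ hJ hperf hab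
    obtain rfl := coeff_two_eq_zero_of_lie h2 hdim hμ hJ hperf hab
    ext v
    have := cayley_hamilton_apply hab v
    simpa [pow_succ] using this
  let _ : LieRing V :=
    { bracket := fun x y => μ x y
      add_lie := fun x y z => by simp
      lie_add := fun x y z => by simp
      lie_self := hμ
      leibniz_lie := fun x y z => leibniz_of_jacobiator hμ hJ x y z }
  let _ : LieAlgebra F V := { lie_smul := fun t x y => map_smul (μ x) t y }
  have hnil : LieRing.IsNilpotent V := by
    rw [LieAlgebra.isNilpotent_iff_forall (R := F)]
    intro x
    exact ⟨5, hpow x⟩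
  have : Nontrivial V := nontrivial_of_finrank_pos (R := F) (by omega)
  obtain ⟨⟨z, hz⟩, hz0⟩ := @exists_ne (LieModule.maxTrivSubmodule F V V)
    (LieModule.nontrivial_max_triv_of_isNilpotent F V V) 0
  rw [LieModule.mem_maxTrivSubmodule] at hz
  have hzk : z ∈ LinearMap.ker μ := by
    rw [LinearMap.mem_ker]
    ext y
    rw [skew_of_alternating hμ y z]
    exact neg_eq_zero.mpr (hz y)
  rcases hirr (LinearMap.ker μ) (by
    intro h hh y hy
    rw [LinearMap.mem_ker] at hy ⊢
    rw [mul_conj hh, hy, map_zero]) with hbot | htop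
  · rw [hbot, Submodule.mem_bot] at hzk
    exact hz0 (Subtype.ext hzk)
  · exact h0 (LinearMap.ker_eq_top.mp htop)

end LieCase

end

section

open Module

/-- The ten two-element subsets of `Fin 5`. -/
def pairFst : Fin 10 → Fin 5 := ![3, 2, 2, 1, 1, 1, 0, 0, 0, 0]

/-- The ten two-element subsets of `Fin 5`. -/
def pairSnd : Fin 10 → Fin 5 := ![4, 4, 3, 4, 3, 2, 4, 3, 2, 1]

/-- The triples complementary to the pairs. -/
def tripleFst : Fin 10 → Fin 5 := ![0, 0, 0, 0, 0, 0, 1, 1, 1, 2]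

/-- The triples complementary to the pairs. -/
def tripleSnd : Fin 10 → Fin 5 := ![1, 1, 1, 2, 2, 3, 2, 2, 3, 3]

/-- The triples complementary to the pairs. -/
def tripleTrd : Fin 10 → Fin 5 := ![2, 3, 4, 3, 4, 4, 3, 4, 4, 4]

/-- The sign of the permutation formed by a triple and the complementary pair. -/
def tripleSign : Fin 10 → ℤ := ![1, -1, 1, 1, -1, 1, -1, 1, -1, 1]

section Weights

variable {K U : Type*} [Field K] [AddCommGroup U] [Module K U]

theorem wedgeFun_eq_sum (T : U →ₗ[K] U →ₗ[K] U →ₗ[K] K) (S : U →ₗ[K] U →ₗ[K] K)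
    (v : Fin 5 → U) : wedgeFun T S v = ∑ q, S (v (pairFst q)) (v (pairSnd q)) *
      ((tripleSign q : K) * T (v (tripleFst q)) (v (tripleSnd q)) (v (tripleTrd q))) := by
  simp [wedgeFun, Fin.sum_univ_succ, pairFst, pairSnd, tripleSign, tripleFst, tripleSnd, tripleTrd]
  ring

theorem alternating_eq_zero_of_pairs {N : Type*} [AddCommGroup N] [Module K N]
    (b : Basis (Fin 5) K U) {S : U →ₗ[K] U →ₗ[K] N} (hS : ∀ x, S x x = 0)
    (h : ∀ q, S (b (pairFst q)) (b (pairSnd q)) = 0) : S = 0 := by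
  have hd : ∀ i j : Fin 5, i = j ∨ ∃ q, (pairFst q = i ∧ pairSnd q = j) ∨
      (pairFst q = j ∧ pairSnd q = i) := by decide
  refine b.ext fun i => b.ext fun j => ?_
  rcases hd i j with rfl | ⟨q, ⟨rfl, rfl⟩ | ⟨rfl, rfl⟩⟩
  · exact hS _
  · exact h q
  · rw [skew_of_alternating hS, h q, neg_zero]
    rfl

theorem jacobiator_rotate (ν : U →ₗ[K] U →ₗ[K] U) (x y z : U) :
    jacobiator ν y z x = jacobiator ν x y z := by
  simp only [jacobiator_apply]
  abel

theorem jacobiator_swap {ν : U →ₗ[K] U →ₗ[K] U} (hν : ∀ x, ν x x = 0) (x y z : U) :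
    jacobiator ν y x z = - jacobiator ν x y z := by
  simp only [jacobiator_apply]
  rw [skew_of_alternating hν x y, skew_of_alternating hν z x, skew_of_alternating hν y z]
  simp
  abel

theorem jacobiator_self {ν : U →ₗ[K] U →ₗ[K] U} (hν : ∀ x, ν x x = 0) (x z : U) :
    jacobiator ν x x z = 0 := by
  simp only [jacobiator_apply]
  rw [skew_of_alternating hν x z]
  simp [hν]

theorem dual_jacobiator_eq_zero_of_triples (b : Basis (Fin 5) K U) {ν : U →ₗ[K] U →ₗ[K] U}
    (hν : ∀ x, ν x x = 0) {f : Dual K U}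
    (h : ∀ q, f (jacobiator ν (b (tripleFst q)) (b (tripleSnd q)) (b (tripleTrd q))) = 0)
    (x y z : U) : f (jacobiator ν x y z) = 0 := by
  have hd : ∀ i j k : Fin 5, i = j ∨ j = k ∨ k = i ∨ ∃ q,
      (tripleFst q = i ∧ tripleSnd q = j ∧ tripleTrd q = k) ∨
      (tripleFst q = j ∧ tripleSnd q = k ∧ tripleTrd q = i) ∨
      (tripleFst q = k ∧ tripleSnd q = i ∧ tripleTrd q = j) ∨
      (tripleFst q = j ∧ tripleSnd q = i ∧ tripleTrd q = k) ∨
      (tripleFst q = i ∧ tripleSnd q = k ∧ tripleTrd q = j) ∨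
      (tripleFst q = k ∧ tripleSnd q = j ∧ tripleTrd q = i) := by decide
  have h0 : (jacobiator ν).compr₂ (LinearMap.llcomp K U U K f) = 0 := by
    refine b.ext fun i => b.ext fun j => b.ext fun k => ?_
    change f (jacobiator ν (b i) (b j) (b k)) = 0
    rcases hd i j k with rfl | rfl | rfl | ⟨q, h1 | h1 | h1 | h1 | h1 | h1⟩
    · rw [jacobiator_self hν, map_zero]
    · rw [← jacobiator_rotate, jacobiator_self hν, map_zero]
    · rw [← jacobiator_rotate, ← jacobiator_rotate, jacobiator_self hν, map_zero]
    · obtain ⟨rfl, rfl, rfl⟩ := h1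
      exact h q
    · obtain ⟨rfl, rfl, rfl⟩ := h1
      rw [← jacobiator_rotate]
      exact h q
    · obtain ⟨rfl, rfl, rfl⟩ := h1
      rw [jacobiator_rotate]
      exact h q
    · obtain ⟨rfl, rfl, rfl⟩ := h1
      rw [jacobiator_swap hν, map_neg, h q, neg_zero]
    · obtain ⟨rfl, rfl, rfl⟩ := h1
      rw [← jacobiator_rotate, jacobiator_swap hν, map_neg, jacobiator_rotate, h q, neg_zero]
    · obtain ⟨rfl, rfl, rfl⟩ := h1
      rw [← jacobiator_rotate, jacobiator_swap hν, map_neg, h q, neg_zero]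
  exact congrArg (fun φ => φ x y z) h0

variable {A : Type*} [AddCommGroup A] [DecidableEq A]

theorem weight_count_le (b : Basis (Fin 5) K U) {ν : U →ₗ[K] U →ₗ[K] U}
    (hν : ∀ x, ν x x = 0) (hB : jacobiatorWedge hν = 0)
    (hperf : ∀ f : Dual K U, (∀ x y, f (ν x y) = 0) → f = 0)
    (hjac : ∀ f : Dual K U, (∀ x y z, f (jacobiator ν x y z) = 0) → f = 0)
    (s : Fin 5 → A) (hs : ∀ i j k, s k ≠ s i + s j → b.coord k (ν (b i) (b j)) = 0) (w : A) :
    Fintype.card {k // s k = w} + Fintype.card {k // ∑ i, s i - s k = w} ≤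
      Fintype.card {q // s (pairFst q) + s (pairSnd q) = w} := by
  have hsJ : ∀ i j l k, s k ≠ s i + s j + s l →
      b.coord k (jacobiator ν (b i) (b j) (b l)) = 0 := by
    have h1 : ∀ i j l k, s k ≠ s i + s j + s l → b.coord k (ν (ν (b i) (b j)) (b l)) = 0 := by
      intro i j l k hk
      rw [← b.sum_repr (ν (b i) (b j))]
      simp only [map_sum, map_smul, LinearMap.sum_apply, LinearMap.smul_apply, smul_eq_mul]
      apply Finset.sum_eq_zero
      intro m _
      by_cases hm : s m = s i + s j
      · rw [hs m l k (by rw [hm]; exact hk), mul_zero]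
      · have := hs i j m hm
        rw [Basis.coord_apply] at this
        rw [this, zero_mul]
    intro i j l k hk
    rw [jacobiator_apply, map_add, map_add, h1 i j l k hk, h1 j l i k, h1 l i j k]
    · simp
    · rwa [show s l + s i + s j = s i + s j + s l by abel]
    · rwa [show s j + s l + s i = s i + s j + s l by abel]
  have hsum : ∀ q, s (tripleFst q) + s (tripleSnd q) + s (tripleTrd q) =
      ∑ i, s i - (s (pairFst q) + s (pairSnd q)) := by
    intro q
    rw [Fin.sum_univ_five]
    fin_cases q <;> simp [pairFst, pairSnd, tripleFst, tripleSnd, tripleTrd] <;> abel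
  let R : Matrix {k // s k = w} {q // s (pairFst q) + s (pairSnd q) = w} K :=
    fun k q => b.coord k (ν (b (pairFst q)) (b (pairSnd q)))
  let Q : Matrix {k // ∑ i, s i - s k = w} {q // s (pairFst q) + s (pairSnd q) = w} K :=
    fun k q => (tripleSign q : K) *
      b.coord k (jacobiator ν (b (tripleFst q)) (b (tripleSnd q)) (b (tripleTrd q)))
  have hR : LinearIndependent K R.row := by
    rw [Fintype.linearIndependent_iff]
    intro g hg
    let f : Dual K U := ∑ k, g k • b.coord k
    have hf : f = 0 := by
      apply hperf
      have h0 : ν.compr₂ f = 0 := by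
        apply alternating_eq_zero_of_pairs b (by intro x; simp [hν])
        intro q
        by_cases hq : s (pairFst q) + s (pairSnd q) = w
        · have := congrFun hg ⟨q, hq⟩
          simpa [f, R, Matrix.row] using this
        · simp only [f, LinearMap.compr₂_apply, LinearMap.sum_apply, LinearMap.smul_apply]
          apply Finset.sum_eq_zero
          intro k _
          rw [hs _ _ _ (by rw [k.2]; exact fun h => hq h.symm), smul_zero]
      intro x y
      exact congrArg (fun φ => φ x y) h0
    intro i
    have := congrArg (fun φ => φ (b i)) hf
    simpa [f, Finsupp.single_apply, ← Subtype.ext_iff] using this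
  have hQ : LinearIndependent K Q.row := by
    rw [Fintype.linearIndependent_iff]
    intro g hg
    let f : Dual K U := ∑ k, g k • b.coord k
    have hf : f = 0 := by
      apply hjac
      apply dual_jacobiator_eq_zero_of_triples b hν
      intro q
      by_cases hq : s (pairFst q) + s (pairSnd q) = w
      · have h1 := congrFun hg ⟨q, hq⟩
        have h2 : (tripleSign q : K) *
            f (jacobiator ν (b (tripleFst q)) (b (tripleSnd q)) (b (tripleTrd q))) = 0 := by
          rw [← Pi.zero_apply (M := fun _ => K)
            (⟨q, hq⟩ : {q // s (pairFst q) + s (pairSnd q) = w}),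
            ← h1]
          simp [f, Q, Matrix.row, Finset.mul_sum, mul_left_comm]
        refine (mul_eq_zero.mp h2).resolve_left ?_
        fin_cases q <;> simp [tripleSign]
      · simp only [f, LinearMap.sum_apply, LinearMap.smul_apply]
        apply Finset.sum_eq_zero
        intro k _
        rw [hsJ, smul_zero]
        intro h
        apply hq
        rw [hsum] at h
        rw [← k.2, h]
        abel
    intro i
    have := congrArg (fun φ => φ (b i)) hf
    simpa [f, Finsupp.single_apply, ← Subtype.ext_iff] using this
  have hRQ : R * Q.transpose = 0 := by
    ext k l
    have h := congrArg (fun φ => φ (b.coord l) (b.coord k) b) hB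
    simp only [jacobiatorWedge_apply, wedgeFun_eq_sum, LinearMap.zero_apply,
      AlternatingMap.zero_apply, LinearMap.compr₂_apply, LinearMap.llcomp_apply] at h
    rw [Matrix.mul_apply, Matrix.zero_apply, ← h]
    rw [← Finset.sum_filter_of_ne (p := fun q => s (pairFst q) + s (pairSnd q) = w),
      ← Finset.sum_subtype_eq_sum_filter]
    · simp [Matrix.transpose, R, Q]
    intro q _ hq
    by_contra hne
    exact hq (by rw [hs _ _ _ (by rw [k.2]; exact fun h => hne h.symm), zero_mul])
  have := Matrix.rank_add_rank_le_card_of_mul_eq_zero hRQ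
  rwa [Matrix.rank_transpose, hR.rank_matrix, hQ.rank_matrix] at this

end Weights

end

section

open Module

theorem sum_eq_of_count_le {ι κ τ A M : Type*} [Fintype ι] [Fintype κ] [Fintype τ] [DecidableEq A]
    [AddCommMonoid M] {a : ι → A} {b : κ → A} {c : τ → A}
    (hcard : Fintype.card τ ≤ Fintype.card ι + Fintype.card κ)
    (h : ∀ w, Fintype.card {i // a i = w} + Fintype.card {i // b i = w} ≤
      Fintype.card {i // c i = w}) (φ : A → M) :
    ∑ i, φ (c i) = ∑ i, φ (a i) + ∑ i, φ (b i) := by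
  have h1 : Finset.univ.val.map a + Finset.univ.val.map b = Finset.univ.val.map c := by
    apply Multiset.eq_of_le_of_card_le
    · rw [Multiset.le_iff_count]
      intro w
      have := h w
      simp only [Fintype.card_subtype, Finset.card_def, Finset.filter_val] at this
      simp only [Multiset.count_add, Multiset.count_map, eq_comm (a := w)]
      exact this
    · simpa using hcard
  have h2 := congrArg (fun m => (m.map φ).sum) h1
  simp only [Multiset.map_add, Multiset.sum_add, Multiset.map_map] at h2
  exact h2.symm

section PowerSums

variable {R : Type*} [CommRing R] {s : Fin 5 → R}

/-- The weights of the sums over pairs are the weights together with the complementary weights. -/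
def PairWeights {A : Type*} [AddCommGroup A] (s : Fin 5 → A) : Prop :=
  ∀ (M : Type) [AddCommMonoid M] (φ : A → M), ∑ q, φ (s (pairFst q) + s (pairSnd q)) =
    ∑ k, φ (s k) + ∑ k, φ (∑ i, s i - s k)

theorem PairWeights.sum_eq_zero {R : Type} [CommRing R] {s : Fin 5 → R} (h : PairWeights s) :
    s 0 + s 1 + s 2 + s 3 + s 4 = 0 := by
  have h1 := h R id
  simp [Fin.sum_univ_succ, pairFst, pairSnd] at h1
  linear_combination -h1

theorem PairWeights.sum_sq_eq_zero {R : Type} [CommRing R] {s : Fin 5 → R} (h : PairWeights s) :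
    s 0 ^ 2 + s 1 ^ 2 + s 2 ^ 2 + s 3 ^ 2 + s 4 ^ 2 = 0 := by
  have h1 := h R (· ^ 2)
  have h0 := h.sum_eq_zero
  have h4 : s 4 = -(s 0 + s 1 + s 2 + s 3) := by linear_combination h0
  rw [Fin.sum_univ_five s, h0] at h1
  simp [Fin.sum_univ_succ, pairFst, pairSnd] at h1
  linear_combination h1 - (s 0 + s 1 + s 2 + s 3 + s 4) * h0

theorem PairWeights.sum_cube_eq_zero {R : Type} [CommRing R] {s : Fin 5 → R} (h : PairWeights s) :
    s 0 ^ 3 + s 1 ^ 3 + s 2 ^ 3 + s 3 ^ 3 + s 4 ^ 3 = 0 := by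
  have h1 := h R (· ^ 3)
  have h0 := h.sum_eq_zero
  rw [Fin.sum_univ_five s, h0] at h1
  simp [Fin.sum_univ_succ, pairFst, pairSnd] at h1
  linear_combination h1 - 3 * (s 0 ^ 2 + s 1 ^ 2 + s 2 ^ 2 + s 3 ^ 2 + s 4 ^ 2) * h0

theorem PairWeights.sum_pow_four_eq_zero {R : Type} [CommRing R] {s : Fin 5 → R}
    (h : PairWeights s) :
    5 * (s 0 ^ 4 + s 1 ^ 4 + s 2 ^ 4 + s 3 ^ 4 + s 4 ^ 4) = 0 := by
  have h1 := h R (· ^ 4)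
  have h0 := h.sum_eq_zero
  have h2 := h.sum_sq_eq_zero
  rw [Fin.sum_univ_five s, h0] at h1
  simp [Fin.sum_univ_succ, pairFst, pairSnd] at h1
  linear_combination -h1 + 4 * (s 0 ^ 3 + s 1 ^ 3 + s 2 ^ 3 + s 3 ^ 3 + s 4 ^ 3) * h0 +
    3 * (s 0 ^ 2 + s 1 ^ 2 + s 2 ^ 2 + s 3 ^ 2 + s 4 ^ 2) * h2

theorem PairWeights.sum_pow_five_eq_zero {R : Type} [CommRing R] {s : Fin 5 → R}
    (h : PairWeights s) :
    11 * (s 0 ^ 5 + s 1 ^ 5 + s 2 ^ 5 + s 3 ^ 5 + s 4 ^ 5) = 0 := by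
  have h1 := h R (· ^ 5)
  have h0 := h.sum_eq_zero
  have h2 := h.sum_sq_eq_zero
  have e : ∀ x : R, (-x) ^ 5 = - x ^ 5 := fun x => by ring
  rw [Fin.sum_univ_five s, h0] at h1
  simp [Fin.sum_univ_succ, pairFst, pairSnd, e] at h1
  linear_combination -h1 + 5 * (s 0 ^ 4 + s 1 ^ 4 + s 2 ^ 4 + s 3 ^ 4 + s 4 ^ 4) * h0 +
    10 * (s 0 ^ 3 + s 1 ^ 3 + s 2 ^ 3 + s 3 ^ 3 + s 4 ^ 3) * h2

theorem PairWeights.pow_five_eq {F : Type} [Field F] {s : Fin 5 → F} (h : PairWeights s)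
    (h2 : (2 : F) ≠ 0) (h3 : (3 : F) ≠ 0) (h5 : (5 : F) ≠ 0) (i : Fin 5) :
    s i ^ 5 = s 0 * s 1 * s 2 * s 3 * s 4 := by
  have q1 := h.sum_eq_zero
  have q2 := h.sum_sq_eq_zero
  have q3 := h.sum_cube_eq_zero
  have q4 := (mul_eq_zero.mp h.sum_pow_four_eq_zero).resolve_left h5
  have e2 : s 0 * s 1 + s 0 * s 2 + s 0 * s 3 + s 0 * s 4 + s 1 * s 2 + s 1 * s 3 + s 1 * s 4 +
      s 2 * s 3 + s 2 * s 4 + s 3 * s 4 = 0 := by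
    refine (mul_eq_zero.mp ?_).resolve_left h2
    linear_combination (s 0 + s 1 + s 2 + s 3 + s 4) * q1 - q2
  have e3 : s 0 * s 1 * s 2 + s 0 * s 1 * s 3 + s 0 * s 1 * s 4 + s 0 * s 2 * s 3 +
      s 0 * s 2 * s 4 + s 0 * s 3 * s 4 + s 1 * s 2 * s 3 + s 1 * s 2 * s 4 + s 1 * s 3 * s 4 +
      s 2 * s 3 * s 4 = 0 := by
    refine (mul_eq_zero.mp ?_).resolve_left h3
    linear_combination (s 0 + s 1 + s 2 + s 3 + s 4) * e2 -
      (s 0 + s 1 + s 2 + s 3 + s 4) * q2 + q3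
  have e4 : s 0 * s 1 * s 2 * s 3 + s 0 * s 1 * s 2 * s 4 + s 0 * s 1 * s 3 * s 4 +
      s 0 * s 2 * s 3 * s 4 + s 1 * s 2 * s 3 * s 4 = 0 := by
    refine (mul_eq_zero.mp ?_).resolve_left (mul_ne_zero h2 h2)
    linear_combination (s 0 + s 1 + s 2 + s 3 + s 4) * e3 -
      (s 0 ^ 2 + s 1 ^ 2 + s 2 ^ 2 + s 3 ^ 2 + s 4 ^ 2) * e2 +
      (s 0 + s 1 + s 2 + s 3 + s 4) * q3 - q4
  have key : (s i - s 0) * (s i - s 1) * (s i - s 2) * (s i - s 3) * (s i - s 4) = 0 := by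
    fin_cases i <;> simp
  linear_combination key + s i ^ 4 * q1 - s i ^ 3 * e2 + s i ^ 2 * e3 - s i * e4

theorem PairWeights.eq_zero_of_large {F : Type} [Field F] {s : Fin 5 → F} (h : PairWeights s)
    (h2 : (2 : F) ≠ 0) (h3 : (3 : F) ≠ 0) (h5 : (5 : F) ≠ 0) (h11 : (11 : F) ≠ 0) (i : Fin 5) :
    s i = 0 := by
  have q5 := (mul_eq_zero.mp h.sum_pow_five_eq_zero).resolve_left h11
  simp only [h.pow_five_eq h2 h3 h5] at q5
  have : s 0 * s 1 * s 2 * s 3 * s 4 = 0 := by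
    refine (mul_eq_zero.mp ?_).resolve_left h5
    linear_combination q5
  exact pow_eq_zero_iff (by norm_num) |>.mp ((h.pow_five_eq h2 h3 h5 i).trans this)

theorem pairWeights_two (a b c d e : ZMod 2) (he : e = -(a + b + c + d))
    (h : [d + e, c + e, c + d, b + e, b + d, b + c, a + e, a + d, a + c, a + b].count 0 =
      [a, b, c, d, e].count 0 + [-a, -b, -c, -d, -e].count 0) :
    a = 0 ∧ b = 0 ∧ c = 0 ∧ d = 0 ∧ e = 0 := by
  subst he
  revert a b c d
  decide

theorem pairWeights_three (a b c d e : ZMod 3) (he : e = -(a + b + c + d))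
    (h : [d + e, c + e, c + d, b + e, b + d, b + c, a + e, a + d, a + c, a + b].count 0 =
      [a, b, c, d, e].count 0 + [-a, -b, -c, -d, -e].count 0) :
    a = 0 ∧ b = 0 ∧ c = 0 ∧ d = 0 ∧ e = 0 := by
  subst he
  revert a b c d
  decide +kernel

set_option synthInstance.maxHeartbeats 200000 in
set_option synthInstance.maxSize 1000 in
theorem pairWeights_five (a b c d e : ZMod 5) (he : e = -(a + b + c + d))
    (h2 : a * a + b * b + c * c + d * d + e * e = 0)
    (h3 : a * a * a + b * b * b + c * c * c + d * d * d + e * e * e = 0)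
    (h : [d + e, c + e, c + d, b + e, b + d, b + c, a + e, a + d, a + c, a + b].count a =
      [a, b, c, d, e].count a + [-a, -b, -c, -d, -e].count a) :
    (a = 0 ∧ b = 0 ∧ c = 0 ∧ d = 0 ∧ e = 0) ∨ [a, b, c, d, e].Nodup := by
  subst he
  revert a b c d
  decide +kernel

theorem PairWeights.count_eq {A : Type} [AddCommGroup A] [DecidableEq A] {s : Fin 5 → A}
    (h : PairWeights s) (h0 : s 0 + s 1 + s 2 + s 3 + s 4 = 0) (w : A) :
    [s 3 + s 4, s 2 + s 4, s 2 + s 3, s 1 + s 4, s 1 + s 3, s 1 + s 2, s 0 + s 4, s 0 + s 3,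
      s 0 + s 2, s 0 + s 1].count w = [s 0, s 1, s 2, s 3, s 4].count w +
      [-s 0, -s 1, -s 2, -s 3, -s 4].count w := by
  obtain ⟨c, hc⟩ : ∃ c : A → ℕ, ∀ x l, (x :: l).count w = l.count w + c x :=
    ⟨_, fun x l => List.count_cons⟩
  have h1 := h ℕ c
  rw [Fin.sum_univ_five s, h0] at h1
  simp [Fin.sum_univ_succ, pairFst, pairSnd] at h1
  simp only [hc, List.count_nil]
  omega

theorem PairWeights.trichotomy {r : ℕ} [Fact r.Prime] {s : Fin 5 → ZMod r} (h : PairWeights s) :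
    s = 0 ∨ (r = 5 ∧ Function.Injective s) ∨ (r = 11 ∧ ∀ i j, s i ^ 5 = s j ^ 5) := by
  have hr : r.Prime := Fact.out
  have hne : ∀ q : ℕ, q.Prime → r ≠ q → ((q : ℕ) : ZMod r) ≠ 0 := by
    intro q hq hrq h0
    exact hrq ((Nat.prime_dvd_prime_iff_eq hr hq).mp ((ZMod.natCast_eq_zero_iff _ _).mp h0))
  have h0 := h.sum_eq_zero
  have hs4 : s 4 = -(s 0 + s 1 + s 2 + s 3) := by linear_combination h0
  have hz : (s 0 = 0 ∧ s 1 = 0 ∧ s 2 = 0 ∧ s 3 = 0 ∧ s 4 = 0) → s = 0 := by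
    rintro ⟨h0, h1, h2, h3, h4⟩
    ext i
    fin_cases i <;> assumption
  by_cases hr2 : r = 2
  · subst hr2
    exact Or.inl (hz (pairWeights_two _ _ _ _ _ hs4 (h.count_eq h0 0)))
  by_cases hr3 : r = 3
  · subst hr3
    exact Or.inl (hz (pairWeights_three _ _ _ _ _ hs4 (h.count_eq h0 0)))
  by_cases hr5 : r = 5
  · subst hr5
    have h2 := h.sum_sq_eq_zero
    have h3 := h.sum_cube_eq_zero
    simp only [pow_succ, pow_zero, one_mul] at h2 h3
    rcases pairWeights_five _ _ _ _ _ hs4 h2 h3 (h.count_eq h0 (s 0)) with h1 | h1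
    · exact Or.inl (hz h1)
    · refine Or.inr (Or.inl ⟨rfl, ?_⟩)
      rw [← List.nodup_ofFn]
      simpa [List.ofFn_succ] using h1
  have h2 := hne 2 (by norm_num) hr2
  have h3 := hne 3 (by norm_num) hr3
  have h5 := hne 5 (by norm_num) hr5
  by_cases hr11 : r = 11
  · exact Or.inr (Or.inr ⟨hr11, fun i j => by
      rw [h.pow_five_eq h2 h3 h5, h.pow_five_eq h2 h3 h5]⟩)
  · exact Or.inl (funext (h.eq_zero_of_large h2 h3 h5 (hne 11 (by norm_num) hr11)))

end PowerSums

end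

section

open Module TensorProduct

section BaseChange

variable {F V : Type*} [Field F] [AddCommGroup V] [Module F V]

theorem span_jacobiator_eq_top {μ : V →ₗ[F] V →ₗ[F] V} (hirr : AutIrreducible μ)
    (hJ : jacobiator μ ≠ 0) :
    Submodule.span F {w | ∃ x y z, jacobiator μ x y z = w} = ⊤ := by
  refine (hirr _ ?_).resolve_left ?_
  · intro h hh x hx
    rw [mem_algAut] at hh
    induction hx using Submodule.span_induction with
    | mem w hw =>
      obtain ⟨x, y, z, rfl⟩ := hw
      exact Submodule.subset_span ⟨h x, h y, h z, by simp [jacobiator_apply, hh]⟩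
    | zero => simp
    | add a b _ _ ha hb => rw [map_add]; exact add_mem ha hb
    | smul c a _ ha => rw [map_smul]; exact Submodule.smul_mem _ _ ha
  · intro hbot
    apply hJ
    ext x y z
    have : jacobiator μ x y z ∈ Submodule.span F {w | ∃ x y z, jacobiator μ x y z = w} :=
      Submodule.subset_span ⟨x, y, z, rfl⟩
    rw [hbot] at this
    exact this

variable (K : Type*) [Field K] [Algebra F K]

/-- Extension of scalars of a bilinear multiplication. -/
abbrev mulBaseChange (μ : V →ₗ[F] V →ₗ[F] V) : K ⊗[F] V →ₗ[K] K ⊗[F] V →ₗ[K] K ⊗[F] V :=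
  LinearMap.BilinMap.baseChange K μ

variable {K}

theorem mulBaseChange_self {μ : V →ₗ[F] V →ₗ[F] V} (hμ : ∀ x, μ x x = 0) (x : K ⊗[F] V) :
    mulBaseChange K μ x x = 0 := by
  have hskew : ∀ x y : K ⊗[F] V, mulBaseChange K μ x y + mulBaseChange K μ y x = 0 := by
    intro x y
    induction x using TensorProduct.induction_on with
    | zero => simp
    | add a b ha hb =>
      simp only [map_add, LinearMap.add_apply]
      rw [add_add_add_comm, ha, hb, add_zero]
    | tmul a v =>
      induction y using TensorProduct.induction_on with
      | zero => simp
      | add a b ha hb =>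
        simp only [map_add, LinearMap.add_apply]
        rw [add_add_add_comm, ha, hb, add_zero]
      | tmul c w =>
        rw [LinearMap.BilinMap.baseChange_tmul, LinearMap.BilinMap.baseChange_tmul,
          skew_of_alternating hμ v w, mul_comm c a, tmul_neg, add_neg_cancel]
  induction x using TensorProduct.induction_on with
  | zero => simp
  | add a b ha hb =>
    simp only [map_add, LinearMap.add_apply]
    rw [ha, hb, zero_add, add_zero, add_comm, hskew]
  | tmul a v => rw [LinearMap.BilinMap.baseChange_tmul, hμ, tmul_zero]

theorem jacobiator_baseChange (μ : V →ₗ[F] V →ₗ[F] V) (x y z : V) :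
    jacobiator (mulBaseChange K μ) (1 ⊗ₜ x) (1 ⊗ₜ y) (1 ⊗ₜ z) = 1 ⊗ₜ jacobiator μ x y z := by
  simp [jacobiator_apply, LinearMap.BilinMap.baseChange_tmul, tmul_add]

theorem dual_baseChange_eq_zero_of_span {S : Set V} (hS : Submodule.span F S = ⊤)
    {f : Dual K (K ⊗[F] V)} (h : ∀ v ∈ S, f (1 ⊗ₜ v) = 0) : f = 0 := by
  have h1 : (f.restrictScalars F) ∘ₗ (TensorProduct.mk F K V 1) = 0 :=
    LinearMap.ext_on hS h
  ext v
  exact LinearMap.congr_fun h1 v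

theorem coord_baseChange {ι : Type*} (e : Basis ι F V) (i : ι) (v : V) :
    (Algebra.TensorProduct.basis K e).coord i (1 ⊗ₜ v) = algebraMap F K (e.coord i v) := by
  simp [Algebra.algebraMap_eq_smul_one]

theorem jacobiatorWedge_baseChange {μ : V →ₗ[F] V →ₗ[F] V} (hμ : ∀ x, μ x x = 0)
    (hW : jacobiatorWedge hμ = 0) (e : Basis (Fin 5) F V) :
    jacobiatorWedge (mulBaseChange_self (K := K) hμ) = 0 := by
  let E := Algebra.TensorProduct.basis K e
  refine E.dualBasis.ext fun i => E.dualBasis.ext fun j => E.ext_alternating fun σ _ => ?_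
  have h := congrArg (fun φ => φ (e.coord i) (e.coord j) (fun k => e (σ k))) hW
  simp only [jacobiatorWedge_apply, wedgeFun_eq_sum, LinearMap.zero_apply,
      AlternatingMap.zero_apply, LinearMap.compr₂_apply, LinearMap.llcomp_apply] at h
  have h' := congrArg (algebraMap F K) h
  simp only [jacobiatorWedge_apply, wedgeFun_eq_sum, LinearMap.zero_apply,
      AlternatingMap.zero_apply, LinearMap.compr₂_apply, LinearMap.llcomp_apply]
  simp only [E, Algebra.TensorProduct.basis_apply, jacobiator_baseChange, Basis.coe_dualBasis,
    coord_baseChange, LinearMap.BilinMap.baseChange_tmul, mul_one]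
  simpa using h'

end BaseChange

end

section

open Module TensorProduct

section Diagonalize

variable {K U : Type*} [Field K] [IsAlgClosed K] [AddCommGroup U] [Module K U]
  [FiniteDimensional K U]

theorem exists_eigenbasis {n : ℕ} (hU : finrank K U = n) {T : End K U} {r : ℕ} (hr : (r : K) ≠ 0)
    (hT : T ^ r = 1) : ∃ (b : Basis (Fin n) K U) (c : Fin n → K),
      (∀ i, T (b i) = c i • b i) ∧ ∀ i, c i ^ r = 1 := by
  classical
  have hss : T.IsSemisimple := by
    apply End.isSemisimple_of_squarefree_aeval_eq_zero
      (Polynomial.X_pow_sub_one_separable_iff.mpr hr).squarefree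
    simp [hT]
  have hinternal := DirectSum.isInternal_submodule_of_iSupIndep_of_iSup_eq_top
    T.eigenspaces_iSupIndep hss.iSup_eigenspace_eq_top
  let I := (c : K) × Fin (finrank K (T.eigenspace c))
  let v : Basis I K U := hinternal.collectedBasis fun c ↦ finBasis K (T.eigenspace c)
  have : Fintype I :=
    FiniteDimensional.fintypeBasisIndex v
  let e := Fintype.equivFinOfCardEq ((finrank_eq_card_basis v).symm.trans hU)
  let b := v.reindex e
  let c : Fin n → K := fun i => (e.symm i).1
  have hc : ∀ i, T (b i) = c i • b i := by
    intro i
    rw [Basis.reindex_apply]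
    exact End.mem_eigenspace_iff.mp (hinternal.collectedBasis_mem _ _)
  refine ⟨b, c, hc, fun i => ?_⟩
  have h1 : ∀ n : ℕ, (T ^ n) (b i) = c i ^ n • b i := by
    intro n
    induction n with
    | zero => simp
    | succ n ih => rw [pow_succ', End.mul_apply, ih, map_smul, hc, smul_smul, pow_succ]
  have h2 := h1 r
  rw [hT, End.one_apply] at h2
  have h3 : (c i ^ r - 1) • b i = 0 := by rw [sub_smul, ← h2, one_smul, sub_self]
  exact sub_eq_zero.mp ((smul_eq_zero.mp h3).resolve_right (b.ne_zero i))

end Diagonalize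

section Weights

variable {F V K : Type*} [Field F] [AddCommGroup V] [Module F V] [Field K] [Algebra F K]

theorem mulBaseChange_map {μ : V →ₗ[F] V →ₗ[F] V} {h : V ≃ₗ[F] V} (hh : h ∈ algAut μ)
    (x y : K ⊗[F] V) : (h : V →ₗ[F] V).baseChange K (mulBaseChange K μ x y) =
      mulBaseChange K μ ((h : V →ₗ[F] V).baseChange K x) ((h : V →ₗ[F] V).baseChange K y) := by
  induction x using TensorProduct.induction_on with
  | zero => simp
  | add a b ha hb => simp only [map_add, LinearMap.add_apply, ha, hb]
  | tmul a v =>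
    induction y using TensorProduct.induction_on with
    | zero => simp
    | add a b ha hb => simp only [map_add, ha, hb]
    | tmul c w =>
      simp [LinearMap.BilinMap.baseChange_tmul, mem_algAut.mp hh]

theorem exists_pairWeights [FiniteDimensional F V] [IsAlgClosed K] {μ : V →ₗ[F] V →ₗ[F] V}
    (hirr : AutIrreducible μ) (h0 : μ ≠ 0)
    (h2 : (2 : F) ≠ 0) (h15 : (15 : F) ≠ 0) (hμ : ∀ x, μ x x = 0) (hdim : finrank F V = 5)
    {h : V ≃ₗ[F] V} (hh : h ∈ algAut μ) {r : ℕ} [Fact r.Prime] (hr : (r : F) ≠ 0)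
    (hhr : h ^ r = 1) {ζ : K} (hζ : IsPrimitiveRoot ζ r) :
    ∃ (b : Basis (Fin 5) K (K ⊗[F] V)) (s : Fin 5 → ZMod r), PairWeights s ∧
      ∀ i, (h : V →ₗ[F] V).baseChange K (b i) = ζ ^ (s i).val • b i := by
  set T : End K (K ⊗[F] V) := (h : V →ₗ[F] V).baseChange K with hTdef
  have hTr : T ^ r = 1 := by
    have h1 : (h : V →ₗ[F] V) ^ r = 1 := by
      have := congrArg (LinearEquiv.automorphismGroup.toLinearMapMonoidHom (R := F)) hhr
      rwa [map_pow, map_one] at this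
    rw [hTdef, ← LinearMap.baseChange_pow, h1, LinearMap.baseChange_one]
  have hrK : (r : K) ≠ 0 := by
    rw [← map_natCast (algebraMap F K)]
    exact (map_ne_zero _).mpr hr
  have hdimK : finrank K (K ⊗[F] V) = 5 := by rw [finrank_baseChange, hdim]
  obtain ⟨b, c, hc, hcr⟩ := exists_eigenbasis hdimK hrK hTr
  have hr0 : NeZero r := ⟨(Fact.out : r.Prime).ne_zero⟩
  choose m hm hmc using fun i => hζ.eq_pow_of_pow_eq_one (hcr i)
  let s : Fin 5 → ZMod r := fun i => (m i : ZMod r)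
  have hsv : ∀ i, ζ ^ (s i).val = c i := by
    intro i
    rw [ZMod.val_natCast, Nat.mod_eq_of_lt (hm i), hmc]
  have hadd : ∀ a b : ZMod r, ζ ^ (a + b).val = ζ ^ a.val * ζ ^ b.val := by
    intro a b
    rw [ZMod.val_add, ← pow_add]
    conv_rhs => rw [← Nat.mod_add_div (a.val + b.val) r, pow_add, pow_mul, hζ.pow_eq_one, one_pow,
      mul_one]
  have hinj : ∀ a b : ZMod r, ζ ^ a.val = ζ ^ b.val → a = b := by
    intro a b hab
    exact ZMod.val_injective r (hζ.pow_inj (ZMod.val_lt a) (ZMod.val_lt b) hab)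
  refine ⟨b, s, ?_, fun i => by rw [hc, hsv]⟩
  let e := finBasisOfFinrankEq F V hdim
  have hW := jacobiatorWedge_eq_zero hirr h2 hμ e
  have hJ := jacobiator_ne_zero hirr h0 h2 h15 hμ hdim
  have hs : ∀ i j k, s k ≠ s i + s j → b.coord k (mulBaseChange K μ (b i) (b j)) = 0 := by
    intro i j k hk
    have h1 := mulBaseChange_map (K := K) hh (b i) (b j)
    rw [← hTdef, hc, hc, map_smul, map_smul, LinearMap.smul_apply, smul_smul] at h1
    have h3 : ∀ u, b.coord k (T u) = c k * b.coord k u := by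
      intro u
      have : b.coord k ∘ₗ T = c k • b.coord k := by
        refine b.ext fun l => ?_
        simp only [LinearMap.comp_apply, hc, map_smul, LinearMap.smul_apply, smul_eq_mul,
          Basis.coord_apply, Basis.repr_self]
        by_cases hlk : l = k
        · rw [hlk]
        · simp [hlk]
      exact LinearMap.congr_fun this u
    have h4 := congrArg (b.coord k) h1
    rw [h3, map_smul, smul_eq_mul] at h4
    have h5 : (c k - c j * c i) * b.coord k (mulBaseChange K μ (b i) (b j)) = 0 := by
      linear_combination h4
    refine (mul_eq_zero.mp h5).resolve_left fun h6 => hk (hinj _ _ ?_)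
    rw [hadd, hsv, hsv, hsv]
    linear_combination h6
  have hle := weight_count_le b (mulBaseChange_self hμ) (jacobiatorWedge_baseChange hμ hW e)
    (fun f hf => dual_baseChange_eq_zero_of_span (span_values_eq_top hirr h0) (by
      rintro _ ⟨x, y, rfl⟩
      simpa [LinearMap.BilinMap.baseChange_tmul] using hf (1 ⊗ₜ x) (1 ⊗ₜ y)))
    (fun f hf => dual_baseChange_eq_zero_of_span (span_jacobiator_eq_top hirr hJ) (by
      rintro _ ⟨x, y, z, rfl⟩
      rw [← jacobiator_baseChange, hf])) s hs
  intro M _ φ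
  exact sum_eq_of_count_le (by simp) hle φ

end Weights

end

section

open Module TensorProduct

section BaseChangeEnd

variable {F V K : Type*} [Field F] [AddCommGroup V] [Module F V] [FiniteDimensional F V]
  [Field K] [Algebra F K]

theorem baseChange_end_injective {f g : V →ₗ[F] V} (h : f.baseChange K = g.baseChange K) :
    f = g := by
  let e := finBasis F V
  ext v
  refine e.ext_elem fun i => (algebraMap F K).injective ?_
  have h1 := LinearMap.congr_fun h (1 ⊗ₜ v)
  rw [LinearMap.baseChange_tmul, LinearMap.baseChange_tmul] at h1
  have h2 := congrArg ((Algebra.TensorProduct.basis K e).coord i) h1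
  rwa [coord_baseChange, coord_baseChange] at h2

theorem hasEigenvalue_baseChange_iff {f : V →ₗ[F] V} {c : K} :
    End.HasEigenvalue (f.baseChange K) c ↔ Polynomial.aeval c f.charpoly = 0 := by
  rw [End.hasEigenvalue_iff_isRoot_charpoly, LinearMap.charpoly_baseChange, Polynomial.IsRoot,
    Polynomial.eval_map_algebraMap]

end BaseChangeEnd

theorem eq_of_eigenbasis {K U ι : Type*} [Field K] [AddCommGroup U] [Module K U]
    [Fintype ι] (b : Basis ι K U) {T : End K U} {c : ι → K} (hc : ∀ i, T (b i) = c i • b i)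
    {d : K} {u : U} (hu : T u = d • u) {i : ι} (hi : b.repr u i ≠ 0) : d = c i := by
  have : b.coord i ∘ₗ T = c i • b.coord i := by
    classical
    refine b.ext fun l => ?_
    simp only [LinearMap.comp_apply, hc, map_smul, LinearMap.smul_apply, smul_eq_mul,
      Basis.coord_apply, Basis.repr_self]
    by_cases hl : l = i
    · rw [hl]
    · simp [hl]
  have h1 := LinearMap.congr_fun this u
  simp only [LinearMap.comp_apply, hu, map_smul, LinearMap.smul_apply, smul_eq_mul,
    Basis.coord_apply] at h1
  exact mul_right_cancel₀ hi h1

theorem exists_eigenvalue_eq {K U ι : Type*} [Field K] [AddCommGroup U] [Module K U]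
    [Fintype ι] (b : Basis ι K U) {T : End K U} {c : ι → K} (hc : ∀ i, T (b i) = c i • b i)
    {d : K} (hd : T.HasEigenvalue d) : ∃ i, d = c i := by
  obtain ⟨u, hu⟩ := hd.exists_hasEigenvector
  have h1 : ∃ i, b.repr u i ≠ 0 := by
    by_contra! h
    exact hu.2 (b.ext_elem fun i => by rw [h, map_zero, Finsupp.zero_apply])
  obtain ⟨i, hi⟩ := h1
  exact ⟨i, eq_of_eigenbasis b hc hu.apply_eq_smul hi⟩

section PrimeOrder

variable {p : ℕ} [Fact p.Prime] {V : Type*} [AddCommGroup V] [Module (ZMod p) V]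
  [FiniteDimensional (ZMod p) V]

theorem eq_five_or_eleven {K : Type*} [Field K] [IsAlgClosed K] [Algebra (ZMod p) K]
    {μ : V →ₗ[ZMod p] V →ₗ[ZMod p] V} (hirr : AutIrreducible μ) (h0 : μ ≠ 0)
    (hp : 7 ≤ p) (hμ : ∀ x, μ x x = 0) (hdim : finrank (ZMod p) V = 5)
    {h : V ≃ₗ[ZMod p] V} (hh : h ∈ algAut μ) {r : ℕ} [Fact r.Prime] (hr : r ≠ p)
    (hhr : h ^ r = 1) (hh1 : h ≠ 1) {ζ : K} (hζ : IsPrimitiveRoot ζ r) :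
    ((p : ZMod 11) ^ 5 = 1) ∨ (r = 5 ∧ ∃ (b : Basis (Fin 5) K (K ⊗[ZMod p] V))
      (s : Fin 5 → ZMod r), Function.Injective s ∧
      ∀ i, (h : V →ₗ[ZMod p] V).baseChange K (b i) = ζ ^ (s i).val • b i) := by
  have hpp : p.Prime := Fact.out
  have hne : ∀ q : ℕ, q.Prime → q ≠ p → (q : ZMod p) ≠ 0 := by
    intro q hq hqp h0
    exact hqp ((Nat.prime_dvd_prime_iff_eq hpp hq).mp ((ZMod.natCast_eq_zero_iff _ _).mp h0)).symm
  have h2 : (2 : ZMod p) ≠ 0 := hne 2 (by norm_num) (by omega)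
  have h15 : (15 : ZMod p) ≠ 0 := by
    have := mul_ne_zero (hne 3 (by norm_num) (by omega)) (hne 5 (by norm_num) (by omega))
    norm_num at this
    exact this
  obtain ⟨b, s, hs, hb⟩ := exists_pairWeights hirr h0 h2 h15 hμ hdim hh (hne r Fact.out hr) hhr hζ
  have hs0 : s ≠ 0 := by
    rintro rfl
    apply hh1
    apply LinearEquiv.toLinearMap_injective
    apply baseChange_end_injective (K := K)
    refine b.ext fun i => ?_
    rw [hb]
    simp
  rcases hs.trichotomy with h1 | ⟨h5, hi⟩ | ⟨h11, h5⟩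
  · exact absurd h1 hs0
  · exact Or.inr ⟨h5, b, s, hi, hb⟩
  · left
    subst h11
    have hs1 : s 0 ≠ 0 := by
      intro h
      apply hs0
      ext i
      have := h5 i 0
      rw [h, zero_pow (by norm_num)] at this
      exact pow_eq_zero_iff (by norm_num) |>.mp this
    have he : End.HasEigenvalue ((h : V →ₗ[ZMod p] V).baseChange K) (ζ ^ (s 0).val) :=
      End.hasEigenvalue_of_hasEigenvector (x := b 0)
        ⟨End.mem_eigenspace_iff.mpr (hb 0), b.ne_zero 0⟩
    have he' : End.HasEigenvalue ((h : V →ₗ[ZMod p] V).baseChange K) ((ζ ^ (s 0).val) ^ p) := by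
      rw [hasEigenvalue_baseChange_iff] at he ⊢
      have h1 := congrArg (FiniteField.frobeniusAlgHom (ZMod p) K) he
      rw [map_zero, ← Polynomial.aeval_algHom_apply] at h1
      simpa using h1
    obtain ⟨i, hi⟩ := exists_eigenvalue_eq b hb he'
    have hi' : (p : ZMod 11) * s 0 = s i := by
      rw [← pow_mul] at hi
      have h0 := pow_mod_orderOf ζ ((s 0).val * p)
      rw [← hζ.eq_orderOf] at h0
      have h1 := hζ.pow_inj (Nat.mod_lt _ (by norm_num)) (ZMod.val_lt (s i)) (h0.trans hi)
      have h2 := congrArg (Nat.cast : ℕ → ZMod 11) h1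
      simpa [mul_comm] using h2
    have h6 := h5 i 0
    rw [← hi', mul_pow] at h6
    exact mul_right_cancel₀ (pow_ne_zero 5 hs1) (h6.trans (one_mul _).symm)

end PrimeOrder

end

section

open Module TensorProduct

theorem exists_eq_smul_of_eigenbasis {K U ι : Type*} [Field K] [AddCommGroup U] [Module K U]
    [Fintype ι] (b : Basis ι K U) {T : End K U} {c : ι → K} (hc : ∀ i, T (b i) = c i • b i)
    (hinj : Function.Injective c) {d : K} {u v : U} (hu0 : u ≠ 0) (hu : T u = d • u)
    (hv : T v = d • v) : ∃ x : K, v = x • u := by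
  have h1 : ∃ i, b.repr u i ≠ 0 := by
    by_contra! h
    exact hu0 (b.ext_elem fun i => by rw [h, map_zero, Finsupp.zero_apply])
  obtain ⟨i, hi⟩ := h1
  have hdi := eq_of_eigenbasis b hc hu hi
  have hz : ∀ w, T w = d • w → ∀ j, j ≠ i → b.repr w j = 0 := by
    intro w hw j hj
    by_contra h
    exact hj (hinj ((eq_of_eigenbasis b hc hw h).symm.trans hdi))
  refine ⟨b.repr v i / b.repr u i, b.ext_elem fun j => ?_⟩
  rw [map_smul, Finsupp.smul_apply, smul_eq_mul]
  by_cases hj : j = i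
  · subst hj
    rw [div_mul_cancel₀ _ hi]
  · rw [hz v hv j hj, hz u hu j hj, mul_zero]

theorem IsPGroup.exists_pow_eq_one {G : Type*} [Group G] [Finite G] [Nontrivial G] {q : ℕ}
    [Fact q.Prime] (h : IsPGroup q G) : ∃ g : G, g ≠ 1 ∧ g ^ q = 1 := by
  obtain ⟨n, hn, hc⟩ := h.nontrivial_iff_card.mp inferInstance
  obtain ⟨g, hg⟩ := exists_prime_orderOf_dvd_card' (G := G) q (hc ▸ dvd_pow_self q hn.ne')
  refine ⟨g, ?_, hg ▸ pow_orderOf_eq_one g⟩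
  rintro rfl
  rw [orderOf_one] at hg
  exact (Fact.out : q.Prime).one_lt.ne hg

theorem isPGroup_of_forall_prime_dvd {G : Type*} [Group G] [Finite G] {q : ℕ}
    (h : ∀ r : ℕ, r.Prime → r ∣ Nat.card G → r = q) : IsPGroup q G :=
  IsPGroup.of_card (Nat.eq_prime_pow_of_unique_prime_dvd Nat.card_pos.ne'
    (fun {r} hr hd => h r hr hd))

section Irreducible

variable {F V : Type*} [Field F] [AddCommGroup V] [Module F V]

theorem AutIrreducible.eq_zero_of_fixed {μ : V →ₗ[F] V →ₗ[F] V} (hirr : AutIrreducible μ)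
    (hdim : finrank F V = 5) {v : V} (hv : ∀ h ∈ algAut μ, h v = v) : v = 0 := by
  rcases hirr (Submodule.span F {v}) (by
    intro h hh x hx
    obtain ⟨a, rfl⟩ := Submodule.mem_span_singleton.mp hx
    rw [map_smul, hv h hh]
    exact hx) with h0 | h1
  · exact Submodule.span_singleton_eq_bot.mp h0
  · have := finrank_span_le_card (R := F) ({v} : Set V)
    rw [h1, finrank_top, hdim, Set.toFinset_singleton, Finset.card_singleton] at this
    omega

theorem AutIrreducible.eq_one_of_central {μ : V →ₗ[F] V →ₗ[F] V} (hirr : AutIrreducible μ)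
    {z : V ≃ₗ[F] V} (hz : ∀ h ∈ algAut μ, h * z = z * h) {v : V} (hv : z v = v) (hv0 : v ≠ 0) :
    z = 1 := by
  have h1 := (hirr (LinearMap.eqLocus (z : V →ₗ[F] V) LinearMap.id) (by
    intro h hh x hx
    have hx' : z x = x := hx
    change z (h x) = h x
    have := LinearEquiv.congr_fun (hz h hh) x
    rw [LinearEquiv.mul_apply, LinearEquiv.mul_apply, hx'] at this
    exact this.symm)).resolve_left (by
      intro hb
      have : v ∈ LinearMap.eqLocus (z : V →ₗ[F] V) LinearMap.id := hv
      rw [hb] at this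
      exact hv0 this)
  ext x
  have : x ∈ LinearMap.eqLocus (z : V →ₗ[F] V) LinearMap.id := h1 ▸ Submodule.mem_top
  exact this

theorem AutIrreducible.eq_bot_of_normal {μ : V →ₗ[F] V →ₗ[F] V} (hirr : AutIrreducible μ)
    {N : Subgroup (algAut μ)} [hN : N.Normal] {v : V} (hv : ∀ n ∈ N, n.1 v = v)
    (hv0 : v ≠ 0) : N = ⊥ := by
  let W : Submodule F V :=
    { carrier := {x | ∀ n ∈ N, n.1 x = x}
      zero_mem' := fun n _ => map_zero n.1
      add_mem' := fun {a b} ha hb n hn => by rw [map_add, ha n hn, hb n hn]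
      smul_mem' := fun c x hx n hn => by rw [map_smul, hx n hn] }
  have h1 : W = ⊤ := (hirr W (by
    intro h hh x hx n hn
    have h2 := hx _ (hN.conj_mem' n hn ⟨h, hh⟩)
    have h3 := congrArg h h2
    have h4 : h * ((⟨h, hh⟩⁻¹ * n * ⟨h, hh⟩ : algAut μ) : V ≃ₗ[F] V) = n.1 * h := by
      simp [mul_assoc]
    have h5 := LinearEquiv.congr_fun h4 x
    rw [LinearEquiv.mul_apply, LinearEquiv.mul_apply] at h5
    exact h5.symm.trans h3)).resolve_left (by
      intro hb
      have : v ∈ W := hv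
      rw [hb] at this
      exact hv0 this)
  rw [eq_bot_iff]
  intro n hn
  rw [Subgroup.mem_bot]
  ext x
  have : x ∈ W := h1 ▸ Submodule.mem_top
  exact this n hn

end Irreducible

/-- The base change to a field extension, as a representation of the automorphism group. -/
def algAutBaseChange {F V : Type*} (K : Type*) [Field F] [AddCommGroup V] [Module F V] [Field K]
    [Algebra F K] (μ : V →ₗ[F] V →ₗ[F] V) : algAut μ →* End K (K ⊗[F] V) where
  toFun h := (h.1 : V →ₗ[F] V).baseChange K
  map_one' := LinearMap.baseChange_id
  map_mul' g h := LinearMap.baseChange_mul (g.1 : V →ₗ[F] V) (h.1 : V →ₗ[F] V)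

theorem isCyclic_of_regular {G K U : Type*} [Group G] [Finite G] [Field K] [AddCommGroup U]
    [Module K U] (hG : IsPGroup 5 G) (ρ : G →* End K U) {ζ : K} (hζ : IsPrimitiveRoot ζ 5)
    (hreg : ∀ g : G, g ^ 5 = 1 → g ≠ 1 → ∃ (b : Basis (Fin 5) K U) (s : Fin 5 → ZMod 5),
      Function.Injective s ∧ ∀ i, ρ g (b i) = ζ ^ (s i).val • b i) : IsCyclic G := by
  have : Fact (Nat.Prime 5) := ⟨by norm_num⟩
  rcases subsingleton_or_nontrivial G with hs | hn
  · infer_instance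
  have heig : ∀ g : G, g ^ 5 = 1 → g ≠ 1 → ∀ (d : K) (u v : U), u ≠ 0 → ρ g u = d • u →
      ρ g v = d • v → ∃ x : K, v = x • u := by
    intro g hg hg1 d u v hu0 hu hv
    obtain ⟨b, s, hs, hb⟩ := hreg g hg hg1
    refine exists_eq_smul_of_eigenbasis b hb ?_ hu0 hu hv
    intro i j hij
    exact hs (ZMod.val_injective 5 (hζ.pow_inj (ZMod.val_lt _) (ZMod.val_lt _) hij))
  have := hG.center_nontrivial
  obtain ⟨⟨z, hzc⟩, hz1, hz5⟩ := (hG.to_subgroup (Subgroup.center G)).exists_pow_eq_one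
  have hz1 : z ≠ 1 := fun h => hz1 (Subtype.ext h)
  have hz5 : z ^ 5 = 1 := congrArg Subtype.val hz5
  rw [Subgroup.mem_center_iff] at hzc
  obtain ⟨b, s, hs, hb⟩ := hreg z hz5 hz1
  have hsur := ((Fintype.bijective_iff_injective_and_card s).mpr ⟨hs, by simp⟩).2
  obtain ⟨i₀, hi₀⟩ := hsur 0
  obtain ⟨i₁, hi₁⟩ := hsur 1
  have hb0 : ρ z (b i₀) = b i₀ := by rw [hb, hi₀]; simp
  have hb1 : ρ z (b i₁) = ζ • b i₁ := by rw [hb, hi₁, ZMod.val_one]; simp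
  have hχ : ∀ i (y : G), ρ y (b i) = b.coord i (ρ y (b i)) • b i := by
    intro i y
    obtain ⟨x, hx⟩ := heig z hz5 hz1 _ (b i) (ρ y (b i)) (b.ne_zero i) (hb i) (by
      rw [← End.mul_apply, ← map_mul, ← hzc y, map_mul, End.mul_apply, hb, map_smul])
    rw [hx]
    simp
  let χ : Fin 5 → G →* K := fun i =>
    { toFun := fun y => b.coord i (ρ y (b i))
      map_one' := by simp
      map_mul' := fun x y => by
        rw [map_mul, End.mul_apply, hχ i y, map_smul, map_smul, smul_eq_mul, mul_comm]
        simp }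
  have hχ' : ∀ i y, ρ y (b i) = χ i y • b i := hχ
  have hne : i₁ ≠ i₀ := by
    rintro rfl
    rw [hi₀] at hi₁
    exact zero_ne_one hi₁
  have hrep : ∀ g : G, g ^ 5 = 1 → χ i₀ g = χ i₁ g → g = 1 := by
    intro g hg h
    by_contra hg1
    obtain ⟨x, hx⟩ := heig g hg hg1 _ (b i₀) (b i₁) (b.ne_zero _) (hχ' _ _) (by rw [hχ', h])
    have := congrArg (b.coord i₁) hx
    simp [hne] at this
  refine isCyclic_of_injective_ringHom (χ i₁) ?_
  rw [injective_iff_map_eq_one]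
  by_contra! hcon
  obtain ⟨y₀, hy₀, hy₀1⟩ := hcon
  have hnt : Nontrivial (χ i₁).ker := ⟨⟨⟨y₀, hy₀⟩, 1, fun h => hy₀1 (congrArg Subtype.val h)⟩⟩
  obtain ⟨⟨y, hyk⟩, hy1, hy5⟩ := (hG.to_subgroup (χ i₁).ker).exists_pow_eq_one
  have hy1 : y ≠ 1 := fun h => hy1 (Subtype.ext h)
  have hy5 : y ^ 5 = 1 := congrArg Subtype.val hy5
  have hyk : χ i₁ y = 1 := hyk
  obtain ⟨m, _, hm⟩ := hζ.eq_pow_of_pow_eq_one (ξ := χ i₀ y) (by rw [← map_pow, hy5, map_one])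
  have hz0 : χ i₀ z = 1 := by
    change b.coord i₀ (ρ z (b i₀)) = 1
    rw [hb0]
    simp
  have hz1 : χ i₁ z = ζ := by
    change b.coord i₁ (ρ z (b i₁)) = ζ
    rw [hb1]
    simp
  have hw := hrep (y * z ^ m) (by
    have hc : Commute y (z ^ m) := (show Commute y z from hzc y).pow_right m
    rw [hc.mul_pow, hy5, ← pow_mul, mul_comm m 5, pow_mul, hz5, one_pow, one_mul]) (by
    rw [map_mul, map_mul, map_pow, map_pow, hz0, hz1, hyk, ← hm, one_pow, one_mul, mul_one])
  have h0 := congrArg (χ i₀) hw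
  rw [map_mul, map_pow, hz0, one_pow, mul_one, map_one] at h0
  exact hy1 (hrep y hy5 (h0.trans hyk.symm))

section Main

variable {p : ℕ} [Fact p.Prime] {V : Type*} [AddCommGroup V] [Module (ZMod p) V]

theorem pow_five_eq_one_of_autIrreducible {μ : V →ₗ[ZMod p] V →ₗ[ZMod p] V}
    (hirr : AutIrreducible μ) (h0 : μ ≠ 0) (hp : 7 ≤ p) (hμ : ∀ x, μ x x = 0)
    (hdim : finrank (ZMod p) V = 5) : (p : ZMod 11) ^ 5 = 1 := by
  by_contra hne
  have hpp : p.Prime := Fact.out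
  have : FiniteDimensional (ZMod p) V := FiniteDimensional.of_finrank_pos (by omega)
  have hVf : Finite V := Module.finite_of_finite (ZMod p)
  have hVn : Nontrivial V := Module.nontrivial_of_finrank_pos (R := ZMod p) (by omega)
  have : Finite (V ≃ₗ[ZMod p] V) :=
    Finite.of_injective (fun e => (e : V → V)) DFunLike.coe_injective
  let K := AlgebraicClosure (ZMod p)
  have hroot : ∀ r : ℕ, r.Prime → r ≠ p → ∃ ζ : K, IsPrimitiveRoot ζ r := by
    intro r hr hrp
    have : NeZero (r : K) := ⟨by
      rw [Ne, CharP.cast_eq_zero_iff K p, Nat.prime_dvd_prime_iff_eq hpp hr]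
      exact hrp.symm⟩
    exact HasEnoughRootsOfUnity.exists_primitiveRoot K r
  have hprime : ∀ r : ℕ, r.Prime → r ∣ Nat.card (algAut μ) → r = 5 ∨ r = p := by
    intro r hr hd
    by_contra! hcon
    have : Fact r.Prime := ⟨hr⟩
    obtain ⟨h, hh⟩ := exists_prime_orderOf_dvd_card' r hd
    obtain ⟨ζ, hζ⟩ := hroot r hr hcon.2
    have h1 : h ≠ 1 := by
      rintro rfl
      rw [orderOf_one] at hh
      exact hr.one_lt.ne hh
    rcases eq_five_or_eleven hirr h0 hp hμ hdim h.2 hcon.2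
      (congrArg Subtype.val (hh ▸ pow_orderOf_eq_one h)) (fun h2 => h1 (Subtype.ext h2)) hζ with
      h | h
    · exact hne h
    · exact hcon.1 h.1
  have : Fact (Nat.Prime 5) := ⟨by norm_num⟩
  have hfix : ∀ N : Subgroup (algAut μ), ¬ 5 ∣ Nat.card N → ∃ v ≠ 0, ∀ n ∈ N, n.1 v = v := by
    intro N hN
    have hpN : IsPGroup p N := isPGroup_of_forall_prime_dvd fun r hr hd =>
      (hprime r hr (hd.trans (Subgroup.card_subgroup_dvd_card N))).resolve_left
        (by rintro rfl; exact hN hd)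
    obtain ⟨v, hv, hv0⟩ := hpN.exists_fixed_point_of_prime_dvd_card_of_fixed_point V
      (by rw [Module.natCard_eq_pow_finrank (K := ZMod p), hdim, Nat.card_zmod]
          exact dvd_pow_self p (by norm_num)) (a := 0) (by
          intro n
          exact map_zero n.1.1)
    exact ⟨v, hv0.symm, fun n hn => hv ⟨n, hn⟩⟩
  by_cases h5 : 5 ∣ Nat.card (algAut μ)
  swap
  · obtain ⟨v, hv0, hv⟩ := hfix ⊤ (by rwa [Subgroup.card_top])
    exact hv0 (hirr.eq_zero_of_fixed hdim fun h hh => hv ⟨h, hh⟩ trivial)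
  obtain ⟨ζ, hζ⟩ := hroot 5 (by norm_num) (by omega)
  have hreg : ∀ g : algAut μ, g ^ 5 = 1 → g ≠ 1 → ∃ (b : Basis (Fin 5) K (K ⊗[ZMod p] V))
      (s : Fin 5 → ZMod 5), Function.Injective s ∧
      ∀ i, algAutBaseChange K μ g (b i) = ζ ^ (s i).val • b i := by
    intro g hg hg1
    rcases eq_five_or_eleven hirr h0 hp hμ hdim g.2 (by omega : 5 ≠ p)
      (congrArg Subtype.val hg) (fun h2 => hg1 (Subtype.ext h2)) hζ with h | h
    · exact absurd h hne
    · exact h.2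
  let Q : Sylow 5 (algAut μ) := default
  have hcyc : IsCyclic Q := isCyclic_of_regular Q.2 ((algAutBaseChange K μ).comp Q.1.subtype) hζ
    fun g hg hg1 => hreg g (congrArg Subtype.val hg) (fun h => hg1 (Subtype.ext h))
  have hmin : (Nat.card (algAut μ)).minFac = 5 := by
    apply le_antisymm (Nat.minFac_le_of_dvd (by norm_num) h5)
    rcases hprime _ (Nat.minFac_prime (by rintro h; rw [h] at h5; norm_num at h5))
      (Nat.minFac_dvd _) with h | h <;> omega
  have hcompl := IsCyclic.isComplement' hmin hcyc
  have hN5 := MonoidHom.not_dvd_card_ker_transferSylow Q (hcyc.normalizer_le_centralizer hmin)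
  obtain ⟨v, hv0, hv⟩ := hfix _ hN5
  rw [hirr.eq_bot_of_normal hv hv0, Subgroup.isComplement'_bot_left] at hcompl
  have hQn : Nontrivial Q :=
    (Subgroup.nontrivial_iff_ne_bot _).mpr (Q.ne_bot_of_dvd_card h5)
  obtain ⟨⟨z, hzQ⟩, hz1, hz5⟩ := Q.2.exists_pow_eq_one
  have hz1 : z ≠ 1 := fun h => hz1 (Subtype.ext h)
  have hz5 : z ^ 5 = 1 := congrArg Subtype.val hz5
  obtain ⟨b, s, hs, hb⟩ := hreg z hz5 hz1
  obtain ⟨i₀, hi₀⟩ := ((Fintype.bijective_iff_injective_and_card s).mpr ⟨hs, by simp⟩).2 0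
  have hev : End.HasEigenvalue ((z.1 : V →ₗ[ZMod p] V).baseChange K) 1 :=
    End.hasEigenvalue_of_hasEigenvector (x := b i₀) ⟨End.mem_eigenspace_iff.mpr (by
      have := hb i₀
      rw [hi₀, ZMod.val_zero, pow_zero] at this
      exact this), b.ne_zero i₀⟩
  have hev' : End.HasEigenvalue (z.1 : V →ₗ[ZMod p] V) 1 := by
    rw [hasEigenvalue_baseChange_iff, ← map_one (algebraMap (ZMod p) K),
      Polynomial.aeval_algebraMap_apply, map_eq_zero] at hev
    rw [End.hasEigenvalue_iff_isRoot_charpoly]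
    simpa using hev
  obtain ⟨u, hu⟩ := hev'.exists_hasEigenvector
  refine hz1 (Subtype.ext (hirr.eq_one_of_central (fun h hh => ?_)
    (hu.apply_eq_smul.trans (one_smul _ u)) hu.2))
  have hcomm := hcyc.commGroup.mul_comm ⟨⟨h, hh⟩, by rw [hcompl]; trivial⟩ ⟨z, hzQ⟩
  exact congrArg (fun q : Q => q.1.1) hcomm

end Main

end

section

open Module
open scoped commutatorElement

section ClassTwo

variable {G : Type*} [Group G]

theorem commutatorElement_mul_left_of_class_two (h : ∀ x y : G, ⁅x, y⁆ ∈ Subgroup.center G)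
    (a b c : G) : ⁅a * b, c⁆ = ⁅a, c⁆ * ⁅b, c⁆ := by
  rw [commutatorElement_mul_left_eq_conj_mul,
    (Subgroup.mem_center_iff.mp (h b c) a), mul_inv_cancel_right]
  exact (Subgroup.mem_center_iff.mp (h b c) _).symm

theorem commutatorElement_mul_right_of_class_two (h : ∀ x y : G, ⁅x, y⁆ ∈ Subgroup.center G)
    (a b c : G) : ⁅a, b * c⁆ = ⁅a, b⁆ * ⁅a, c⁆ := by
  rw [← commutatorElement_inv, commutatorElement_mul_left_of_class_two h, mul_inv_rev,
    commutatorElement_inv, commutatorElement_inv, Subgroup.mem_center_iff.mp (h a b)]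

theorem mul_pow_of_class_two (h : ∀ x y : G, ⁅x, y⁆ ∈ Subgroup.center G) (x y : G) (n : ℕ) :
    (x * y) ^ n = x ^ n * y ^ n * ⁅y, x⁆ ^ n.choose 2 := by
  have hc : ∀ (k : ℕ) (g : G), g * ⁅y, x⁆ ^ k = ⁅y, x⁆ ^ k * g := fun k =>
    Subgroup.mem_center_iff.mp (Subgroup.pow_mem _ (h y x) k)
  have h1 : ∀ n : ℕ, y ^ n * x = x * y ^ n * ⁅y, x⁆ ^ n := by
    intro n
    induction n with
    | zero => simp
    | succ n ih =>
      have h2 : y * x = x * y * ⁅y, x⁆ := by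
        rw [Subgroup.mem_center_iff.mp (h y x), commutatorElement_def]
        group
      rw [pow_succ y, mul_assoc, h2, ← mul_assoc, ← mul_assoc, ih, pow_succ ⁅y, x⁆, ← mul_assoc,
        mul_assoc (x * y ^ n) _ y, ← hc n y]
      simp only [mul_assoc]
  induction n with
  | zero => simp
  | succ n ih =>
    rw [pow_succ, ih, show (n + 1).choose 2 = n + n.choose 2 by
      rw [Nat.choose_succ_succ' n 1, Nat.choose_one_right], pow_add ⁅y, x⁆,
      mul_assoc (x ^ n * y ^ n), ← hc, ← mul_assoc, ← mul_assoc, mul_assoc (x ^ n), h1,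
      pow_succ x n, pow_succ y n]
    calc x ^ n * (x * y ^ n * ⁅y, x⁆ ^ n) * y * ⁅y, x⁆ ^ n.choose 2
        = x ^ n * x * y ^ n * (⁅y, x⁆ ^ n * y) * ⁅y, x⁆ ^ n.choose 2 := by
          simp only [mul_assoc]
      _ = _ := by
          rw [← hc n y]
          simp only [mul_assoc]

end ClassTwo

section UCS

variable {G : Type*} [Group G] [Finite G]

theorem eq_of_characteristic (h3 : Nat.card {H : Subgroup G // H.Characteristic} = 3)
    {M : Subgroup G} (hM : M.Characteristic) (hbot : M ≠ ⊥) (htop : M ≠ ⊤) {N : Subgroup G}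
    (hN : N.Characteristic) : N = ⊥ ∨ N = M ∨ N = ⊤ := by
  have hbt : (⊥ : Subgroup G) ≠ ⊤ := by
    intro h
    exact hbot (le_bot_iff.mp (h ▸ le_top))
  have hsub : ({⊥, M, ⊤} : Set (Subgroup G)) ⊆ {H | H.Characteristic} := by
    rintro H (rfl | rfl | rfl)
    · exact Subgroup.botCharacteristic
    · exact hM
    · exact Subgroup.topCharacteristic
  have hc : ({⊥, M, ⊤} : Set (Subgroup G)).ncard = 3 :=
    Set.ncard_eq_three.mpr ⟨⊥, M, ⊤, hbot.symm, hbt, htop, rfl⟩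
  have heq := Set.eq_of_subset_of_ncard_le hsub (by
    rw [hc]
    exact h3.le) (Set.toFinite _)
  have : N ∈ ({⊥, M, ⊤} : Set (Subgroup G)) := heq ▸ hN
  exact this

theorem commutator_eq_center {p : ℕ} [Fact p.Prime] [Nontrivial G] (hG : IsPGroup p G)
    (h3 : Nat.card {H : Subgroup G // H.Characteristic} = 3)
    (hcomm : ¬ ∀ a b : G, a * b = b * a) :
    commutator G = Subgroup.center G ∧ Subgroup.center G ≠ ⊥ ∧ Subgroup.center G ≠ ⊤ := by
  have htop : Subgroup.center G ≠ ⊤ := by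
    intro h
    exact hcomm fun a b => (Subgroup.mem_center_iff.mp (h ▸ Subgroup.mem_top b) a)
  have hbot : Subgroup.center G ≠ ⊥ := by
    rw [← Subgroup.nontrivial_iff_ne_bot]
    exact hG.center_nontrivial
  have := hG.isNilpotent
  have hchar : (commutator G).Characteristic := by
    rw [commutator_def]
    infer_instance
  refine ⟨?_, hbot, htop⟩
  rcases eq_of_characteristic h3 inferInstance hbot htop hchar with h | h | h
  · exact absurd ((commutator_eq_bot_iff_center_eq_top G).mp h) htop
  · exact h
  · exact absurd h (Group.IsSolvable.commutator_lt_top_of_nontrivial G).ne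

theorem pow_eq_one_of_mem_center {p : ℕ} [Fact p.Prime] [Nontrivial G] (hG : IsPGroup p G)
    (h3 : Nat.card {H : Subgroup G // H.Characteristic} = 3)
    (hbot : Subgroup.center G ≠ ⊥) (htop : Subgroup.center G ≠ ⊤) {z : G}
    (hz : z ∈ Subgroup.center G) : z ^ p = 1 := by
  let N : Subgroup G :=
    { carrier := {x | x ∈ Subgroup.center G ∧ x ^ p = 1}
      one_mem' := ⟨one_mem _, one_pow p⟩
      mul_mem' := fun {a b} ha hb => ⟨mul_mem ha.1 hb.1, by
        rw [Commute.mul_pow (Subgroup.mem_center_iff.mp hb.1 a), ha.2, hb.2, one_mul]⟩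
      inv_mem' := fun {a} ha => ⟨inv_mem ha.1, by rw [inv_pow, ha.2, inv_one]⟩ }
  have hN : N.Characteristic := by
    rw [Subgroup.characteristic_iff_map_le]
    rintro φ _ ⟨x, hx, rfl⟩
    refine ⟨?_, ?_⟩
    · exact Subgroup.characteristic_iff_map_le.mp Subgroup.centerCharacteristic φ
        (Subgroup.mem_map_of_mem _ hx.1)
    · rw [← map_pow, hx.2, map_one]
  rcases eq_of_characteristic h3 inferInstance hbot htop hN with h | h | h
  · have := hG.center_nontrivial
    obtain ⟨⟨g, hgc⟩, hg1, hgp⟩ := (hG.to_subgroup (Subgroup.center G)).exists_pow_eq_one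
    have : g ∈ N := ⟨hgc, congrArg Subtype.val hgp⟩
    rw [h, Subgroup.mem_bot] at this
    exact absurd (Subtype.ext this) hg1
  · rw [← h] at hz
    exact hz.2
  · have : z ∈ N := h ▸ Subgroup.mem_top z
    exact this.2

end UCS

end

section

open Module
open scoped commutatorElement IsMulCommutative

/-- A group of class two in which the `p`-th power map is a homomorphism whose image and kernel
are both the centre. -/
structure PowerCentral (p : ℕ) (G : Type*) [Group G] : Prop where
  comm_mem : ∀ x y : G, ⁅x, y⁆ ∈ Subgroup.center G
  pow_mem : ∀ x : G, x ^ p ∈ Subgroup.center G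
  pow_eq_one_iff : ∀ x : G, x ^ p = 1 ↔ x ∈ Subgroup.center G
  exists_pow : ∀ z ∈ Subgroup.center G, ∃ x : G, x ^ p = z
  mul_pow : ∀ x y : G, (x * y) ^ p = x ^ p * y ^ p

namespace PowerCentral

universe u

variable {G : Type u} [Group G] {p : ℕ}

theorem commutatorElement_congr (h : PowerCentral p G) {x x' y y' : G} (hx : x ^ p = x' ^ p)
    (hy : y ^ p = y' ^ p) : ⁅x, y⁆ = ⁅x', y'⁆ := by
  have key : ∀ {a b : G}, a ^ p = b ^ p → ∃ z ∈ Subgroup.center G, a = b * z := by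
    intro a b hab
    refine ⟨b⁻¹ * a, ?_, by group⟩
    rw [← h.pow_eq_one_iff, h.mul_pow, hab, inv_pow, inv_mul_cancel]
  obtain ⟨z, hz, rfl⟩ := key hx
  obtain ⟨w, hw, rfl⟩ := key hy
  have hz' : ∀ g : G, ⁅z, g⁆ = 1 := fun g =>
    commutatorElement_eq_one_iff_mul_comm.mpr (Subgroup.mem_center_iff.mp hz g).symm
  have hw' : ∀ g : G, ⁅g, w⁆ = 1 := fun g =>
    commutatorElement_eq_one_iff_mul_comm.mpr (Subgroup.mem_center_iff.mp hw g)
  rw [commutatorElement_mul_left_of_class_two h.comm_mem,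
    commutatorElement_mul_right_of_class_two h.comm_mem, hz', hw', mul_one, mul_one]

theorem exists_module_equiv_center [Fact p.Prime] (h : PowerCentral p G) :
    ∃ (V : Type u) (_ : AddCommGroup V) (_ : Module (ZMod p) V),
      Nonempty (Additive (Subgroup.center G) ≃+ V) :=
  ⟨Additive (Subgroup.center G), inferInstance, AddCommGroup.zmodModule fun x => by
    change Additive.ofMul (x.toMul ^ p) = 0
    rw [ofMul_eq_zero]
    exact Subtype.ext ((h.pow_eq_one_iff _).mpr x.toMul.2), ⟨AddEquiv.refl _⟩⟩

theorem exists_autIrreducible [Fact p.Prime] (h : PowerCentral p G)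
    (hchar : ∀ N : Subgroup G, N.Characteristic → N ≤ Subgroup.center G →
      N = ⊥ ∨ N = Subgroup.center G) (hcomm : ¬ ∀ a b : G, a * b = b * a) :
    ∃ (V : Type u) (_ : AddCommGroup V) (_ : Module (ZMod p) V)
      (μ : V →ₗ[ZMod p] V →ₗ[ZMod p] V), AutIrreducible μ ∧ μ ≠ 0 ∧ (∀ x : V, μ x x = 0) ∧
      Nat.card V = Nat.card (Subgroup.center G) := by
  obtain ⟨V, _, _, ⟨e⟩⟩ := exists_module_equiv_center h
  let t : Subgroup.center G → V := fun z => e (Additive.ofMul z)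
  have htm : ∀ x y, t (x * y) = t x + t y := fun x y => map_add e _ _
  have ht1 : t 1 = 0 := map_zero e
  have htinv : ∀ x, t x⁻¹ = - t x := fun x => map_neg e _
  have hti : Function.Injective t := e.injective.comp Additive.ofMul.injective
  have hts : Function.Surjective t := e.surjective.comp Additive.ofMul.surjective
  let π : G → V := fun x => t ⟨x ^ p, h.pow_mem x⟩
  have hπ : Function.Surjective π := by
    intro v
    obtain ⟨z, rfl⟩ := hts v
    obtain ⟨x, hx⟩ := h.exists_pow _ z.2
    exact ⟨x, congrArg t (Subtype.ext hx)⟩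
  have hπi : ∀ {x y : G}, π x = π y → x ^ p = y ^ p := fun hxy => congrArg Subtype.val (hti hxy)
  have hπm : ∀ x y, π (x * y) = π x + π y := fun x y =>
    (congrArg t (Subtype.ext (h.mul_pow x y))).trans (htm _ _)
  let c : G → G → V := fun x y => t ⟨⁅x, y⁆, h.comm_mem x y⟩
  let σ : V → G := Function.surjInv hπ
  have hσ : ∀ v, π (σ v) = v := Function.surjInv_eq hπ
  have hf : ∀ x y, c (σ (π x)) (σ (π y)) = c x y := fun x y =>
    congrArg t (Subtype.ext
      (h.commutatorElement_congr (hπi (hσ _)) (hπi (hσ _))))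
  have hadd₁ : ∀ u v w, c (σ (u + v)) (σ w) = c (σ u) (σ w) + c (σ v) (σ w) := by
    intro u v w
    obtain ⟨x, rfl⟩ := hπ u
    obtain ⟨y, rfl⟩ := hπ v
    obtain ⟨z, rfl⟩ := hπ w
    rw [← hπm, hf, hf, hf]
    exact (congrArg t (Subtype.ext
      (commutatorElement_mul_left_of_class_two h.comm_mem x y z))).trans (htm _ _)
  have hadd₂ : ∀ w u v, c (σ w) (σ (u + v)) = c (σ w) (σ u) + c (σ w) (σ v) := by
    intro w u v
    obtain ⟨x, rfl⟩ := hπ u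
    obtain ⟨y, rfl⟩ := hπ v
    obtain ⟨z, rfl⟩ := hπ w
    rw [← hπm, hf, hf, hf]
    exact (congrArg t (Subtype.ext
      (commutatorElement_mul_right_of_class_two h.comm_mem z x y))).trans (htm _ _)
  let μ : V →ₗ[ZMod p] V →ₗ[ZMod p] V := LinearMap.mk₂ (ZMod p) (fun u v => c (σ u) (σ v))
    hadd₁ (fun k u v => ZMod.map_smul (AddMonoidHom.mk' (fun u => c (σ u) (σ v))
      fun a b => hadd₁ a b v) k u) hadd₂
      (fun k u v => ZMod.map_smul (AddMonoidHom.mk' (fun v => c (σ u) (σ v))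
      fun a b => hadd₂ u a b) k v)
  have hμ : ∀ x y, μ (π x) (π y) = c x y := hf
  refine ⟨V, inferInstance, inferInstance, μ, ?_, ?_, ?_, Nat.card_congr e.toEquiv.symm⟩
  · intro W hW
    let N : Subgroup G :=
      { carrier := {x | ∃ hx : x ∈ Subgroup.center G, t ⟨x, hx⟩ ∈ W}
        one_mem' := ⟨one_mem _, by
          change t 1 ∈ W
          rw [ht1]
          exact W.zero_mem⟩
        mul_mem' := fun {a b} ⟨ha, ha'⟩ ⟨hb, hb'⟩ => ⟨mul_mem ha hb, by
          change t (⟨a, ha⟩ * ⟨b, hb⟩) ∈ W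
          rw [htm]
          exact W.add_mem ha' hb'⟩
        inv_mem' := fun {a} ⟨ha, ha'⟩ => ⟨inv_mem ha, by
          change t (⟨a, ha⟩⁻¹) ∈ W
          rw [htinv]
          exact W.neg_mem ha'⟩ }
    have hN : N.Characteristic := by
      rw [Subgroup.characteristic_iff_map_le]
      rintro φ _ ⟨x, ⟨hx, hxW⟩, rfl⟩
      let g : V ≃+ V := (e.symm.trans (MulEquiv.toAdditive (Subgroup.centerCongr φ))).trans e
      let f : V ≃ₗ[ZMod p] V := { g with map_smul' := fun k v => ZMod.map_smul g k v }
      have hft : ∀ z, f (t z) = t (Subgroup.centerCongr φ z) := fun z => by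
        change e (Additive.ofMul (Subgroup.centerCongr φ (e.symm (e (Additive.ofMul z))).toMul)) = _
        rw [AddEquiv.symm_apply_apply]
        rfl
      have hfπ : ∀ x, f (π x) = π (φ x) := fun x =>
        (hft _).trans (congrArg t (Subtype.ext (map_pow φ x p)))
      have hfm : f ∈ algAut μ := by
        intro u v
        obtain ⟨x, rfl⟩ := hπ u
        obtain ⟨y, rfl⟩ := hπ v
        rw [hfπ, hfπ, hμ, hμ]
        exact (hft _).trans (congrArg t (Subtype.ext (map_commutatorElement φ x y)))
      have := hW f hfm _ hxW
      rw [hft] at this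
      exact ⟨_, this⟩
    rcases hchar N hN (fun x hx => hx.1) with hb | ht
    · left
      rw [eq_bot_iff]
      intro v hv
      obtain ⟨z, rfl⟩ := hts v
      have : (z : G) ∈ N := ⟨z.2, hv⟩
      rw [hb, Subgroup.mem_bot] at this
      rw [show z = 1 from Subtype.ext this]
      exact ht1
    · right
      rw [eq_top_iff]
      intro v _
      obtain ⟨z, rfl⟩ := hts v
      have : (z : G) ∈ N := by
        rw [ht]
        exact z.2
      exact this.2
  · intro h0
    refine hcomm fun a b => commutatorElement_eq_one_iff_mul_comm.mp ?_
    have := hμ a b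
    rw [h0] at this
    exact congrArg Subtype.val (hti (this.symm.trans ht1.symm))
  · intro v
    obtain ⟨x, rfl⟩ := hπ v
    rw [hμ]
    exact (congrArg t (Subtype.ext (commutatorElement_self x))).trans ht1

end PowerCentral

end

section

open Module
open scoped commutatorElement

universe u

theorem exists_autIrreducible_of_characteristic {p : ℕ} [Fact p.Prime] (hodd : Odd p)
    {G : Type u} [Group G] [Finite G] (hG : IsPGroup p G)
    (h3 : Nat.card {H : Subgroup G // H.Characteristic} = 3)
    (hcomm : ¬ ∀ a b : G, a * b = b * a) (hexp : Monoid.exponent G = p ^ 2) :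
    ∃ (V : Type u) (_ : AddCommGroup V) (_ : Module (ZMod p) V)
      (μ : V →ₗ[ZMod p] V →ₗ[ZMod p] V), AutIrreducible μ ∧ μ ≠ 0 ∧ (∀ x : V, μ x x = 0) ∧
      Nat.card V ^ 2 = Nat.card G := by
  have hp : p.Prime := Fact.out
  have : Nontrivial G := by
    by_contra h
    rw [not_nontrivial_iff_subsingleton] at h
    exact hcomm fun a b => Subsingleton.elim _ _
  obtain ⟨hD, hbot, htop⟩ := commutator_eq_center hG h3 hcomm
  have hcm : ∀ x y : G, ⁅x, y⁆ ∈ Subgroup.center G := by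
    intro x y
    rw [← hD, commutator_def]
    exact Subgroup.commutator_mem_commutator trivial trivial
  have hz : ∀ z ∈ Subgroup.center G, z ^ p = 1 := fun z =>
    pow_eq_one_of_mem_center hG h3 hbot htop
  have hmul : ∀ x y : G, (x * y) ^ p = x ^ p * y ^ p := by
    intro x y
    obtain ⟨k, hk⟩ : p ∣ p.choose 2 := hp.dvd_choose_self (by norm_num) (by
      rcases hp.two_le.lt_or_eq with h | h
      · exact h
      · rw [← h] at hodd
        exact absurd hodd (by decide))
    rw [mul_pow_of_class_two hcm, hk, pow_mul, hz _ (hcm y x), one_pow, mul_one]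
  let π : G →* G := MonoidHom.mk' (fun x => x ^ p) hmul
  have hker : π.ker = Subgroup.center G := by
    have hc : π.ker.Characteristic := by
      rw [Subgroup.characteristic_iff_map_le]
      rintro φ _ ⟨x, hx, rfl⟩
      have hx : x ^ p = 1 := hx
      change (φ x) ^ p = 1
      rw [← map_pow, hx, map_one]
    rcases eq_of_characteristic h3 inferInstance hbot htop hc with h | h | h
    · exact absurd (le_bot_iff.mp (h ▸ fun z hzc => hz z hzc)) hbot
    · exact h
    · have h1 : Monoid.exponent G ∣ p := Monoid.exponent_dvd_of_forall_pow_eq_one fun g =>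
        (h ▸ Subgroup.mem_top g : g ∈ π.ker)
      rw [hexp] at h1
      have := Nat.le_of_dvd hp.pos h1
      nlinarith [hp.two_le]
  have hrange : π.range = Subgroup.center G := by
    have hc : π.range.Characteristic := by
      rw [Subgroup.characteristic_iff_map_le]
      rintro φ _ ⟨_, ⟨x, rfl⟩, rfl⟩
      exact ⟨φ x, (map_pow φ x p).symm⟩
    rcases eq_of_characteristic h3 inferInstance hbot htop hc with h | h | h
    · rw [MonoidHom.range_eq_bot_iff] at h
      rw [h, MonoidHom.ker_one] at hker
      exact absurd hker.symm htop
    · exact h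
    · have := Finite.injective_iff_surjective.mpr (MonoidHom.range_eq_top.mp h)
      rw [(MonoidHom.ker_eq_bot_iff π).mpr this] at hker
      exact absurd hker.symm hbot
  have hP : PowerCentral p G :=
    { comm_mem := hcm
      pow_mem := fun x => by
        rw [← hrange]
        exact ⟨x, rfl⟩
      pow_eq_one_iff := fun x => by
        rw [← hker]
        rfl
      exists_pow := fun z hzc => by
        rw [← hrange] at hzc
        exact hzc
      mul_pow := hmul }
  obtain ⟨V, i₁, i₂, μ, h1, h2, h4, h5⟩ := hP.exists_autIrreducible (fun N hN hle => by
    rcases eq_of_characteristic h3 inferInstance hbot htop hN with h | h | h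
    · exact Or.inl h
    · exact Or.inr h
    · rw [h, top_le_iff] at hle
      exact absurd hle htop) hcomm
  refine ⟨V, i₁, i₂, μ, h1, h2, h4, ?_⟩
  have := Subgroup.card_mul_index π.ker
  rw [Subgroup.index_ker, hker, hrange] at this
  rw [h5, sq, this]

theorem pow_five_eq_one_of_characteristic {p : ℕ} [Fact p.Prime] (hodd : Odd p)
    {G : Type u} [Group G] [Finite G] (hG : IsPGroup p G)
    (h3 : Nat.card {H : Subgroup G // H.Characteristic} = 3)
    (hcomm : ¬ ∀ a b : G, a * b = b * a) (hexp : Monoid.exponent G = p ^ 2)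
    (hcard : Nat.card G = p ^ 10) : (p : ZMod 11) ^ 5 = 1 := by
  have hp : p.Prime := Fact.out
  have h2 := hp.two_le
  rcases le_or_gt 7 p with h7 | h7
  · obtain ⟨V, _, _, μ, hirr, h0, hμ, hV⟩ :=
      exists_autIrreducible_of_characteristic hodd hG h3 hcomm hexp
    rw [hcard, show p ^ 10 = (p ^ 5) ^ 2 by ring] at hV
    have hV := Nat.pow_left_injective (by norm_num : 2 ≠ 0) hV
    have : Finite V := Nat.finite_of_card_ne_zero (by rw [hV]; positivity)
    rw [Module.natCard_eq_pow_finrank (K := ZMod p), Nat.card_zmod] at hV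
    exact pow_five_eq_one_of_autIrreducible hirr h0 h7 hμ (Nat.pow_right_injective h2 hV)
  · interval_cases p
    · exact absurd hodd (by decide)
    · decide
    · exact absurd hp (by norm_num)
    · decide
    · exact absurd hp (by norm_num)

end

section

open Module

/-- The group structure on an additive group obtained by twisting with an alternating biadditive
map that vanishes on its own values. -/
abbrev twistGroup {W : Type*} [AddCommGroup W] (c : W →+ W →+ W) (h₁ : ∀ x y z, c (c x y) z = 0)
    (h₂ : ∀ x y z, c z (c x y) = 0) (h : ∀ x, c x x = 0) : Group W where
  mul x y := x + y + c x y
  one := 0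
  inv x := -x
  mul_assoc x y z := by
    change x + y + c x y + z + c (x + y + c x y) z = x + (y + z + c y z) + c x (y + z + c y z)
    simp only [map_add, AddMonoidHom.add_apply, h₁, h₂]
    abel
  one_mul x := by
    change 0 + x + c 0 x = x
    simp
  mul_one x := by
    change x + 0 + c x 0 = x
    simp
  inv_mul_cancel x := by
    change -x + x + c (-x) x = 0
    simp [h]

theorem smul_eq_self_of_odd {V : Type*} [AddCommGroup V] {n : ℕ} (hn : Odd n) {m : V}
    (hm : 2 • m = 0) : n • m = m := by
  obtain ⟨k, rfl⟩ := hn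
  rw [add_smul, mul_comm, mul_smul, hm, smul_zero, zero_add, one_smul]

theorem exists_group_of_autIrreducible {p : ℕ} [Fact p.Prime] (hodd : Odd p) {V W : Type*}
    [AddCommGroup V] [Module (ZMod p) V] {μ : V →ₗ[ZMod p] V →ₗ[ZMod p] V}
    (hirr : AutIrreducible μ) (h0 : μ ≠ 0) (hμ : ∀ x, μ x x = 0)
    [AddCommGroup W] (r : W →+ V) (hr : Function.Surjective r) (ι : V →+ W)
    (hι : Function.Injective ι) (hιr : ∀ w, ι (r w) = p • w)
    (hker : ∀ w, r w = 0 → ∃ v, w = ι v)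
    (hlift : ∀ h ∈ algAut μ, ∃ H : W ≃+ W, ∀ w, r (H w) = h (r w)) :
    ∃ _ : Group W, (IsPGroup p W ∧ Nat.card {H : Subgroup W // H.Characteristic} = 3) ∧
      (¬ ∀ a b : W, a * b = b * a) ∧ Monoid.exponent W = p ^ 2 := by
  have hp : p.Prime := Fact.out
  have hpV : ∀ v : V, p • v = 0 := fun v => by
    rw [← Nat.cast_smul_eq_nsmul (ZMod p), CharP.cast_eq_zero, zero_smul]
  have hrι : ∀ v, r (ι v) = 0 := by
    intro v
    obtain ⟨w, rfl⟩ := hr v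
    rw [hιr, map_nsmul, hpV]
  have hVn : ∃ v : V, v ≠ 0 := by
    by_contra! h
    exact h0 (LinearMap.ext fun x => by rw [h x, map_zero, map_zero])
  obtain ⟨v₀, hv₀⟩ := hVn
  let c : W →+ W →+ W := AddMonoidHom.mk' (fun x => AddMonoidHom.mk' (fun y => ι (μ (r x) (r y)))
    fun y z => by simp) fun x y => by ext z; simp
  have hc : ∀ x y, c x y = ι (μ (r x) (r y)) := fun _ _ => rfl
  let inst : Group W := twistGroup c (fun x y z => by rw [hc, hc, hrι]; simp)
    (fun x y z => by rw [hc, hc, hrι]; simp) (fun x => by rw [hc, hμ, map_zero])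
  have hmul : ∀ x y : W, x * y = x + y + ι (μ (r x) (r y)) := fun _ _ => rfl
  have hone : (1 : W) = 0 := rfl
  have hinv : ∀ x : W, x⁻¹ = -x := fun _ => rfl
  have hpow : ∀ (x : W) (n : ℕ), x ^ n = n • x := by
    intro x n
    induction n with
    | zero => rw [pow_zero, zero_smul, hone]
    | succ n ih =>
      rw [pow_succ, ih, hmul, map_nsmul, map_nsmul, LinearMap.smul_apply, hμ, smul_zero, map_zero,
        add_zero, succ_nsmul]
  have hpp : ∀ x : W, x ^ p = ι (r x) := fun x => by rw [hpow, hιr]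
  have hpp2 : ∀ x : W, x ^ p ^ 2 = 1 := fun x => by
    rw [sq, pow_mul, hpp, hpp, hrι, map_zero, hone]
  have hr_mul : ∀ x y : W, r (x * y) = r x + r y := fun x y => by
    rw [hmul, map_add, map_add, hrι, add_zero]
  have hι_mul : ∀ a b : V, ι a * ι b = ι (a + b) := fun a b => by
    rw [hmul, hrι, hrι, map_zero, map_zero, add_zero, map_add]
  let P : Subgroup W :=
    { carrier := {x | r x = 0}
      one_mem' := map_zero r
      mul_mem' := fun {a b} ha hb => by
        change r (a * b) = 0
        rw [hr_mul, ha, hb, add_zero]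
      inv_mem' := fun {a} ha => by
        change r (a⁻¹) = 0
        rw [hinv, map_neg, ha, neg_zero] }
  have hPι : ∀ v, ι v ∈ P := hrι
  have hPbot : P ≠ ⊥ := by
    intro h
    have := hPι v₀
    rw [h, Subgroup.mem_bot, hone, map_eq_zero_iff ι hι] at this
    exact hv₀ this
  have hPtop : P ≠ ⊤ := by
    intro h
    obtain ⟨w, rfl⟩ := hr v₀
    have : w ∈ P := h ▸ Subgroup.mem_top w
    exact hv₀ this
  have hPchar : P.Characteristic := by
    rw [Subgroup.characteristic_iff_map_le]
    rintro φ _ ⟨x, hx, rfl⟩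
    obtain ⟨v, rfl⟩ := hker x hx
    obtain ⟨w, rfl⟩ := hr v
    change r (φ (ι (r w))) = 0
    rw [← hpp, map_pow, hpp, hrι]
  have hlift' : ∀ h ∈ algAut μ, ∃ φ : W ≃* W, (∀ w, r (φ w) = h (r w)) ∧
      ∀ v, φ (ι v) = ι (h v) := by
    intro h hh
    obtain ⟨H, hH⟩ := hlift h hh
    have hHι : ∀ v, H (ι v) = ι (h v) := by
      intro v
      obtain ⟨w, rfl⟩ := hr v
      rw [hιr, map_nsmul, ← hH, hιr]
    refine ⟨{ H with map_mul' := fun x y => ?_ }, hH, hHι⟩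
    change H (x * y) = H x * H y
    rw [hmul, hmul, map_add, map_add, hHι, mem_algAut.mp hh, hH, hH]
  have hchar : ∀ N : Subgroup W, N.Characteristic → N = ⊥ ∨ N = P ∨ N = ⊤ := by
    intro N hN
    have hNmap : ∀ (φ : W ≃* W), ∀ x ∈ N, φ x ∈ N := fun φ x hx =>
      Subgroup.characteristic_iff_map_le.mp hN φ (Subgroup.mem_map_of_mem _ hx)
    let A : AddSubgroup V :=
      { carrier := {v | ∃ x ∈ N, r x = v}
        zero_mem' := ⟨1, N.one_mem, map_zero r⟩
        add_mem' := fun ⟨x, hx, hx'⟩ ⟨y, hy, hy'⟩ =>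
          ⟨x * y, N.mul_mem hx hy, by rw [hr_mul, hx', hy']⟩
        neg_mem' := fun ⟨x, hx, hx'⟩ => ⟨x⁻¹, N.inv_mem hx, by rw [hinv, map_neg, hx']⟩ }
    let B : AddSubgroup V :=
      { carrier := {v | ι v ∈ N}
        zero_mem' := by
          change ι 0 ∈ N
          rw [map_zero]
          exact N.one_mem
        add_mem' := fun {a b} ha hb => by
          change ι (a + b) ∈ N
          rw [← hι_mul]
          exact N.mul_mem ha hb
        neg_mem' := fun {a} ha => by
          change ι (-a) ∈ N
          rw [map_neg]
          exact N.inv_mem ha }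
    rcases hirr (AddSubgroup.toZModSubmodule p A) (by
      rintro h hh v ⟨x, hx, rfl⟩
      obtain ⟨φ, hφ, -⟩ := hlift' h hh
      exact ⟨φ x, hNmap φ x hx, hφ x⟩) with hA | hA
    · have hNP : N ≤ P := by
        intro x hx
        have : r x ∈ AddSubgroup.toZModSubmodule p A := ⟨x, hx, rfl⟩
        rw [hA] at this
        exact this
      rcases hirr (AddSubgroup.toZModSubmodule p B) (by
        intro h hh v hv
        obtain ⟨φ, -, hφ⟩ := hlift' h hh
        have := hNmap φ _ hv
        rw [hφ] at this
        exact this) with hB | hB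
      · left
        rw [eq_bot_iff]
        intro x hx
        obtain ⟨v, rfl⟩ := hker x (hNP hx)
        have : v ∈ AddSubgroup.toZModSubmodule p B := hx
        rw [hB, Submodule.mem_bot] at this
        rw [this, map_zero]
        exact Subgroup.one_mem _
      · right; left
        refine le_antisymm hNP fun x hx => ?_
        obtain ⟨v, rfl⟩ := hker x hx
        have : v ∈ AddSubgroup.toZModSubmodule p B := hB ▸ Submodule.mem_top
        exact this
    · right; right
      have hrN : ∀ v, ∃ x ∈ N, r x = v := fun v => by
        have : v ∈ AddSubgroup.toZModSubmodule p A := hA ▸ Submodule.mem_top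
        exact this
      have hιN : ∀ v, ι v ∈ N := by
        intro v
        obtain ⟨x, hx, rfl⟩ := hrN v
        rw [← hpp]
        exact N.pow_mem hx p
      rw [eq_top_iff]
      intro w _
      obtain ⟨x, hx, hxw⟩ := hrN (r w)
      obtain ⟨v, hv⟩ := hker (w - x) (by rw [map_sub, hxw, sub_self])
      have : w = x * ι v := by
        rw [hmul, hrι, map_zero, map_zero, add_zero, ← hv, add_sub_cancel]
      rw [this]
      exact N.mul_mem hx (hιN v)
  refine ⟨inst, ⟨fun g => ⟨2, hpp2 g⟩, ?_⟩, ?_, ?_⟩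
  · have hset : {H : Subgroup W | H.Characteristic} = {⊥, P, ⊤} := by
      ext N
      refine ⟨hchar N, ?_⟩
      rintro (rfl | rfl | rfl)
      · exact Subgroup.botCharacteristic
      · exact hPchar
      · exact Subgroup.topCharacteristic
    change Set.ncard {H : Subgroup W | H.Characteristic} = 3
    rw [hset]
    exact Set.ncard_eq_three.mpr ⟨⊥, P, ⊤, hPbot.symm,
      fun h => hPbot (le_bot_iff.mp (h ▸ le_top)), hPtop, rfl⟩
  · intro hcomm
    refine h0 (LinearMap.ext₂ fun u v => ?_)
    obtain ⟨x, rfl⟩ := hr u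
    obtain ⟨y, rfl⟩ := hr v
    have h1 := hcomm x y
    rw [hmul, hmul, add_comm y x, add_right_inj] at h1
    have h2 := hι h1
    have h3 := hμ (r x + r y)
    simp only [map_add, LinearMap.add_apply, hμ, zero_add, add_zero] at h3
    rw [← h2, ← two_nsmul] at h3
    exact (smul_eq_self_of_odd hodd h3).symm.trans (hpV _)
  · obtain ⟨k, hk, hk'⟩ := (Nat.dvd_prime_pow hp).mp (Monoid.exponent_dvd_of_forall_pow_eq_one hpp2)
    rw [hk']
    congr 1
    by_contra hne
    have h1 : Monoid.exponent W ∣ p := by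
      rw [hk']
      exact (pow_dvd_pow p (by omega : k ≤ 1)).trans (by rw [pow_one])
    obtain ⟨w, rfl⟩ := hr v₀
    have h2 := Monoid.exponent_dvd_iff_forall_pow_eq_one.mp h1 w
    rw [hpp, hone, map_eq_zero_iff ι hι] at h2
    exact hv₀ h2

end

section

open Module

theorem exists_zmod_inclusion (p : ℕ) [Fact p.Prime] :
    ∃ (ρ : ZMod (p ^ 2) →+* ZMod p) (j : ZMod p →+ ZMod (p ^ 2)), Function.Surjective ρ ∧
      Function.Injective j ∧ (∀ x, j (ρ x) = p • x) ∧ ∀ x, ρ x = 0 → ∃ a, x = j a := by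
  have hp : p.Prime := Fact.out
  let f : ℤ →+ ZMod (p ^ 2) := zmultiplesHom _ (p : ZMod (p ^ 2))
  have hf : ∀ k : ℤ, f k = ((k * p : ℤ) : ZMod (p ^ 2)) := fun k => by simp [f]
  let j : ZMod p →+ ZMod (p ^ 2) := ZMod.lift p ⟨f, by
    rw [hf, ZMod.intCast_zmod_eq_zero_iff_dvd]
    push_cast
    rw [sq]⟩
  have hj : ∀ k : ℤ, j (k : ZMod p) = ((k * p : ℤ) : ZMod (p ^ 2)) := fun k =>
    (ZMod.lift_coe p _ k).trans (hf k)
  let ρ : ZMod (p ^ 2) →+* ZMod p := ZMod.castHom (dvd_pow_self p two_ne_zero) (ZMod p)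
  refine ⟨ρ, j, ZMod.castHom_surjective _, ?_, ?_, ?_⟩
  · rw [injective_iff_map_eq_zero]
    intro a ha
    obtain ⟨k, rfl⟩ := ZMod.intCast_surjective a
    rw [hj, ZMod.intCast_zmod_eq_zero_iff_dvd] at ha
    push_cast at ha
    rw [sq] at ha
    rw [ZMod.intCast_zmod_eq_zero_iff_dvd]
    exact Int.dvd_of_mul_dvd_mul_right (by exact_mod_cast hp.ne_zero) ha
  · intro x
    obtain ⟨k, rfl⟩ := ZMod.intCast_surjective x
    rw [map_intCast, hj, nsmul_eq_mul]
    push_cast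
    ring
  · intro x hx
    obtain ⟨k, rfl⟩ := ZMod.intCast_surjective x
    rw [map_intCast, ZMod.intCast_zmod_eq_zero_iff_dvd] at hx
    obtain ⟨l, rfl⟩ := hx
    exact ⟨l, by rw [hj, mul_comm]⟩

theorem exists_ucs_group_of_autIrreducible {p : ℕ} [Fact p.Prime] (hodd : Odd p) {V : Type*}
    [AddCommGroup V] [Module (ZMod p) V] {μ : V →ₗ[ZMod p] V →ₗ[ZMod p] V}
    (hirr : AutIrreducible μ) (h0 : μ ≠ 0) (hμ : ∀ x, μ x x = 0)
    (hdim : finrank (ZMod p) V = 5) :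
    ∃ (G : Type) (_ : Group G) (_ : Finite G),
        (IsPGroup p G ∧ Nat.card {H : Subgroup G // H.Characteristic} = 3) ∧
        (¬ ∀ a b : G, a * b = b * a) ∧
        Monoid.exponent G = p ^ 2 ∧ Nat.card G = p ^ 10 := by
  have hp : p.Prime := Fact.out
  have : NeZero (p ^ 2) := ⟨pow_ne_zero 2 hp.ne_zero⟩
  have : FiniteDimensional (ZMod p) V := FiniteDimensional.of_finrank_pos (by omega)
  obtain ⟨ρ, j, hρ, hj, hjρ, hker⟩ := exists_zmod_inclusion p
  let e : V ≃ₗ[ZMod p] (Fin 5 → ZMod p) := (finBasisOfFinrankEq (ZMod p) V hdim).equivFun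
  let r₀ : (Fin 5 → ZMod (p ^ 2)) →+ (Fin 5 → ZMod p) := ρ.toAddMonoidHom.compLeft (Fin 5)
  let r : (Fin 5 → ZMod (p ^ 2)) →+ V := e.symm.toAddEquiv.toAddMonoidHom.comp r₀
  let ι : V →+ (Fin 5 → ZMod (p ^ 2)) := (j.compLeft (Fin 5)).comp e.toAddEquiv.toAddMonoidHom
  have her : ∀ w, e (r w) = fun i => ρ (w i) := fun w => e.apply_symm_apply _
  have hιa : ∀ v, ι v = fun i => j (e v i) := fun v => rfl
  have hr : Function.Surjective r := by
    intro v
    choose w hw using fun i => hρ (e v i)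
    refine ⟨w, e.injective ?_⟩
    rw [her]
    exact funext hw
  have hι : Function.Injective ι := fun u v huv =>
    e.injective (funext fun i => hj (congrFun huv i))
  have hιr : ∀ w, ι (r w) = p • w := by
    intro w
    rw [hιa, her]
    exact funext fun i => hjρ (w i)
  have hkerr : ∀ w, r w = 0 → ∃ v, w = ι v := by
    intro w hw
    have h1 := her w
    rw [hw, map_zero] at h1
    choose a ha using fun i => hker (w i) (congrFun h1 i).symm
    refine ⟨e.symm a, ?_⟩
    rw [hιa, e.apply_symm_apply]
    exact funext ha
  have hlift : ∀ h ∈ algAut μ, ∃ H : (Fin 5 → ZMod (p ^ 2)) ≃+ (Fin 5 → ZMod (p ^ 2)),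
      ∀ w, r (H w) = h (r w) := by
    intro h _
    let A : Matrix (Fin 5) (Fin 5) (ZMod p) :=
      LinearMap.toMatrix' (e.toLinearMap ∘ₗ h.toLinearMap ∘ₗ e.symm.toLinearMap)
    have hA : ∀ v, e (h v) = A.mulVec (e v) := by
      intro v
      rw [← Matrix.toLin'_apply, Matrix.toLin'_toMatrix']
      simp
    choose B hB using fun i k => hρ (A i k)
    have hBA : (Matrix.of B).map ρ = A := Matrix.ext hB
    let H : (Fin 5 → ZMod (p ^ 2)) →+ (Fin 5 → ZMod (p ^ 2)) :=
      (Matrix.mulVecLin (Matrix.of B)).toAddMonoidHom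
    have hH : ∀ w, r (H w) = h (r w) := by
      intro w
      apply e.injective
      rw [hA, her, her]
      funext i
      change ρ ((Matrix.of B).mulVec w i) = _
      rw [RingHom.map_mulVec, hBA]
      rfl
    have hHi : Function.Injective H := by
      rw [injective_iff_map_eq_zero]
      intro w hw
      have h1 : r w = 0 := by
        have := hH w
        rw [hw, map_zero] at this
        exact h.map_eq_zero_iff.mp this.symm
      obtain ⟨v, rfl⟩ := hkerr w h1
      obtain ⟨w, rfl⟩ := hr v
      rw [hιr, map_nsmul, ← hιr, hH, map_eq_zero_iff ι hι, h.map_eq_zero_iff] at hw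
      rw [hw, map_zero]
    exact ⟨AddEquiv.ofBijective H (Finite.injective_iff_bijective.mp hHi), hH⟩
  obtain ⟨i, h1, h2, h3⟩ :=
    exists_group_of_autIrreducible hodd hirr h0 hμ r hr ι hι hιr hkerr hlift
  refine ⟨_, i, inferInstance, h1, h2, h3, ?_⟩
  rw [Nat.card_fun, Nat.card_zmod, Nat.card_fin, ← pow_mul]

end

section

open Module

section Existence

theorem exists_pow_mod_eleven {p : ℕ} (h : (p : ZMod 11) ^ 5 = 1) (h1 : (p : ZMod 11) ≠ 1) :
    ∃ a b : ℕ, (p : ZMod 11) ^ a = 3 ∧ (p : ZMod 11) ^ b = 9 := by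
  have key : ∀ x : ZMod 11, x ^ 5 = 1 → x ≠ 1 →
      ∃ a b : Fin 5, x ^ (a : ℕ) = 3 ∧ x ^ (b : ℕ) = 9 := by decide
  obtain ⟨a, b, hab⟩ := key _ h h1
  exact ⟨a, b, hab⟩

variable {p : ℕ} [Fact p.Prime]

theorem exists_orderOf_eq_eleven {K : Type*} [Field K] [Finite K] {q : ℕ} (hq : Nat.card K = q)
    (hq1 : 1 ≤ q) (h : (q : ZMod 11) = 1) : ∃ ζ : Kˣ, orderOf ζ = 11 := by
  have : Fact (Nat.Prime 11) := ⟨by norm_num⟩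
  apply exists_prime_orderOf_dvd_card'
  rw [Nat.card_units, hq, ← ZMod.natCast_eq_zero_iff, Nat.cast_sub hq1, h, Nat.cast_one, sub_self]

/-- The `p ^ a`-th power map, as a linear map over the prime field. -/
noncomputable def frobeniusLinear (p : ℕ) [Fact p.Prime] (K : Type*) [Field K] [Algebra (ZMod p) K]
    [CharP K p] (a : ℕ) : K →ₗ[ZMod p] K :=
  (iterateFrobenius K p a).toAddMonoidHom.toZModLinearMap p

theorem eq_bot_or_eq_top_of_mul_mem {F K : Type*} [Field F] [Field K] [Algebra F K]
    (hprime : (finrank F K).Prime) {ζ : K} (hζ : ζ ∉ Set.range (algebraMap F K))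
    {W : Submodule F K} (hW : ∀ x ∈ W, ζ * x ∈ W) : W = ⊥ ∨ W = ⊤ := by
  let S : Subalgebra F K :=
    { carrier := {a | ∀ x ∈ W, a * x ∈ W}
      mul_mem' := fun {a b} ha hb x hx => by
        rw [mul_assoc]
        exact ha _ (hb x hx)
      add_mem' := fun {a b} ha hb x hx => by
        rw [add_mul]
        exact W.add_mem (ha x hx) (hb x hx)
      algebraMap_mem' := fun c x hx => by
        rw [← Algebra.smul_def]
        exact W.smul_mem c hx }
  have := Subalgebra.isSimpleOrder_of_finrank_prime F K hprime
  have hS : S = ⊤ := (eq_bot_or_eq_top S).resolve_left fun h => by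
    have h1 : ζ ∈ S := hW
    rw [h] at h1
    exact hζ (Algebra.mem_bot.mp h1)
  rw [or_iff_not_imp_left]
  intro hne
  obtain ⟨w, hw, hw0⟩ := W.ne_bot_iff.mp hne
  rw [eq_top_iff]
  intro x _
  have h1 : x / w ∈ S := hS ▸ Algebra.mem_top
  have := h1 w hw
  rwa [div_mul_cancel₀ _ hw0] at this

theorem exists_autIrreducible_of_order_five (h : (p : ZMod 11) ^ 5 = 1)
    (h1 : (p : ZMod 11) ≠ 1) :
    ∃ μ : GaloisField p 5 →ₗ[ZMod p] GaloisField p 5 →ₗ[ZMod p] GaloisField p 5,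
      AutIrreducible μ ∧ μ ≠ 0 ∧ ∀ x, μ x x = 0 := by
  have hp : p.Prime := Fact.out
  let K := GaloisField p 5
  have hdim : finrank (ZMod p) K = 5 := GaloisField.finrank p (by norm_num)
  obtain ⟨ζ, hζ⟩ := exists_orderOf_eq_eleven (K := K) (GaloisField.card p 5 (by norm_num))
    (Nat.one_le_pow _ _ hp.pos) (by push_cast; exact h)
  obtain ⟨a, b, ha, hb⟩ := exists_pow_mod_eleven h h1
  have hpow : ∀ m n : ℕ, ζ ^ m = ζ ^ n ↔ (m : ZMod 11) = n := by
    intro m n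
    rw [pow_inj_mod, hζ, ZMod.natCast_eq_natCast_iff, Nat.ModEq]
  have hpowK : ∀ m n : ℕ, (ζ : K) ^ m = ζ ^ n ↔ (m : ZMod 11) = n := by
    intro m n
    rw [← hpow, ← Units.val_pow_eq_pow_val, ← Units.val_pow_eq_pow_val, Units.val_inj]
  let σ := frobeniusLinear p K
  let μ : K →ₗ[ZMod p] K →ₗ[ZMod p] K := (LinearMap.mul (ZMod p) K).compl₁₂ (σ a) (σ b) -
    (LinearMap.mul (ZMod p) K).compl₁₂ (σ b) (σ a)
  have hμ : ∀ x y : K, μ x y = x ^ p ^ a * y ^ p ^ b - x ^ p ^ b * y ^ p ^ a := fun _ _ => rfl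
  have hζab : (ζ : K) ^ p ^ a * ζ ^ p ^ b = ζ := by
    rw [← pow_add]
    conv_rhs => rw [← pow_one (ζ : K)]
    rw [hpowK]
    push_cast
    rw [ha, hb]
    decide
  refine ⟨μ, ?_, ?_, ?_⟩
  · intro W hW
    refine eq_bot_or_eq_top_of_mul_mem (ζ := (ζ : K)) (by rw [hdim]; norm_num) ?_ ?_
    · rintro ⟨c, hc⟩
      have h2 : (ζ : K) ^ p = ζ ^ 1 := by
        rw [← hc, ← map_pow, ZMod.pow_card, pow_one]
      rw [hpowK, Nat.cast_one] at h2
      exact h1 h2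
    · let m : K ≃ₗ[ZMod p] K := DistribMulAction.toLinearEquiv (ZMod p) K ζ
      have hm : ∀ x, m x = ζ * x := fun _ => rfl
      have hmem : m ∈ algAut μ := by
        intro x y
        rw [hm, hm, hm, hμ, hμ]
        linear_combination -(x ^ p ^ a * y ^ p ^ b - x ^ p ^ b * y ^ p ^ a) * hζab
      exact fun x hx => hW m hmem x hx
  · intro h0
    have h2 := hμ 1 (ζ : K)
    rw [h0, one_pow, one_pow, one_mul, one_mul] at h2
    have h3 : (ζ : K) ^ p ^ b = ζ ^ p ^ a := sub_eq_zero.mp h2.symm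
    rw [hpowK] at h3
    push_cast at h3
    rw [ha, hb] at h3
    exact absurd h3 (by decide)
  · intro x
    rw [hμ, mul_comm, sub_self]

end Existence

end

section

open Module

section Existence

variable {p : ℕ} [Fact p.Prime]

theorem single_mem_of_diagonal_mem {K ι : Type*} [Field K] [DecidableEq ι] {n : ℕ}
    (hn : (n : K) ≠ 0) {c : ι → K} (hc : ∀ i, c i ^ n = 1) (hinj : Function.Injective c)
    {W : Submodule K (ι → K)} (hW : ∀ m : ℕ, ∀ x ∈ W, (fun i => c i ^ m * x i) ∈ W)
    {w : ι → K} (hw : w ∈ W) {k : ι} (hk : w k ≠ 0) : Pi.single k (1 : K) ∈ W := by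
  have hn0 : n ≠ 0 := by
    rintro rfl
    exact hn Nat.cast_zero
  have hc0 : c k ≠ 0 := by
    intro h0
    have := hc k
    rw [h0, zero_pow hn0] at this
    exact zero_ne_one this
  have h1 : ∑ m ∈ Finset.range n, (c k)⁻¹ ^ m • (fun i => c i ^ m * w i) ∈ W :=
    W.sum_mem fun m _ => W.smul_mem _ (hW m w hw)
  have h2 : Pi.single k (1 : K) = ((n : K) * w k)⁻¹ •
      ∑ m ∈ Finset.range n, (c k)⁻¹ ^ m • (fun i => c i ^ m * w i) := by
    ext i
    rw [Pi.smul_apply, Finset.sum_apply]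
    simp only [Pi.smul_apply, smul_eq_mul, ← mul_assoc, ← mul_pow, ← Finset.sum_mul]
    by_cases hi : i = k
    · subst hi
      simp [inv_mul_cancel₀ hc0]
      field_simp
    · have h3 : (c k)⁻¹ * c i ≠ 1 := by
        intro h
        rw [inv_mul_eq_one₀ hc0] at h
        exact hi (hinj h.symm)
      have h4 : ∑ m ∈ Finset.range n, ((c k)⁻¹ * c i) ^ m = 0 := by
        rw [geom_sum_eq h3, mul_pow, inv_pow, hc, hc]
        simp
      rw [h4, Pi.single_eq_of_ne hi]
      simp
  rw [h2]
  exact W.smul_mem _ h1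

/-- The algebra with basis indexed by `ZMod 5` in which the product of the basis vectors at `i + 1`
and `i + 2` is the one at `i`. -/
def cyclicAlgebra (K : Type*) [Field K] : (ZMod 5 → K) →ₗ[K] (ZMod 5 → K) →ₗ[K] (ZMod 5 → K) :=
  LinearMap.mk₂ K (fun x y i => x (i + 1) * y (i + 2) - x (i + 2) * y (i + 1))
    (fun x y z => by ext i; simp only [Pi.add_apply]; ring)
    (fun c x y => by ext i; simp only [Pi.smul_apply, smul_eq_mul]; ring)
    (fun x y z => by ext i; simp only [Pi.add_apply]; ring)
    (fun c x y => by ext i; simp only [Pi.smul_apply, smul_eq_mul]; ring)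

theorem cyclicAlgebra_apply {K : Type*} [Field K] (x y : ZMod 5 → K) (i : ZMod 5) :
    cyclicAlgebra K x y i = x (i + 1) * y (i + 2) - x (i + 2) * y (i + 1) := rfl

theorem cyclicAlgebra_self {K : Type*} [Field K] (x : ZMod 5 → K) :
    cyclicAlgebra K x x = 0 := by
  ext i
  rw [cyclicAlgebra_apply, Pi.zero_apply]
  ring

theorem cyclicAlgebra_ne_zero (K : Type*) [Field K] : cyclicAlgebra K ≠ 0 := by
  intro h
  have h1 := cyclicAlgebra_apply (Pi.single 1 (1 : K)) (Pi.single 2 (1 : K)) 0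
  rw [h] at h1
  have h2 : (2 : ZMod 5) ≠ 1 := by decide
  simp [h2] at h1

theorem autIrreducible_cyclicAlgebra {K : Type*} [Field K] {ζ : Kˣ} (hζ : orderOf ζ = 11)
    (h11 : (11 : K) ≠ 0) : AutIrreducible (cyclicAlgebra K) := by
  intro W hW
  let d : ZMod 5 → ℕ := ![1, 3, 9, 5, 4]
  have hd : ∀ i, (d (i + 1) + d (i + 2)) % 11 = d i % 11 := by decide
  have hdi : ∀ i j, d i % 11 = d j % 11 → i = j := by decide
  have hmul : ∀ i, (ζ ^ d (i + 1) * ζ ^ d (i + 2) : Kˣ) = ζ ^ d i := by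
    intro i
    rw [← pow_add, pow_inj_mod, hζ, hd]
  let D : (ZMod 5 → K) ≃ₗ[K] (ZMod 5 → K) :=
    LinearEquiv.piCongrRight fun i => DistribMulAction.toLinearEquiv K K (ζ ^ d i)
  have hDx : ∀ x i, D x i = (ζ ^ d i : Kˣ) * x i := fun _ _ => rfl
  have hD : D ∈ algAut (cyclicAlgebra K) := by
    intro x y
    ext i
    rw [hDx, cyclicAlgebra_apply, cyclicAlgebra_apply, hDx, hDx, hDx, hDx, ← hmul, Units.val_mul]
    ring
  let S : (ZMod 5 → K) ≃ₗ[K] (ZMod 5 → K) :=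
    LinearEquiv.funCongrLeft K K (Equiv.addRight (1 : ZMod 5))
  have hSx : ∀ x i, S x i = x (i + 1) := fun _ _ => rfl
  have hS : S ∈ algAut (cyclicAlgebra K) := by
    intro x y
    ext i
    rw [hSx, cyclicAlgebra_apply, cyclicAlgebra_apply, hSx, hSx, hSx, hSx, add_right_comm i 1 2]
  have hDm : ∀ (m : ℕ) x i, (D ^ m) x i = ((ζ ^ d i : Kˣ) : K) ^ m * x i := by
    intro m x i
    induction m with
    | zero => simp
    | succ m ih => rw [pow_succ', LinearEquiv.mul_apply, hDx, ih, pow_succ', mul_assoc]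
  rw [or_iff_not_imp_left]
  intro hne
  obtain ⟨w, hw, hw0⟩ := W.ne_bot_iff.mp hne
  obtain ⟨k, hk⟩ := Function.ne_iff.mp hw0
  have hs : Pi.single k (1 : K) ∈ W := by
    refine single_mem_of_diagonal_mem (n := 11) (by exact_mod_cast h11)
      (c := fun i => ((ζ ^ d i : Kˣ) : K)) ?_ ?_ ?_ hw hk
    · intro i
      rw [← Units.val_pow_eq_pow_val, pow_right_comm, ← hζ, pow_orderOf_eq_one, one_pow,
        Units.val_one]
    · intro i j hij
      have := Units.val_injective hij
      rw [pow_inj_mod, hζ] at this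
      exact hdi i j this
    · intro m x hx
      rw [← funext (hDm m x)]
      exact hW _ (Subgroup.pow_mem _ hD m) x hx
  have hSk : ∀ k : ZMod 5, S (Pi.single k 1) = Pi.single (k - 1) 1 := by
    intro k
    ext i
    rw [hSx, Pi.single_apply, Pi.single_apply]
    simp only [eq_sub_iff_add_eq]
  have hall : ∀ n : ℕ, Pi.single (k - n) (1 : K) ∈ W := by
    intro n
    induction n with
    | zero => simpa using hs
    | succ n ih =>
      have := hW S hS _ ih
      rwa [hSk, sub_sub, ← Nat.cast_succ] at this
  have hall' : ∀ i, Pi.single i (1 : K) ∈ W := by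
    intro i
    have := hall (k - i).val
    rwa [ZMod.natCast_zmod_val, sub_sub_cancel] at this
  rw [eq_top_iff]
  intro x _
  have hx : x = ∑ i, x i • Pi.single i (1 : K) := by
    ext j
    simp [Finset.sum_apply, Pi.single_apply]
  rw [hx]
  exact W.sum_mem fun i _ => W.smul_mem _ (hall' i)

theorem exists_ucs_group_of_pow_five_eq_one (hodd : Odd p) (h : (p : ZMod 11) ^ 5 = 1) :
    ∃ (G : Type) (_ : Group G) (_ : Finite G),
        (IsPGroup p G ∧ Nat.card {H : Subgroup G // H.Characteristic} = 3) ∧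
        (¬ ∀ a b : G, a * b = b * a) ∧
        Monoid.exponent G = p ^ 2 ∧ Nat.card G = p ^ 10 := by
  by_cases h1 : (p : ZMod 11) = 1
  · have hp : p.Prime := Fact.out
    obtain ⟨ζ, hζ⟩ := exists_orderOf_eq_eleven (Nat.card_zmod p) hp.one_le h1
    have h11 : (11 : ZMod p) ≠ 0 := by
      intro h0
      have h0 : ((11 : ℕ) : ZMod p) = 0 := by exact_mod_cast h0
      rw [ZMod.natCast_eq_zero_iff, Nat.prime_dvd_prime_iff_eq hp (by norm_num)] at h0
      rw [h0] at h1
      exact absurd h1 (by decide)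
    exact exists_ucs_group_of_autIrreducible hodd (autIrreducible_cyclicAlgebra hζ h11)
      (cyclicAlgebra_ne_zero _) cyclicAlgebra_self (by simp [ZMod.card])
  · obtain ⟨μ, hirr, h0, hμ⟩ := exists_autIrreducible_of_order_five h h1
    exact exists_ucs_group_of_autIrreducible hodd hirr h0 hμ (GaloisField.finrank p (by norm_num))

end Existence

end

theorem stmt19 (p : ℕ) (hp : p.Prime) (hodd : Odd p) :
    (∃ (G : Type) (_ : Group G) (_ : Finite G),
        IsUCS p G ∧ (¬ ∀ a b : G, a * b = b * a) ∧
        Monoid.exponent G = p ^ 2 ∧ Nat.card G = p ^ 10) ↔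
      p ^ 5 % 11 = 1 := by
  have : Fact p.Prime := ⟨hp⟩
  have key : (p : ZMod 11) ^ 5 = 1 ↔ p ^ 5 % 11 = 1 := by
    have := ZMod.natCast_eq_natCast_iff (p ^ 5) 1 11
    rwa [Nat.cast_pow, Nat.cast_one, Nat.ModEq] at this
  rw [← key]
  refine ⟨?_, exists_ucs_group_of_pow_five_eq_one hodd⟩
  rintro ⟨G, _, _, ⟨hG, h3⟩, hcomm, hexp, hcard⟩
  exact pow_five_eq_one_of_characteristic hodd hG h3 hcomm hexp hcard
end
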